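/- Let H be a free group, let u, v ∈ H be nontrivial elements neither of which is a proper power in H, and assume u is not conjugate in H to v or to v⁻¹. Let G = ⟨H, t | tut⁻¹ = v⟩ be the HNN extension of H associated to the isomorphism of the infinite cyclic subgroups ⟨u⟩ ≅ ⟨v⟩ sending u to v. Then every subgroup of G generated by at most 3 elements is either a free group of rank at most 3, or has a one-relator presentation on three generators, i.e. is isomorphic to a presented group ⟨x₁, x₂, x₃ | r⟩ for some element r of the free group on three generators. -/

import Mathlib

/-- An element of a group is a proper power if it equals `y ^ k` for some
element `y` and some integer `k ≥ 2`. -/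
def IsProperPower {G : Type*} [Group G] (x : G) : Prop :=
  ∃ (y : G) (k : ℕ), 2 ≤ k ∧ y ^ k = x

set_option linter.unusedSectionVars false

/-- Free groups are residually finite. -/
theorem FreeGroup.exists_hom_perm_ne_one {α : Type} (w : FreeGroup α) (hw : w ≠ 1) :
    ∃ (S : Type) (_ : Finite S) (f : FreeGroup α →* Equiv.Perm S), f w ≠ 1 := by
  classical
  let T : Set (FreeGroup α) := {s | ∃ L ∈ w.toWord.tails, s = FreeGroup.mk L}
  have hT : T.Finite := by
    have : T = (fun L => FreeGroup.mk L) '' {L | L ∈ w.toWord.tails} := by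
      ext s; simp only [T, Set.mem_ofPred_eq, Set.mem_image]
      exact ⟨fun ⟨L, h, e⟩ => ⟨L, h, e.symm⟩, fun ⟨L, h, e⟩ => ⟨L, h, e.symm⟩⟩
    rw [this]
    exact (List.finite_toSet _).image _
  have : Finite T := hT
  let e (x : α) : {s : T // FreeGroup.of x * s.1 ∈ T} ≃ {s : T // (FreeGroup.of x)⁻¹ * s.1 ∈ T} :=
    { toFun := fun s => ⟨⟨FreeGroup.of x * s.1.1, s.2⟩, by simp⟩
      invFun := fun s => ⟨⟨(FreeGroup.of x)⁻¹ * s.1.1, s.2⟩, by simp⟩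
      left_inv := fun s => by simp
      right_inv := fun s => by simp }
  let f : FreeGroup α →* Equiv.Perm T := FreeGroup.lift fun x => (e x).extendSubtype
  have h1T : (1 : FreeGroup α) ∈ T := ⟨[], by simp, rfl⟩
  have key : ∀ (L : List (α × Bool)), L ∈ w.toWord.tails →
      (f (FreeGroup.mk L) ⟨1, h1T⟩ : FreeGroup α) = FreeGroup.mk L := by
    intro L
    induction L with
    | nil => intro _; simp [← FreeGroup.one_eq_mk]
    | cons a L ih =>
      intro hL
      have hL' : L ∈ w.toWord.tails := by
        rw [List.mem_tails] at hL ⊢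
        exact (List.suffix_cons a L).trans hL
      have hf := ih hL'
      have hm : FreeGroup.mk (a :: L) ∈ T := ⟨_, hL, rfl⟩
      obtain ⟨x, b⟩ := a
      have hc : FreeGroup.mk ((x, b) :: L) = FreeGroup.mk [(x, b)] * FreeGroup.mk L := by
        rw [FreeGroup.mul_mk]; rfl
      rw [hc] at hm ⊢
      rw [_root_.map_mul, Equiv.Perm.mul_apply]
      have h : FreeGroup.mk L ∈ T := ⟨_, hL', rfl⟩
      have hf' : f (FreeGroup.mk L) ⟨1, h1T⟩ = ⟨FreeGroup.mk L, h⟩ := Subtype.ext hf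
      rw [hf']
      cases b with
      | true =>
        have h1 : FreeGroup.mk [(x, true)] = FreeGroup.of x := rfl
        rw [h1] at hm ⊢
        have := Equiv.extendSubtype_apply_of_mem (e x) ⟨FreeGroup.mk L, h⟩ hm
        simp only [f, FreeGroup.lift_apply_of]
        rw [this]
        rfl
      | false =>
        have h1 : FreeGroup.mk [(x, false)] = (FreeGroup.of x)⁻¹ := rfl
        rw [h1] at hm ⊢
        have := Equiv.extendSubtype_apply_of_mem (e x) ⟨(FreeGroup.of x)⁻¹ * FreeGroup.mk L, hm⟩
          (by simpa using h)
        have h2 : (f (FreeGroup.of x)⁻¹) ⟨FreeGroup.mk L, h⟩ =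
            ⟨(FreeGroup.of x)⁻¹ * FreeGroup.mk L, hm⟩ := by
          simp only [f, _root_.map_inv, FreeGroup.lift_apply_of]
          rw [Equiv.Perm.inv_eq_iff_eq, this]
          simp [e]
        rw [h2]
  have hf := key w.toWord (by simp)
  refine ⟨T, inferInstance, f, fun h0 => hw ?_⟩
  rw [FreeGroup.mk_toWord, h0] at hf
  exact hf.symm

/-- Free groups of finite rank are Hopfian. -/
theorem FreeGroup.injective_of_surjective {α : Type} [Finite α]
    (φ : FreeGroup α →* FreeGroup α) (hφ : Function.Surjective φ) : Function.Injective φ := by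
  rw [injective_iff_map_eq_one]
  intro w hw
  by_contra hw1
  obtain ⟨S, _, f, hf⟩ := w.exists_hom_perm_ne_one hw1
  have : Finite (FreeGroup α →* Equiv.Perm S) :=
    Finite.of_equiv (α → Equiv.Perm S) FreeGroup.lift
  have hinj : Function.Injective
      (fun g : FreeGroup α →* Equiv.Perm S => g.comp φ) := fun g g' h => by
    ext1 x
    obtain ⟨y, hy⟩ := hφ (FreeGroup.of x)
    rw [← hy]
    exact DFunLike.congr_fun h y
  obtain ⟨g, hg⟩ := Finite.surjective_of_injective hinj f
  apply hf
  rw [← hg]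
  simp [hw]

/-- `GenBy Q n`: the subgroup `Q` is generated by `n` elements. -/
def GenBy {P : Type} [Group P] (Q : Subgroup P) (n : ℕ) : Prop :=
  ∃ f : Fin n → P, Subgroup.closure (Set.range f) = Q

section GenBy
variable {P : Type} [Group P] {Q R : Subgroup P} {m n : ℕ}

theorem GenBy.of_fintype {ι : Type} [Finite ι] (f : ι → P)
    (hf : Subgroup.closure (Set.range f) = Q) (h : Nat.card ι ≤ n) : GenBy Q n := by
  obtain ⟨k, rfl⟩ := Nat.exists_eq_add_of_le h
  refine ⟨fun i => Fin.addCases (motive := fun _ => P)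
    (fun j => f ((Finite.equivFin ι).symm j)) (fun _ => 1) i, ?_⟩
  rw [← hf]
  apply le_antisymm
  · rw [Subgroup.closure_le]
    rintro _ ⟨i, rfl⟩
    refine Fin.addCases (fun j => ?_) (fun j => ?_) i
    · simp only [Fin.addCases_left]
      exact Subgroup.subset_closure ⟨_, rfl⟩
    · simp [one_mem]
  · rw [Subgroup.closure_le]
    rintro _ ⟨i, rfl⟩
    refine Subgroup.subset_closure ⟨Fin.castAdd k (Finite.equivFin ι i), ?_⟩
    simp

theorem GenBy.mono (h : GenBy Q m) (hmn : m ≤ n) : GenBy Q n := by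
  obtain ⟨f, hf⟩ := h
  exact GenBy.of_fintype f hf (by simpa using hmn)

theorem GenBy.bot : GenBy (⊥ : Subgroup P) 0 := ⟨fun _ => 1, by
  rw [Set.range_eq_empty, Subgroup.closure_empty]⟩

theorem GenBy.zpowers (x : P) : GenBy (Subgroup.zpowers x) 1 := ⟨fun _ => x, by
  rw [Set.range_const, Subgroup.zpowers_eq_closure]⟩

theorem GenBy.sup (hQ : GenBy Q m) (hR : GenBy R n) : GenBy (Q ⊔ R) (m + n) := by
  obtain ⟨f, rfl⟩ := hQ
  obtain ⟨g, rfl⟩ := hR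
  refine GenBy.of_fintype (Sum.elim f g) ?_ (by simp)
  rw [Set.Sum.elim_range, Subgroup.closure_union]

theorem GenBy.map {P' : Type} [Group P'] (hQ : GenBy Q m) (ψ : P →* P') :
    GenBy (Q.map ψ) m := by
  obtain ⟨f, rfl⟩ := hQ
  exact ⟨ψ ∘ f, by rw [Set.range_comp, MonoidHom.map_closure]⟩

theorem GenBy.of_map {P' : Type} [Group P'] (ψ : P →* P') (hψ : Function.Injective ψ)
    (hQ : GenBy (Q.map ψ) m) : GenBy Q m := by
  obtain ⟨f, hf⟩ := hQ
  have : ∀ i, ∃ x, x ∈ Q ∧ ψ x = f i := fun i => by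
    have : f i ∈ Q.map ψ := hf ▸ Subgroup.subset_closure ⟨i, rfl⟩
    simpa using this
  choose g hg hgf using this
  refine ⟨g, Subgroup.map_injective hψ ?_⟩
  rw [MonoidHom.map_closure, ← Set.range_comp, ← hf]
  congr 2
  ext i; exact hgf i

theorem GenBy.eq_bot (hQ : GenBy Q 0) : Q = ⊥ := by
  obtain ⟨f, rfl⟩ := hQ
  rw [Set.range_eq_empty, Subgroup.closure_empty]

theorem GenBy.eq_zpowers (hQ : GenBy Q 1) : ∃ x, Q = Subgroup.zpowers x := by
  obtain ⟨f, rfl⟩ := hQ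
  exact ⟨f 0, by rw [Set.range_unique, Subgroup.zpowers_eq_closure]; rfl⟩

theorem range_lift_eq_closure {ι : Type} (f : ι → P) :
    (FreeGroup.lift f).range = Subgroup.closure (Set.range f) := by
  rw [FreeGroup.range_lift_eq_closure]

/-- A free group with a surjection from a free group of finite rank `n` has a basis of
cardinality at most `n`. -/
theorem exists_basis_le {F : Type} [Group F] [IsFreeGroup F] {ι : Type} [Finite ι]
    (π : FreeGroup ι →* F) (hπ : Function.Surjective π) :
    ∃ m, m ≤ Nat.card ι ∧ Nonempty (F ≃* FreeGroup (Fin m)) := by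
  classical
  let J := IsFreeGroup.Generators F
  let e : F ≃* FreeGroup J := IsFreeGroup.toFreeGroup F
  let Z := Multiplicative (ZMod 2)
  let Φ : (J → Z) → (ι → Z) := fun c i => FreeGroup.lift c (e (π (FreeGroup.of i)))
  have hΦ : Function.Injective Φ := by
    intro c c' h
    have h1 : (FreeGroup.lift c).comp (e.toMonoidHom.comp π) =
        (FreeGroup.lift c').comp (e.toMonoidHom.comp π) := by
      ext i
      exact congrFun h i
    funext j
    obtain ⟨y, hy⟩ := hπ (e.symm (FreeGroup.of j))
    have h2 := DFunLike.congr_fun h1 y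
    simpa [hy] using h2
  have hfin : Finite (J → Z) := Finite.of_injective Φ hΦ
  have hJ : Finite J := by
    let a : Z := Multiplicative.ofAdd 1
    have ha : a ≠ 1 := by decide
    refine Finite.of_injective (fun j : J => (fun k => if k = j then a else 1 : J → Z)) ?_
    intro j j' h
    by_contra hne
    have := congrFun h j
    simp [hne, ha] at this
  refine ⟨Nat.card J, ?_, ⟨e.trans (FreeGroup.freeGroupCongr (Finite.equivFin J))⟩⟩
  have hc := Nat.card_le_card_of_injective Φ hΦ
  rw [Nat.card_fun, Nat.card_fun] at hc
  have hZ : Nat.card Z = 2 := by simp [Z]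
  rw [hZ] at hc
  exact (Nat.pow_le_pow_iff_right (by norm_num)).1 hc

/-- A free group generated by finitely many elements subject to a nontrivial relation is
generated by fewer elements. -/
theorem genBy_of_relation [IsFreeGroup Q] {ι : Type} [Finite ι] (f : ι → P)
    (hf : Subgroup.closure (Set.range f) = Q) (w : FreeGroup ι) (hw : w ≠ 1)
    (hw1 : FreeGroup.lift f w = 1) : GenBy Q (Nat.card ι - 1) := by
  let π : FreeGroup ι →* Q := (FreeGroup.lift f).codRestrict Q fun x => by
    rw [← hf, ← FreeGroup.range_lift_eq_closure]; exact ⟨x, rfl⟩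
  have hπ : Function.Surjective π := by
    rintro ⟨q, hq⟩
    rw [← hf, ← FreeGroup.range_lift_eq_closure] at hq
    obtain ⟨x, hx⟩ := hq
    exact ⟨x, Subtype.ext hx⟩
  obtain ⟨m, hm, ⟨e⟩⟩ := exists_basis_le π hπ
  have hlt : m ≠ Nat.card ι := by
    rintro rfl
    let e' : Q ≃* FreeGroup ι := e.trans (FreeGroup.freeGroupCongr (Finite.equivFin ι).symm)
    have h1 : Function.Surjective (e'.toMonoidHom.comp π) :=
      e'.surjective.comp hπ
    have := FreeGroup.injective_of_surjective _ h1
    apply hw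
    apply this
    have : π w = 1 := Subtype.ext hw1
    simp [this]
  refine GenBy.of_fintype (fun i => (e.symm (FreeGroup.of i) : P)) ?_
    (show Nat.card (Fin m) ≤ _ by simp; omega)
  have : (fun i => (e.symm (FreeGroup.of i) : P)) = Q.subtype ∘ e.symm ∘ FreeGroup.of := rfl
  rw [this, Set.range_comp, Set.range_comp, ← MonoidHom.map_closure]
  have h2 : Subgroup.closure (e.symm '' Set.range FreeGroup.of) = ⊤ := by
    have := MonoidHom.map_closure e.symm.toMonoidHom (Set.range (FreeGroup.of : Fin m → _))
    rw [FreeGroup.closure_range_of] at this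
    exact this.symm.trans (Subgroup.map_top_of_surjective _ e.symm.surjective)
  rw [h2, ← MonoidHom.range_eq_map, Subgroup.range_subtype]

end GenBy

section FreeRelations

theorem isReduced_append_of_fst_ne {α : Type} {L₁ L₂ : List (α × Bool)}
    (h₁ : FreeGroup.IsReduced L₁) (h₂ : FreeGroup.IsReduced L₂)
    (h : ∀ p ∈ L₁, ∀ q ∈ L₂, p.1 ≠ q.1) : FreeGroup.IsReduced (L₁ ++ L₂) := by
  rw [FreeGroup.IsReduced, List.isChain_append]
  exact ⟨h₁, h₂, fun p hp q hq e =>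
    absurd e (h p (List.mem_of_mem_getLast? hp) q (List.mem_of_mem_head? hq))⟩

theorem mk_ne_mk_of_isReduced {α : Type} {L₁ L₂ : List (α × Bool)}
    (h₁ : FreeGroup.IsReduced L₁) (h₂ : FreeGroup.IsReduced L₂) (h : L₁ ≠ L₂) :
    FreeGroup.mk L₁ ≠ FreeGroup.mk L₂ := by
  classical
  intro e
  have := congrArg FreeGroup.toWord e
  rw [FreeGroup.toWord_mk, FreeGroup.toWord_mk, h₁.reduce_eq, h₂.reduce_eq] at this
  exact h this

theorem isReduced_map_of_injective {α β : Type} {L : List (α × Bool)} (f : α → β)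
    (hf : Function.Injective f) (h : FreeGroup.IsReduced L) :
    FreeGroup.IsReduced (L.map fun x => (f x.1, x.2)) := by
  rw [FreeGroup.IsReduced, List.isChain_map]
  exact List.IsChain.imp (fun a b hab e => hab (hf e)) h

theorem exists_mk_of_ne_one {α : Type} (w : FreeGroup α) (hw : w ≠ 1) :
    ∃ p L, FreeGroup.mk (p :: L) = w ∧ FreeGroup.IsReduced (p :: L) := by
  classical
  rcases h : w.toWord with _ | ⟨p, L⟩
  · exact absurd (FreeGroup.toWord_eq_nil_iff.1 h) hw
  · exact ⟨p, L, by rw [← h, FreeGroup.mk_toWord], h ▸ FreeGroup.isReduced_toWord⟩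

theorem map_inl_mul_map_inr_ne {α β : Type} (x : FreeGroup α) (y : FreeGroup β)
    (hx : x ≠ 1) (hy : y ≠ 1) :
    FreeGroup.map Sum.inl x * FreeGroup.map Sum.inr y ≠
      FreeGroup.map Sum.inr y * FreeGroup.map Sum.inl x := by
  obtain ⟨p, L, rfl, hL⟩ := exists_mk_of_ne_one x hx
  obtain ⟨q, M, rfl, hM⟩ := exists_mk_of_ne_one y hy
  rw [FreeGroup.map.mk, FreeGroup.map.mk, FreeGroup.mul_mk, FreeGroup.mul_mk]
  apply mk_ne_mk_of_isReduced
  · apply isReduced_append_of_fst_ne (isReduced_map_of_injective _ Sum.inl_injective hL)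
      (isReduced_map_of_injective _ Sum.inr_injective hM)
    intro a ha b hb
    obtain ⟨_, _, rfl⟩ := List.mem_map.1 ha
    obtain ⟨_, _, rfl⟩ := List.mem_map.1 hb
    simp
  · apply isReduced_append_of_fst_ne (isReduced_map_of_injective _ Sum.inr_injective hM)
      (isReduced_map_of_injective _ Sum.inl_injective hL)
    intro a ha b hb
    obtain ⟨_, _, rfl⟩ := List.mem_map.1 ha
    obtain ⟨_, _, rfl⟩ := List.mem_map.1 hb
    simp
  · simp

theorem map_some_mul_conj_ne {α : Type} (x y : FreeGroup α) (hx : x ≠ 1) (hy : y ≠ 1) :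
    FreeGroup.map some x * (FreeGroup.of none * FreeGroup.map some y * (FreeGroup.of none)⁻¹) ≠
      FreeGroup.of none * FreeGroup.map some y * (FreeGroup.of none)⁻¹ *
        FreeGroup.map some x := by
  obtain ⟨p, L, rfl, hL⟩ := exists_mk_of_ne_one x hx
  obtain ⟨q, M, rfl, hM⟩ := exists_mk_of_ne_one y hy
  have h1 : (FreeGroup.of (none : Option α)) = FreeGroup.mk [(none, true)] := rfl
  rw [FreeGroup.map.mk, FreeGroup.map.mk, h1, FreeGroup.inv_mk, FreeGroup.mul_mk,
    FreeGroup.mul_mk, FreeGroup.mul_mk, FreeGroup.mul_mk]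
  have hL' := isReduced_map_of_injective _ (Option.some_injective α) hL
  have hM' := isReduced_map_of_injective _ (Option.some_injective α) hM
  have hone : ∀ b : Bool, FreeGroup.IsReduced [((none : Option α), b)] :=
    fun b => FreeGroup.IsReduced.singleton
  have hmid : FreeGroup.IsReduced
      ([((none : Option α), true)] ++ List.map (fun x => (some x.1, x.2)) (q :: M) ++
        FreeGroup.invRev [(none, true)]) := by
    rw [FreeGroup.IsReduced, List.isChain_append]
    refine ⟨?_, hone false, ?_⟩
    · apply isReduced_append_of_fst_ne (hone true) hM'
      intro a ha b hb
      obtain ⟨_, _, rfl⟩ := List.mem_map.1 hb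
      rw [List.mem_singleton.1 ha]
      simp
    · intro a ha b hb e
      rw [List.getLast?_append_of_ne_nil _ (by simp)] at ha
      obtain ⟨_, _, rfl⟩ := List.mem_map.1 (List.mem_of_mem_getLast? ha)
      simp [FreeGroup.invRev] at hb
      subst hb
      simp at e
  apply mk_ne_mk_of_isReduced
  · rw [FreeGroup.IsReduced, List.isChain_append]
    refine ⟨hL', hmid, ?_⟩
    intro a ha b hb e
    obtain ⟨_, _, rfl⟩ := List.mem_map.1 (List.mem_of_mem_getLast? ha)
    simp at hb
    subst hb
    simp at e
  · rw [FreeGroup.IsReduced, List.isChain_append]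
    refine ⟨hmid, hL', ?_⟩
    intro a ha b hb e
    obtain ⟨_, _, rfl⟩ := List.mem_map.1 (List.mem_of_mem_head? hb)
    rw [List.getLast?_append_of_ne_nil _ (by simp [FreeGroup.invRev])] at ha
    simp [FreeGroup.invRev] at ha
    subst ha
    simp at e
  · simp

variable {P : Type} [Group P] {A B : Subgroup P} {m n : ℕ}

theorem exists_lift_eq {ι : Type} {f : ι → P} {a : P}
    (ha : a ∈ Subgroup.closure (Set.range f)) : ∃ w, FreeGroup.lift f w = a := by
  rwa [← FreeGroup.range_lift_eq_closure] at ha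

theorem GenBy.sup_of_commute (hA : GenBy A m) (hB : GenBy B n) [IsFreeGroup (A ⊔ B : Subgroup P)]
    {a b : P} (ha : a ∈ A) (hb : b ∈ B) (ha1 : a ≠ 1) (hb1 : b ≠ 1) (hab : a * b = b * a) :
    GenBy (A ⊔ B) (m + n - 1) := by
  obtain ⟨f, rfl⟩ := hA
  obtain ⟨g, rfl⟩ := hB
  obtain ⟨x, rfl⟩ := exists_lift_eq ha
  obtain ⟨y, rfl⟩ := exists_lift_eq hb
  have hx : x ≠ 1 := by rintro rfl; simp at ha1
  have hy : y ≠ 1 := by rintro rfl; simp at hb1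
  have := genBy_of_relation (Q := Subgroup.closure (Set.range f) ⊔ Subgroup.closure (Set.range g))
    (Sum.elim f g) (by rw [Set.Sum.elim_range, Subgroup.closure_union])
    (FreeGroup.map Sum.inl x * FreeGroup.map Sum.inr y *
      (FreeGroup.map Sum.inr y * FreeGroup.map Sum.inl x)⁻¹)
    (by rw [Ne, mul_inv_eq_one]; exact map_inl_mul_map_inr_ne x y hx hy)
    (by
      have h1 : ∀ z, FreeGroup.lift (Sum.elim f g) (FreeGroup.map Sum.inl z) =
          FreeGroup.lift f z := fun z => by
        rw [← MonoidHom.comp_apply]; congr 1; ext; simp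
      have h2 : ∀ z, FreeGroup.lift (Sum.elim f g) (FreeGroup.map Sum.inr z) =
          FreeGroup.lift g z := fun z => by
        rw [← MonoidHom.comp_apply]; congr 1; ext; simp
      rw [map_mul, map_inv, map_mul, map_mul, h1, h2, hab, mul_inv_cancel])
  simpa using this

theorem GenBy.sup_zpowers_of_commute (hA : GenBy A m) (z : P)
    [IsFreeGroup (A ⊔ Subgroup.zpowers z : Subgroup P)]
    {a b : P} (ha : a ∈ A) (hb : b ∈ A) (ha1 : a ≠ 1) (hb1 : b ≠ 1)
    (hab : a * (z * b * z⁻¹) = z * b * z⁻¹ * a) :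
    GenBy (A ⊔ Subgroup.zpowers z) m := by
  obtain ⟨f, rfl⟩ := hA
  obtain ⟨x, rfl⟩ := exists_lift_eq ha
  obtain ⟨y, rfl⟩ := exists_lift_eq hb
  have hx : x ≠ 1 := by rintro rfl; simp at ha1
  have hy : y ≠ 1 := by rintro rfl; simp at hb1
  have := genBy_of_relation (Q := Subgroup.closure (Set.range f) ⊔ Subgroup.zpowers z)
    (fun o : Option (Fin m) => o.elim z f)
    (by
      have : Set.range (fun o : Option (Fin m) => o.elim z f) = Set.range f ∪ {z} := by
        ext x; constructor
        · rintro ⟨_ | i, rfl⟩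
          · right; rfl
          · left; exact ⟨i, rfl⟩
        · rintro (⟨i, rfl⟩ | rfl)
          · exact ⟨some i, rfl⟩
          · exact ⟨none, rfl⟩
      rw [this, Subgroup.closure_union, Subgroup.zpowers_eq_closure])
    (FreeGroup.map some x * (FreeGroup.of none * FreeGroup.map some y * (FreeGroup.of none)⁻¹) *
      (FreeGroup.of none * FreeGroup.map some y * (FreeGroup.of none)⁻¹ *
        FreeGroup.map some x)⁻¹)
    (by rw [Ne, mul_inv_eq_one]; exact map_some_mul_conj_ne x y hx hy)
    (by
      have h1 : ∀ w, FreeGroup.lift (fun o : Option (Fin m) => o.elim z f)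
          (FreeGroup.map some w) = FreeGroup.lift f w := fun z => by
        rw [← MonoidHom.comp_apply]; congr 1; ext; simp
      simp only [map_mul, map_inv, h1, FreeGroup.lift_apply_of, Option.elim_none]
      rw [hab, mul_inv_cancel])
  simpa using this

end FreeRelations

section FreePowers
variable {F : Type} [Group F] [IsFreeGroup F]

instance (Q : Subgroup F) : IsFreeGroup Q := inferInstance

theorem exists_zpowers_of_relation (x y : F) (w : FreeGroup Bool) (hw : w ≠ 1)
    (h : FreeGroup.lift (fun b => cond b x y) w = 1) :
    ∃ z, x ∈ Subgroup.zpowers z ∧ y ∈ Subgroup.zpowers z := by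
  have := genBy_of_relation (fun b => cond b x y) rfl w hw h
  rw [Nat.card_eq_fintype_card, Fintype.card_bool] at this
  obtain ⟨z, hz⟩ := this.eq_zpowers
  refine ⟨z, ?_, ?_⟩
  · rw [← hz]; exact Subgroup.subset_closure ⟨true, rfl⟩
  · rw [← hz]; exact Subgroup.subset_closure ⟨false, rfl⟩

theorem exists_zpowers_of_zpow_eq {x y : F} {a b : ℤ} (ha : a ≠ 0) (h : x ^ a = y ^ b) :
    ∃ z, x ∈ Subgroup.zpowers z ∧ y ∈ Subgroup.zpowers z := by
  refine exists_zpowers_of_relation x y (FreeGroup.of true ^ a * (FreeGroup.of false ^ b)⁻¹)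
    (fun h1 => ha ?_) (by simp [h])
  have := congrArg (FreeGroup.lift
    (fun b => cond b (Multiplicative.ofAdd (1 : ℤ)) 1)) h1
  simpa using congrArg Multiplicative.toAdd this

theorem exists_zpowers_of_commute {x y : F} (h : x * y = y * x) :
    ∃ z, x ∈ Subgroup.zpowers z ∧ y ∈ Subgroup.zpowers z := by
  refine exists_zpowers_of_relation x y
    (FreeGroup.of true * FreeGroup.of false * (FreeGroup.of false * FreeGroup.of true)⁻¹)
    (fun h1 => ?_) (by simp only [map_mul, map_inv, FreeGroup.lift_apply_of, cond, h]; simp)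
  rw [mul_inv_eq_one] at h1
  exact absurd (congrArg FreeGroup.toWord h1) (by decide)

theorem eq_one_of_zpow_eq_one {x : F} {n : ℤ} (hn : n ≠ 0) (h : x ^ n = 1) : x = 1 := by
  have := genBy_of_relation (fun _ : Unit => x) rfl (FreeGroup.of () ^ n)
    (fun h1 => hn (by
      have := congrArg (FreeGroup.lift (fun _ => Multiplicative.ofAdd (1 : ℤ))) h1
      simpa using congrArg Multiplicative.toAdd this)) (by simp [h])
  rw [Nat.card_eq_fintype_card, Fintype.card_unit] at this
  have h2 := this.eq_bot
  rw [Subgroup.closure_eq_bot_iff] at h2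
  exact h2 ⟨(), rfl⟩

theorem eq_or_eq_inv_of_mem_zpowers {F : Type} [Group F] {v z : F} (hv : v ≠ 1)
    (hvp : ¬ IsProperPower v)
    (h : v ∈ Subgroup.zpowers z) : v = z ∨ v = z⁻¹ := by
  obtain ⟨k, rfl⟩ := Subgroup.mem_zpowers_iff.1 h
  obtain ⟨n, rfl | rfl⟩ := k.eq_nat_or_neg
  · rcases n with _ | _ | n
    · simp at hv
    · left; simp
    · exact absurd ⟨z, n + 2, by omega, by rw [zpow_natCast]⟩ hvp
  · rcases n with _ | _ | n
    · simp at hv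
    · right; simp
    · exact absurd ⟨z⁻¹, n + 2, by omega, by rw [zpow_neg, zpow_natCast, inv_pow]⟩ hvp

theorem mem_zpowers_of_common {F : Type} [Group F] {v x z : F} (hv : v ≠ 1)
    (hvp : ¬ IsProperPower v)
    (h : v ∈ Subgroup.zpowers z) (hx : x ∈ Subgroup.zpowers z) : x ∈ Subgroup.zpowers v := by
  rcases eq_or_eq_inv_of_mem_zpowers hv hvp h with rfl | rfl
  · exact hx
  · simpa using hx

theorem mem_zpowers_of_zpow_mem {v x : F} (hv : v ≠ 1) (hvp : ¬ IsProperPower v) {n : ℤ}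
    (hn : n ≠ 0) (h : x ^ n ∈ Subgroup.zpowers v) : x ∈ Subgroup.zpowers v := by
  obtain ⟨m, hm⟩ := Subgroup.mem_zpowers_iff.1 h
  obtain ⟨z, hx, hz⟩ := exists_zpowers_of_zpow_eq hn hm.symm
  exact mem_zpowers_of_common hv hvp hz hx

theorem mem_zpowers_of_commute {v x : F} (hv : v ≠ 1) (hvp : ¬ IsProperPower v)
    (h : x * v = v * x) : x ∈ Subgroup.zpowers v := by
  obtain ⟨z, hx, hz⟩ := exists_zpowers_of_commute h
  exact mem_zpowers_of_common hv hvp hz hx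

theorem IsProperPower.conj_iff {G : Type} [Group G] {x : G} (h : G) :
    IsProperPower (h * x * h⁻¹) ↔ IsProperPower x := by
  constructor
  · rintro ⟨y, k, hk, e⟩
    refine ⟨h⁻¹ * y * h, k, hk, ?_⟩
    have := conj_pow (a := h⁻¹) (b := y) (i := k)
    rw [inv_inv] at this
    rw [this, e]; group
  · rintro ⟨y, k, hk, e⟩
    exact ⟨h * y * h⁻¹, k, hk, by rw [conj_pow, e]⟩

theorem mem_zpowers_of_conj_zpow {v h : F} (hv : v ≠ 1) (hvp : ¬ IsProperPower v) {a b : ℤ}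
    (ha : a ≠ 0) (e : h * v ^ a * h⁻¹ = v ^ b) : h ∈ Subgroup.zpowers v := by
  rw [← conj_zpow] at e
  obtain ⟨z, hx, hz⟩ := exists_zpowers_of_zpow_eq ha e
  have h1 := mem_zpowers_of_common hv hvp hz hx
  have hc1 : h * v * h⁻¹ ≠ 1 := by simpa using hv
  rcases eq_or_eq_inv_of_mem_zpowers hc1 (by rwa [IsProperPower.conj_iff]) h1 with h2 | h2
  · exact mem_zpowers_of_commute hv hvp (by rw [← mul_inv_eq_iff_eq_mul, h2])
  · refine mem_zpowers_of_zpow_mem hv hvp (n := 2) (by norm_num)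
      (mem_zpowers_of_commute hv hvp ?_)
    have h3 : h * v = v⁻¹ * h := by rw [← mul_inv_eq_iff_eq_mul, h2]
    have h4 : h * v⁻¹ = v * h := by
      rw [← mul_inv_eq_iff_eq_mul, ← conj_inv, h2, inv_inv]
    rw [zpow_ofNat, sq, mul_assoc, h3, ← mul_assoc, h4, mul_assoc]

theorem conj_eq_of_conj_zpow {u v h : F} (hu : u ≠ 1) (hup : ¬ IsProperPower u)
    (hv : v ≠ 1) (hvp : ¬ IsProperPower v) {a b : ℤ}
    (ha : a ≠ 0) (e : h * v ^ a * h⁻¹ = u ^ b) : IsConj u v ∨ IsConj u v⁻¹ := by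
  rw [← conj_zpow] at e
  obtain ⟨z, hx, hz⟩ := exists_zpowers_of_zpow_eq ha e
  have hc1 : h * v * h⁻¹ ≠ 1 := by simpa using hv
  have h1 := mem_zpowers_of_common hu hup hz hx
  rcases eq_or_eq_inv_of_mem_zpowers hc1 (by rwa [IsProperPower.conj_iff]) h1 with h2 | h2
  · exact Or.inl (isConj_iff.2 ⟨h, h2⟩).symm
  · exact Or.inr (isConj_iff.2 ⟨h, by rw [← conj_inv, h2, inv_inv]⟩).symm

end FreePowers

theorem relIndex_ne_zero_of_le_zpowers {G : Type} [Group G] {c k : G} {K : Subgroup G}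
    (hK : K ≤ Subgroup.zpowers c) (hk : k ∈ K) (hk1 : k ≠ 1) :
    K.relIndex (Subgroup.zpowers c) ≠ 0 := by
  obtain ⟨m, rfl⟩ := Subgroup.mem_zpowers_iff.1 (hK hk)
  have hm : m ≠ 0 := by rintro rfl; simp at hk1
  rw [← Subgroup.range_zpowersHom c, ← Subgroup.index_comap]
  have h1 : Subgroup.zpowers (Multiplicative.ofAdd m) ≤ K.comap (zpowersHom G c) := by
    rw [Subgroup.zpowers_le, Subgroup.mem_comap]
    simpa using hk
  intro h0
  have h2 := Subgroup.index_dvd_of_le h1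
  rw [h0, zero_dvd_iff] at h2
  have h3 := Int.index_zmultiples m
  rw [← AddSubgroup.index_toSubgroup] at h3
  have : (AddSubgroup.toSubgroup (AddSubgroup.zmultiples m)).index = 0 := h2
  omega

/-- An action of `G` on an oriented tree, with free vertex stabilizers and infinite cyclic,
root-closed, pairwise non-overlapping edge stabilizers. -/
structure IsTreeAction (G X : Type) [Group G] [MulAction G X] (adj : X → X → Prop) : Prop where
  smul : ∀ (g : G) {x y : X}, adj x y → adj (g • x) (g • y)
  asymm : ∀ {x y : X}, adj x y → ¬ adj y x
  no_cycle : ∀ (n : ℕ) (f : ℕ → X), 0 < n →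
    (∀ k < n, adj (f k) (f (k + 1)) ∨ adj (f (k + 1)) (f k)) →
    (∀ k, k + 2 ≤ n → f k ≠ f (k + 2)) → f 0 ≠ f n
  conn : ∀ x y : X, ∃ (n : ℕ) (f : ℕ → X), f 0 = x ∧ f n = y ∧
    ∀ k < n, adj (f k) (f (k + 1)) ∨ adj (f (k + 1)) (f k)
  comm : ∀ {x y : X} {g h : G}, adj x y → g • x = x → g • y = y → h • x = x → h • y = y →
    g * h = h * g
  relIndex : ∀ {x y : X} {K : Subgroup G}, adj x y →
    K ≤ MulAction.stabilizer G x ⊓ MulAction.stabilizer G y → K ≠ ⊥ →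
    K.relIndex (MulAction.stabilizer G x ⊓ MulAction.stabilizer G y) ≠ 0
  unique : ∀ {x y z : X} {g : G}, g ≠ 1 → g • x = x → g • y = y → g • z = z →
    (adj x y ∨ adj y x) → (adj x z ∨ adj z x) → y = z
  root : ∀ {x y : X} {g : G} {n : ℤ}, g • x = x → g ^ n • y = y → g ^ n ≠ 1 →
    (adj x y ∨ adj y x) → g • y = y
  free : ∀ x : X, IsFreeGroup (MulAction.stabilizer G x)
  cyclic : ∀ {x y : X}, adj x y → ∃ c, MulAction.stabilizer G x ⊓ MulAction.stabilizer G y =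
    Subgroup.zpowers c

theorem IsTreeAction.flip {G X : Type} [Group G] [MulAction G X] {adj : X → X → Prop}
    (h : IsTreeAction G X adj) : IsTreeAction G X (fun x y => adj y x) where
  smul g _ _ e := h.smul g e
  asymm e := h.asymm e
  no_cycle n f hn h1 h2 := h.no_cycle n f hn (fun k hk => (h1 k hk).symm) h2
  conn x y := by
    obtain ⟨n, f, h1, h2, h3⟩ := h.conn x y
    exact ⟨n, f, h1, h2, fun k hk => (h3 k hk).symm⟩
  comm e h1 h2 h3 h4 := h.comm e h2 h1 h4 h3
  relIndex e hK hK1 := by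
    rw [inf_comm] at hK ⊢
    exact h.relIndex e hK hK1
  unique h1 h2 h3 h4 e e' := h.unique h1 h2 h3 h4 e.symm e'.symm
  root h1 h2 h3 e := h.root h1 h2 h3 e.symm
  free := h.free
  cyclic e := by rw [inf_comm]; exact h.cyclic e

namespace HNNTree
open HNNExtension

section General
variable {H : Type} [Group H] {A B : Subgroup H} (φ : A ≃* B)

/-- The vertices of the Bass-Serre tree. -/
abbrev Vertex := HNNExtension H A B φ ⧸ (of (G := H) (φ := φ)).range

/-- The base vertex. -/
def base : Vertex φ := QuotientGroup.mk 1

/-- Oriented adjacency in the Bass-Serre tree. -/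
def adj (x y : Vertex φ) : Prop :=
  ∃ g : HNNExtension H A B φ, x = g • base φ ∧ y = (g * t) • base φ

variable {φ}

theorem smul_base_eq_iff {g h : HNNExtension H A B φ} :
    g • base φ = h • base φ ↔ ∃ a : H, h = g * of a := by
  change (QuotientGroup.mk (g * 1) : Vertex φ) = QuotientGroup.mk (h * 1) ↔ _
  rw [QuotientGroup.eq]
  simp only [mul_one, MonoidHom.mem_range]
  constructor
  · rintro ⟨a, ha⟩; exact ⟨a, by rw [ha]; group⟩
  · rintro ⟨a, rfl⟩; exact ⟨a, by group⟩

theorem of_smul_base (a : H) : (of a : HNNExtension H A B φ) • base φ = base φ := by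
  have := (smul_base_eq_iff (φ := φ) (g := 1) (h := of a)).2 ⟨a, by simp⟩
  rw [← this, one_smul]

theorem smul_base_eq_base_iff {g : HNNExtension H A B φ} :
    g • base φ = base φ ↔ ∃ a : H, g = of a := by
  constructor
  · intro h
    have := (smul_base_eq_iff (φ := φ) (g := 1) (h := g)).1 (by rw [h, one_smul])
    simpa using this
  · rintro ⟨a, rfl⟩; exact of_smul_base a

theorem exists_smul_base (x : Vertex φ) : ∃ g : HNNExtension H A B φ, x = g • base φ := by
  induction x using QuotientGroup.induction_on with
  | H g => exact ⟨g, by change _ = QuotientGroup.mk (g * 1); rw [mul_one]⟩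

theorem adj_smul (g : HNNExtension H A B φ) {x y : Vertex φ} (h : adj φ x y) :
    adj φ (g • x) (g • y) := by
  obtain ⟨k, rfl, rfl⟩ := h
  exact ⟨g * k, by rw [mul_smul], by simp only [mul_smul]⟩

/-- The height homomorphism. -/
def height : HNNExtension H A B φ →* Multiplicative ℤ :=
  lift 1 (Multiplicative.ofAdd 1) (by simp)

theorem height_of (a : H) : height (of a : HNNExtension H A B φ) = 1 := by simp [height]

theorem height_t : height (t : HNNExtension H A B φ) = Multiplicative.ofAdd 1 := by simp [height]

theorem adj_asymm {x y : Vertex φ} (h : adj φ x y) : ¬ adj φ y x := by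
  obtain ⟨g, rfl, rfl⟩ := h
  rintro ⟨g', h1, h2⟩
  obtain ⟨a, ha⟩ := smul_base_eq_iff.1 h1
  obtain ⟨b, hb⟩ := smul_base_eq_iff.1 h2
  have h3 := congrArg height hb
  rw [ha] at h3
  simp only [map_mul, height_of, height_t, mul_one] at h3
  have h4 := congrArg Multiplicative.toAdd h3
  simp only [toAdd_mul, toAdd_ofAdd] at h4
  omega

theorem adj_base_iff {y : Vertex φ} :
    (adj φ (base φ) y ∨ adj φ y (base φ)) ↔
      ∃ (a : H) (ε : ℤˣ), y = (of a * t ^ (ε : ℤ) : HNNExtension H A B φ) • base φ := by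
  constructor
  · rintro (⟨g, h1, rfl⟩ | ⟨g, rfl, h1⟩)
    · obtain ⟨a, rfl⟩ := smul_base_eq_base_iff.1 h1.symm
      exact ⟨a, 1, by simp⟩
    · obtain ⟨a, ha⟩ := smul_base_eq_base_iff.1 h1.symm
      refine ⟨a, -1, ?_⟩
      rw [← ha]; simp
  · rintro ⟨a, ε, rfl⟩
    rcases Int.units_eq_one_or ε with rfl | rfl
    · exact Or.inl ⟨of a, (of_smul_base a).symm, by simp⟩
    · refine Or.inr ⟨of a * t ^ (-1 : ℤ), by simp, ?_⟩
      simp [of_smul_base]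

theorem adj_iff {g : HNNExtension H A B φ} {y : Vertex φ} :
    (adj φ (g • base φ) y ∨ adj φ y (g • base φ)) ↔
      ∃ (a : H) (ε : ℤˣ), y = (g * of a * t ^ (ε : ℤ) : HNNExtension H A B φ) • base φ := by
  have h1 : (adj φ (g • base φ) y ∨ adj φ y (g • base φ)) ↔
      (adj φ (base φ) (g⁻¹ • y) ∨ adj φ (g⁻¹ • y) (base φ)) := by
    constructor
    · rintro (h | h)
      · left; simpa using adj_smul g⁻¹ h
      · right; simpa using adj_smul g⁻¹ h
    · rintro (h | h)
      · left; simpa using adj_smul g h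
      · right; simpa using adj_smul g h
  rw [h1, adj_base_iff]
  refine exists_congr fun a => exists_congr fun ε => ?_
  rw [inv_smul_eq_iff, smul_smul, mul_assoc]

theorem mem_toSubgroup_of_conj_mem {ε : ℤˣ} {h : H}
    (hh : (t ^ (ε : ℤ) * of h * t ^ (-(ε : ℤ)) : HNNExtension H A B φ) ∈
      (of (G := H) (φ := φ)).range) : h ∈ toSubgroup A B ε := by
  by_contra hn
  have := HNNExtension.ReducedWord.toList_eq_nil_of_mem_of_range φ
    (⟨1, [(ε, h), (-ε, 1)], by simp [hn]⟩ : NormalWord.ReducedWord H A B)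
    (by simpa [NormalWord.ReducedWord.prod, mul_assoc] using hh)
  simp at this

theorem conj_of_mem_toSubgroup {ε : ℤˣ} {h : H} (hh : h ∈ toSubgroup A B ε) :
    (t ^ (ε : ℤ) * of h * t ^ (-(ε : ℤ)) : HNNExtension H A B φ) ∈
      (of (G := H) (φ := φ)).range := by
  rcases Int.units_eq_one_or ε with rfl | rfl
  · refine ⟨φ ⟨h, by simpa using hh⟩, ?_⟩
    rw [equiv_eq_conj]; simp
  · refine ⟨φ.symm ⟨h, by simpa using hh⟩, ?_⟩
    rw [equiv_symm_eq_conj]; simp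

theorem of_smul_neighbor_iff {a k : H} {ε : ℤˣ} :
    (of k : HNNExtension H A B φ) • (of a * t ^ (ε : ℤ) : HNNExtension H A B φ) • base φ =
      (of a * t ^ (ε : ℤ) : HNNExtension H A B φ) • base φ ↔
    a⁻¹ * k * a ∈ toSubgroup A B (-ε) := by
  have : ((of a * t ^ (ε : ℤ))⁻¹ * (of k * (of a * t ^ (ε : ℤ))) : HNNExtension H A B φ) =
      t ^ ((-ε : ℤˣ) : ℤ) * of (a⁻¹ * k * a) * t ^ (-((-ε : ℤˣ) : ℤ)) := by
    simp [mul_assoc]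
  rw [smul_smul, ← inv_smul_eq_iff, smul_smul, smul_base_eq_base_iff, this]
  constructor
  · rintro ⟨b, hb⟩
    exact mem_toSubgroup_of_conj_mem (φ := φ) ⟨b, hb.symm⟩
  · intro h
    obtain ⟨b, hb⟩ := conj_of_mem_toSubgroup (φ := φ) h
    exact ⟨b, hb.symm⟩

theorem exists_reducedWord (n : ℕ) (f : ℕ → Vertex φ) (g : HNNExtension H A B φ)
    (h0 : f 0 = g • base φ)
    (h1 : ∀ k < n, adj φ (f k) (f (k + 1)) ∨ adj φ (f (k + 1)) (f k))
    (h2 : ∀ k, k + 2 ≤ n → f k ≠ f (k + 2)) :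
    ∃ w : NormalWord.ReducedWord H A B, w.toList.length = n ∧
      f n = (g * NormalWord.ReducedWord.prod φ w) • base φ ∧
      ∀ p ∈ w.toList.head?,
        f 1 = (g * of w.head * t ^ (p.1 : ℤ) : HNNExtension H A B φ) • base φ := by
  induction n generalizing f g with
  | zero =>
    exact ⟨⟨1, [], List.isChain_nil⟩, rfl, by simpa [NormalWord.ReducedWord.prod] using h0,
      by simp⟩
  | succ n ih =>
    have e := h1 0 (by omega)
    rw [h0] at e
    obtain ⟨a, ε, ha⟩ := adj_iff.1 e
    obtain ⟨w, hw1, hw2, hw3⟩ := ih (fun k => f (k + 1)) _ ha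
      (fun k hk => h1 (k + 1) (by omega)) (fun k hk => h2 (k + 1) (by omega))
    refine ⟨⟨a, (ε, w.head) :: w.toList, ?_⟩, by simp [hw1], ?_, ?_⟩
    · rw [List.isChain_cons]
      refine ⟨?_, w.chain⟩
      intro p hp hm
      by_contra hne
      have h3 := hw3 p hp
      have h4 : p.1 = -ε := by
        rcases Int.units_eq_one_or ε with h | h <;>
          rcases Int.units_eq_one_or p.1 with h' | h' <;> simp_all
      have hn : 0 + 2 ≤ n + 1 := by
        have : w.toList ≠ [] := by rintro h; simp [h] at hp
        have := List.length_pos_iff.2 this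
        omega
      apply h2 0 hn
      obtain ⟨b, hb⟩ := conj_of_mem_toSubgroup (φ := φ) hm
      rw [h0]
      change _ = f (1 + 1)
      rw [h3, h4, smul_base_eq_iff]
      refine ⟨a * b, ?_⟩
      rw [map_mul, hb]
      simp [mul_assoc]
    · rw [hw2]
      simp [NormalWord.ReducedWord.prod, mul_assoc]
    · intro p hp
      simp at hp
      subst hp
      exact ha

theorem adj_no_cycle (n : ℕ) (f : ℕ → Vertex φ) (hn : 0 < n)
    (h1 : ∀ k < n, adj φ (f k) (f (k + 1)) ∨ adj φ (f (k + 1)) (f k))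
    (h2 : ∀ k, k + 2 ≤ n → f k ≠ f (k + 2)) : f 0 ≠ f n := by
  intro h
  obtain ⟨g, hg⟩ := exists_smul_base (f 0)
  obtain ⟨w, hw1, hw2, -⟩ := exists_reducedWord n f g hg h1 h2
  rw [hw2, hg, smul_base_eq_iff] at h
  obtain ⟨a, ha⟩ := h
  have := HNNExtension.ReducedWord.toList_eq_nil_of_mem_of_range φ w ⟨a, (mul_left_cancel ha).symm⟩
  simp [this] at hw1
  omega

/-- Reachability in the underlying graph of an oriented graph. -/
theorem conn_trans {X : Type} {r : X → X → Prop} {x y z : X}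
    (h : ∃ (n : ℕ) (f : ℕ → X), f 0 = x ∧ f n = y ∧ ∀ k < n, r (f k) (f (k + 1)))
    (e : r y z) : ∃ (n : ℕ) (f : ℕ → X), f 0 = x ∧ f n = z ∧ ∀ k < n, r (f k) (f (k + 1)) := by
  obtain ⟨n, f, h0, h1, h2⟩ := h
  refine ⟨n + 1, fun k => if k ≤ n then f k else z, by simpa using h0, by simp, fun k hk => ?_⟩
  rcases Nat.lt_succ_iff_lt_or_eq.1 hk with h | rfl
  · simpa [h.le, Nat.succ_le_of_lt h] using h2 k h
  · simpa [h1] using e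

theorem exists_walk_of_reflTransGen {X : Type} {r : X → X → Prop} {x y : X}
    (h : Relation.ReflTransGen r x y) :
    ∃ (n : ℕ) (f : ℕ → X), f 0 = x ∧ f n = y ∧ ∀ k < n, r (f k) (f (k + 1)) := by
  induction h with
  | refl => exact ⟨0, fun _ => x, rfl, rfl, by simp⟩
  | tail _ e ih => exact conn_trans ih e

theorem adj_conn (x y : Vertex φ) : ∃ (n : ℕ) (f : ℕ → Vertex φ), f 0 = x ∧ f n = y ∧
    ∀ k < n, adj φ (f k) (f (k + 1)) ∨ adj φ (f (k + 1)) (f k) := by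
  obtain ⟨g, rfl⟩ := exists_smul_base x
  obtain ⟨g', rfl⟩ := exists_smul_base y
  obtain ⟨k, rfl⟩ : ∃ k, g' = g * k := ⟨g⁻¹ * g', by group⟩
  apply exists_walk_of_reflTransGen (r := fun x y => adj φ x y ∨ adj φ y x)
  induction k using HNNExtension.induction_on generalizing g with
  | of a => rw [smul_base_eq_iff.2 ⟨a, rfl⟩]
  | t => exact Relation.ReflTransGen.single (Or.inl ⟨g, rfl, rfl⟩)
  | mul a b iha ihb =>
    rw [← mul_assoc]
    exact (iha g).trans (ihb (g * a))
  | inv a ih =>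
    have := ih (g * a⁻¹)
    rw [inv_mul_cancel_right] at this
    have hs : Std.Symm (fun x y => adj φ x y ∨ adj φ y x) := ⟨fun _ _ => Or.symm⟩
    exact Relation.ReflTransGen.stdSymm.symm _ _ this

end General

section Cyclic
variable {H : Type} [Group H] [IsFreeGroup H] {u v : H} (hu : u ≠ 1) (hv : v ≠ 1)
  (hup : ¬ IsProperPower u) (hvp : ¬ IsProperPower v)
  (huv : ¬ IsConj u v) (huv' : ¬ IsConj u v⁻¹)
  (φ : Subgroup.zpowers u ≃* Subgroup.zpowers v)

include hu hv hup hvp in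
theorem gen_toSubgroup (ε : ℤˣ) : ∃ c : H, c ≠ 1 ∧ ¬ IsProperPower c ∧
    toSubgroup (Subgroup.zpowers u) (Subgroup.zpowers v) ε = Subgroup.zpowers c ∧
    c = if ε = 1 then u else v := by
  rcases Int.units_eq_one_or ε with rfl | rfl
  · exact ⟨u, hu, hup, by simp, by simp⟩
  · exact ⟨v, hv, hvp, by simp, by simp⟩

theorem adj_smul_base {g : HNNExtension H _ _ φ} {y : Vertex φ}
    (h : adj φ (g • base φ) y ∨ adj φ y (g • base φ)) :
    adj φ (base φ) (g⁻¹ • y) ∨ adj φ (g⁻¹ • y) (base φ) := by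
  rcases h with h | h
  · left; simpa using adj_smul g⁻¹ h
  · right; simpa using adj_smul g⁻¹ h

theorem smul_conj_iff {G X : Type} [Group G] [MulAction G X] (g k : G) (y : X) :
    (g⁻¹ * k * g) • g⁻¹ • y = g⁻¹ • y ↔ k • y = y := by
  rw [smul_smul, mul_assoc, mul_inv_cancel, mul_one, mul_smul]
  exact smul_left_cancel_iff _

theorem exists_conj_mem {H' : Type} [Group H'] {c a k : H'}
    (hk : a⁻¹ * k * a ∈ Subgroup.zpowers c) :
    ∃ n : ℤ, k = a * c ^ n * a⁻¹ := by
  obtain ⟨n, hn⟩ := Subgroup.mem_zpowers_iff.1 hk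
  exact ⟨n, by rw [hn]; group⟩

include hu hv hup hvp in
theorem stabilizer_edge {x y : Vertex φ} (h : adj φ x y ∨ adj φ y x) : ∃ c,
    MulAction.stabilizer (HNNExtension H _ _ φ) x ⊓
      MulAction.stabilizer (HNNExtension H _ _ φ) y = Subgroup.zpowers c := by
  obtain ⟨g, rfl⟩ := exists_smul_base x
  obtain ⟨a, ε, ha⟩ := adj_base_iff.1 (adj_smul_base φ h)
  obtain ⟨c, hc1, hcp, hc, -⟩ := gen_toSubgroup hu hv hup hvp (-ε)
  refine ⟨g * of (a * c * a⁻¹) * g⁻¹, ?_⟩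
  ext k
  rw [Subgroup.mem_inf, MulAction.mem_stabilizer_iff, MulAction.mem_stabilizer_iff,
    ← smul_conj_iff g k y, ← smul_conj_iff g k, inv_smul_smul, smul_base_eq_base_iff, ha]
  constructor
  · rintro ⟨⟨b, hb⟩, h2⟩
    rw [hb, of_smul_neighbor_iff, hc] at h2
    obtain ⟨n, rfl⟩ := exists_conj_mem h2
    refine ⟨n, ?_⟩
    simp only
    rw [conj_zpow, ← map_zpow, conj_zpow, ← hb]
    group
  · rintro ⟨n, rfl⟩
    simp only
    rw [conj_zpow, ← map_zpow, conj_zpow]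
    have : g⁻¹ * (g * of (a * c ^ n * a⁻¹) * g⁻¹) * g =
      (of (a * c ^ n * a⁻¹) : HNNExtension H _ _ φ) := by group
    rw [this]
    refine ⟨⟨_, rfl⟩, ?_⟩
    rw [of_smul_neighbor_iff, hc]
    exact ⟨n, by group⟩

include hu hv hup hvp huv huv' in
theorem isTreeAction : IsTreeAction (HNNExtension H _ _ φ) (Vertex φ) (adj φ) where
  smul g _ _ h := adj_smul g h
  asymm h := adj_asymm h
  no_cycle := adj_no_cycle
  conn := adj_conn
  comm := by
    intro x y g h e h1 h2 h3 h4
    obtain ⟨c, hc⟩ := stabilizer_edge hu hv hup hvp φ (Or.inl e)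
    obtain ⟨m, rfl⟩ := Subgroup.mem_zpowers_iff.1 (hc ▸ Subgroup.mem_inf.2 ⟨h1, h2⟩)
    obtain ⟨n, rfl⟩ := Subgroup.mem_zpowers_iff.1 (hc ▸ Subgroup.mem_inf.2 ⟨h3, h4⟩)
    rw [← zpow_add, ← zpow_add, add_comm]
  cyclic e := stabilizer_edge hu hv hup hvp φ (Or.inl e)
  relIndex := by
    intro x y K e hK hK1
    obtain ⟨c, hc⟩ := stabilizer_edge hu hv hup hvp φ (Or.inl e)
    rw [hc] at hK ⊢
    obtain ⟨k, hk1⟩ := Subgroup.ne_bot_iff_exists_ne_one.1 hK1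
    exact relIndex_ne_zero_of_le_zpowers hK k.2 (fun h => hk1 (Subtype.ext h))
  unique := by
    intro x y z k hk hx hy hz e e'
    obtain ⟨g, rfl⟩ := exists_smul_base x
    obtain ⟨a, ε, ha⟩ := adj_base_iff.1 (adj_smul_base φ e)
    obtain ⟨a', ε', ha'⟩ := adj_base_iff.1 (adj_smul_base φ e')
    rw [← smul_conj_iff g, inv_smul_smul, smul_base_eq_base_iff] at hx
    obtain ⟨b, hb⟩ := hx
    have hb1 : b ≠ 1 := by
      rintro rfl
      apply hk
      rw [map_one] at hb
      have : k = g * (g⁻¹ * k * g) * g⁻¹ := by group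
      rw [this, hb]; group
    rw [← smul_conj_iff g, hb, ha, of_smul_neighbor_iff] at hy
    rw [← smul_conj_iff g, hb, ha', of_smul_neighbor_iff] at hz
    rw [← smul_left_cancel_iff g⁻¹, ha, ha']
    obtain ⟨c, hc1, hcp, hc, hc'⟩ := gen_toSubgroup hu hv hup hvp (-ε)
    obtain ⟨d, hd1, hdp, hd, hd'⟩ := gen_toSubgroup hu hv hup hvp (-ε')
    rw [hc] at hy
    rw [hd] at hz
    obtain ⟨m, hm⟩ := exists_conj_mem hy
    obtain ⟨n, hn⟩ := exists_conj_mem hz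
    have hm0 : m ≠ 0 := by rintro rfl; apply hb1; rw [hm]; group
    have hn0 : n ≠ 0 := by rintro rfl; apply hb1; rw [hn]; group
    have h1 : (a'⁻¹ * a) * c ^ m * (a'⁻¹ * a)⁻¹ = d ^ n := by
      have : d ^ n = a'⁻¹ * b * a' := by rw [hn]; group
      rw [this, hm]; group
    by_cases hε : ε = ε'
    · subst hε
      have hcd : c = d := by rw [hc', hd']
      subst hcd
      have h2 := mem_zpowers_of_conj_zpow hc1 hcp hm0 h1
      rw [← hc] at h2
      obtain ⟨b', hb'⟩ := conj_of_mem_toSubgroup (φ := φ) h2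
      rw [eq_comm, smul_base_eq_iff]
      refine ⟨b', ?_⟩
      rw [hb']
      simp [mul_assoc]
    · exfalso
      have h2 : IsConj d c ∨ IsConj d c⁻¹ := conj_eq_of_conj_zpow hd1 hdp hc1 hcp hm0 h1
      have h3 : (c = u ∧ d = v) ∨ (c = v ∧ d = u) := by
        rcases Int.units_eq_one_or ε with rfl | rfl <;>
          rcases Int.units_eq_one_or ε' with rfl | rfl <;> simp_all
      rcases h3 with ⟨rfl, rfl⟩ | ⟨rfl, rfl⟩
      · rcases h2 with h2 | h2
        · exact huv h2.symm
        · apply huv'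
          obtain ⟨e, he⟩ := isConj_iff.1 h2
          exact (isConj_iff.2 ⟨e, by rw [← conj_inv, he, inv_inv]⟩).symm
      · rcases h2 with h2 | h2
        · exact huv h2
        · exact huv' h2
  root := by
    intro x y k n hx hy hk e
    obtain ⟨g, rfl⟩ := exists_smul_base x
    obtain ⟨a, ε, ha⟩ := adj_base_iff.1 (adj_smul_base φ e)
    rw [← smul_conj_iff g, inv_smul_smul, smul_base_eq_base_iff] at hx
    obtain ⟨b, hb⟩ := hx
    have hn0 : n ≠ 0 := by rintro rfl; simp at hk
    have hbn : g⁻¹ * k ^ n * g = of (b ^ n) := by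
      rw [map_zpow, ← hb]
      have := conj_zpow (a := g⁻¹) (b := k) (i := n)
      rw [inv_inv] at this
      exact this.symm
    rw [← smul_conj_iff g, hbn, ha, of_smul_neighbor_iff] at hy
    rw [← smul_conj_iff g, hb, ha, of_smul_neighbor_iff]
    obtain ⟨c, hc1, hcp, hc, hc'⟩ := gen_toSubgroup hu hv hup hvp (-ε)
    rw [hc] at hy ⊢
    apply mem_zpowers_of_zpow_mem hc1 hcp hn0
    have := conj_zpow (a := a⁻¹) (b := b) (i := n)
    rw [inv_inv] at this
    rwa [this]
  free := by
    intro x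
    obtain ⟨g, rfl⟩ := exists_smul_base x
    let ψ : H →* HNNExtension H _ _ φ := (MulAut.conj g).toMonoidHom.comp of
    have hψ : Function.Injective ψ := (MulAut.conj g).injective.comp (of_injective φ)
    have hr : ψ.range = MulAction.stabilizer (HNNExtension H _ _ φ) (g • base φ) := by
      ext k
      rw [MulAction.mem_stabilizer_iff, ← smul_conj_iff g, inv_smul_smul, smul_base_eq_base_iff]
      constructor
      · rintro ⟨b, rfl⟩
        exact ⟨b, by simp [ψ, mul_assoc]⟩
      · rintro ⟨b, hb⟩
        exact ⟨b, by simp [ψ, ← hb, mul_assoc]⟩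
    rw [← hr]
    exact IsFreeGroup.ofMulEquiv (MonoidHom.ofInjective hψ)

end Cyclic
end HNNTree

/-- A finite connected graph of subgroups of `P`, mapped equivariantly to a `G`-tree along
`ψ : P →* G`. -/
structure PreSys {P G X : Type} [Group P] [Group G] [MulAction G X] (ψ : P →* G)
    (adj : X → X → Prop) where
  V : Type
  E : Type
  [fV : Fintype V]
  [fE : Fintype E]
  [dV : DecidableEq V]
  [dE : DecidableEq E]
  ne : Nonempty V
  src : E → V
  tgt : E → V
  g : E → P
  Q : V → Subgroup P
  pos : V → X
  n : V → ℕ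
  fix : ∀ v, ∀ q ∈ Q v, ψ q • pos v = pos v
  edge : ∀ e, adj (pos (src e)) (ψ (g e) • pos (tgt e))
  gen : ∀ v, GenBy (Q v) (n v)
  conn : ∀ R : P → V → Prop, (∀ p v, ∀ q ∈ Q v, R p v → R (p * q) v) →
    (∀ p e, R p (src e) ↔ R (p * g e) (tgt e)) → ∀ p v p' v', R p v → R p' v'

namespace PreSys
attribute [instance] PreSys.fV PreSys.fE PreSys.dV PreSys.dE

section Basic
variable {P G X : Type} [Group P] [Group G] [MulAction G X] {ψ : P →* G} {adj : X → X → Prop}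
variable (S : PreSys ψ adj)

/-- The edge group, as a subgroup of the vertex group at the source. -/
def C (e : S.E) : Subgroup P :=
  S.Q (S.src e) ⊓ (S.Q (S.tgt e)).comap (MulAut.conj (S.g e)⁻¹).toMonoidHom

theorem mem_C {e : S.E} {p : P} :
    p ∈ S.C e ↔ p ∈ S.Q (S.src e) ∧ (S.g e)⁻¹ * p * S.g e ∈ S.Q (S.tgt e) := by
  simp [C, Subgroup.mem_inf]

/-- The stabilizer of the edge of the tree underlying an edge. -/
def Est (e : S.E) : Subgroup G :=
  MulAction.stabilizer G (S.pos (S.src e)) ⊓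
    MulAction.stabilizer G (ψ (S.g e) • S.pos (S.tgt e))

theorem mem_Est {e : S.E} {x : G} : x ∈ S.Est e ↔ x • S.pos (S.src e) = S.pos (S.src e) ∧
    x • ψ (S.g e) • S.pos (S.tgt e) = ψ (S.g e) • S.pos (S.tgt e) := Iff.rfl

theorem map_C_mem_Est {e : S.E} {p : P} (hp : p ∈ S.C e) : ψ p ∈ S.Est e := by
  rw [mem_C] at hp
  refine ⟨S.fix _ _ hp.1, ?_⟩
  have := S.fix _ _ hp.2
  rw [map_mul, map_mul, mul_smul, mul_smul, map_inv, inv_smul_eq_iff] at this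
  exact this

/-- Whether an edge group has trivial image. -/
def Triv (e : S.E) : Prop := ∀ p ∈ S.C e, ψ p = 1

open Classical in
/-- Indicator of `Triv`. -/
noncomputable def tr (e : S.E) : ℕ := if S.Triv e then 1 else 0

theorem tr_le_one (e : S.E) : S.tr e ≤ 1 := by unfold tr; split_ifs <;> simp

theorem tr_eq_one {e : S.E} : S.tr e = 1 ↔ S.Triv e := by simp [tr]

theorem tr_eq_zero {e : S.E} : S.tr e = 0 ↔ ∃ p ∈ S.C e, ψ p ≠ 1 := by
  unfold tr Triv
  split_ifs with h
  · simpa using h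
  · simpa using h

/-- The number of generators. -/
noncomputable def cost : ℕ := ∑ v, S.n v + ∑ e, S.tr e

/-- The complexity bound. -/
def Bdd (K : ℕ) : Prop := S.cost + 1 ≤ K + Fintype.card S.V

/-- The map is injective on vertex groups. -/
def Inj : Prop := ∀ v, ∀ q ∈ S.Q v, ψ q = 1 → q = 1

/-- The first measure of complexity. -/
noncomputable def m1 : ℕ := Fintype.card S.E + ∑ e, S.tr e

/-- The second measure of complexity. -/
noncomputable def m2 : ℕ := ∑ e, ((S.C e).map ψ).relIndex (S.Est e)

/-- A system is simpler than another one. -/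
def Lt {ψ' : P →* G} {adj' : X → X → Prop} (S' : PreSys ψ' adj') (S : PreSys ψ adj) : Prop :=
  S'.m1 < S.m1 ∨ S'.m1 = S.m1 ∧ S'.m2 < S.m2

/-- The result of a morphism of graphs of subgroups, with redundant edges deleted. -/
abbrev fold {V' E' : Type} [Fintype V'] [Fintype E'] [DecidableEq V'] [DecidableEq E']
    (f : S.V → V') (t : S.V → P) (ι : E' → S.E) (Q' : V' → Subgroup P) (pos' : V' → X)
    (n' : V' → ℕ) (hf : Function.Surjective f)
    (hQ : ∀ x, ∀ q ∈ S.Q x, (t x)⁻¹ * q * t x ∈ Q' (f x))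
    (hfix : ∀ v, ∀ q ∈ Q' v, ψ q • pos' v = pos' v)
    (hgen : ∀ v, GenBy (Q' v) (n' v))
    (hdel : ∀ e, (∃ e', ι e' = e) ∨
      (f (S.src e) = f (S.tgt e) ∧
        (t (S.src e))⁻¹ * S.g e * t (S.tgt e) ∈ Q' (f (S.src e))) ∨
      (∃ e', f (S.src e) = f (S.src (ι e')) ∧ f (S.tgt e) = f (S.tgt (ι e')) ∧
        ∃ a ∈ Q' (f (S.src e)), ∃ b ∈ Q' (f (S.tgt e)),
          (t (S.src e))⁻¹ * S.g e * t (S.tgt e) =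
          a * ((t (S.src (ι e')))⁻¹ * S.g (ι e') * t (S.tgt (ι e'))) * b))
    (hedge : ∀ e', adj (pos' (f (S.src (ι e'))))
      (ψ ((t (S.src (ι e')))⁻¹ * S.g (ι e') * t (S.tgt (ι e'))) • pos' (f (S.tgt (ι e'))))) :
    PreSys ψ adj where
  V := V'
  E := E'
  src e := f (S.src (ι e))
  tgt e := f (S.tgt (ι e))
  g e := (t (S.src (ι e)))⁻¹ * S.g (ι e) * t (S.tgt (ι e))
  Q := Q'
  pos := pos'
  n := n'
  fix := hfix
  edge := hedge
  ne := S.ne.map f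
  gen := hgen
  conn R h1 h2 := by
    have h1' : ∀ p v, ∀ q ∈ Q' v, R p v ↔ R (p * q) v := fun p v q hq =>
      ⟨h1 p v q hq, fun h => by simpa using h1 _ v q⁻¹ (inv_mem hq) h⟩
    have key := S.conn (fun p x => R (p * t x) (f x)) (fun p x q hq h => by
        have := h1 _ _ _ (hQ x q hq) h
        simpa [mul_assoc] using this) (fun p e => by
        rcases hdel e with ⟨e', rfl⟩ | ⟨h3, h4⟩ | ⟨e', h3, h4, a, ha, b, hb, h5⟩
        · rw [h2 _ e']
          simp [mul_assoc]
        · rw [h1' _ _ _ h4, h3]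
          simp [mul_assoc]
        · have h6 : p * S.g e * t (S.tgt e) = p * t (S.src e) * a *
              ((t (S.src (ι e')))⁻¹ * S.g (ι e') * t (S.tgt (ι e'))) * b := by
            simp only [mul_assoc] at h5 ⊢
            rw [← h5]; simp
          rw [h6, ← h1' _ _ b hb, h1' _ _ a ha, h3, h4, h2 _ e'])
    intro p v p' v' h
    obtain ⟨x, rfl⟩ := hf v
    obtain ⟨x', rfl⟩ := hf v'
    have := key (p * (t x)⁻¹) x (p' * (t x')⁻¹) x' (by simpa using h)
    simpa using this

section Fold
variable {S} {V' E' : Type} [Fintype V'] [Fintype E'] [DecidableEq V'] [DecidableEq E']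
    {f : S.V → V'} {t : S.V → P} {ι : E' → S.E} {Q' : V' → Subgroup P} {pos' : V' → X}
    {n' : V' → ℕ} (hf : Function.Surjective f)
    (hQ : ∀ x, ∀ q ∈ S.Q x, (t x)⁻¹ * q * t x ∈ Q' (f x))
    (hfix : ∀ v, ∀ q ∈ Q' v, ψ q • pos' v = pos' v)
    (hgen : ∀ v, GenBy (Q' v) (n' v))
    (hdel : ∀ e, (∃ e', ι e' = e) ∨
      (f (S.src e) = f (S.tgt e) ∧
        (t (S.src e))⁻¹ * S.g e * t (S.tgt e) ∈ Q' (f (S.src e))) ∨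
      (∃ e', f (S.src e) = f (S.src (ι e')) ∧ f (S.tgt e) = f (S.tgt (ι e')) ∧
        ∃ a ∈ Q' (f (S.src e)), ∃ b ∈ Q' (f (S.tgt e)),
          (t (S.src e))⁻¹ * S.g e * t (S.tgt e) =
          a * ((t (S.src (ι e')))⁻¹ * S.g (ι e') * t (S.tgt (ι e'))) * b))
    (hedge : ∀ e', adj (pos' (f (S.src (ι e'))))
      (ψ ((t (S.src (ι e')))⁻¹ * S.g (ι e') * t (S.tgt (ι e'))) • pos' (f (S.tgt (ι e')))))

include hQ in
theorem mem_C_fold {e' : E'} {p : P} (hp : p ∈ S.C (ι e')) :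
    (t (S.src (ι e')))⁻¹ * p * t (S.src (ι e')) ∈
      (S.fold f t ι Q' pos' n' hf hQ hfix hgen hdel hedge).C e' := by
  rw [mem_C] at hp
  refine (mem_C _).2 ⟨hQ _ _ hp.1, ?_⟩
  have := hQ _ _ hp.2
  simpa [mul_assoc] using this

theorem tr_fold_le (e' : E') :
    (S.fold f t ι Q' pos' n' hf hQ hfix hgen hdel hedge).tr e' ≤ S.tr (ι e') := by
  rcases Nat.eq_zero_or_pos (S.tr (ι e')) with h | h
  · obtain ⟨p, hp, hp1⟩ := S.tr_eq_zero.1 h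
    rw [h, Nat.le_zero]
    refine (tr_eq_zero _).2 ⟨_, mem_C_fold hf hQ hfix hgen hdel hedge hp, fun h2 => hp1 ?_⟩
    rw [map_mul, map_mul, map_inv] at h2
    have := eq_inv_of_mul_eq_one_left h2
    rw [inv_mul_eq_iff_eq_mul, mul_inv_cancel] at this
    exact this
  · exact (tr_le_one _ _).trans h

theorem edge_of_pos (hadj : ∀ (g : G) {x y : X}, adj x y → adj (g • x) (g • y))
    (hpos : ∀ x, ψ (t x) • pos' (f x) = S.pos x) (e : S.E) :
    adj (pos' (f (S.src e))) (ψ ((t (S.src e))⁻¹ * S.g e * t (S.tgt e)) • pos' (f (S.tgt e))) := by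
  have := hadj (ψ (t (S.src e)))⁻¹ (S.edge e)
  rw [← hpos, ← hpos, inv_smul_smul] at this
  simpa [mul_smul] using this

end Fold

end Basic
end PreSys

theorem sum_update_add {α : Type} [Fintype α] [DecidableEq α] (F : α → ℕ) (a : α) (m : ℕ) :
    ∑ x, Function.update F a m x + F a = ∑ x, F x + m := by
  rw [Finset.sum_update_of_mem (Finset.mem_univ a), ← Finset.add_sum_erase _ F (Finset.mem_univ a),
    Finset.sdiff_singleton_eq_erase]
  omega

namespace PreSys
variable {P G X : Type} [Group P] [Group G] [MulAction G X] {ψ : P →* G} {adj : X → X → Prop}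
variable (S : PreSys ψ adj)

/-- Data exhibiting that two edges with the same source can be folded. -/
structure FoldData (e₁ e₂ : S.E) (q : P) : Prop where
  src : S.src e₁ = S.src e₂
  mem : q ∈ S.Q (S.src e₁)
  pos : ψ (q * S.g e₁) • S.pos (S.tgt e₁) = ψ (S.g e₂) • S.pos (S.tgt e₂)

variable {S} {e₁ e₂ : S.E} {q : P}

theorem FoldData.symm (h : S.FoldData e₁ e₂ q) : S.FoldData e₂ e₁ q⁻¹ where
  src := h.src.symm
  mem := h.src ▸ inv_mem h.mem
  pos := by
    rw [map_mul, map_inv, mul_smul, ← h.pos, map_mul, mul_smul, inv_smul_smul]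

theorem FoldData.exists_commute (h : S.FoldData e₁ e₂ q) (hT : IsTreeAction G X adj)
    (hS : S.Inj) (h₁ : S.tr e₁ = 0) (h₂ : S.tr e₂ = 0) :
    ∃ a ∈ S.Q (S.tgt e₁), ∃ b ∈ S.Q (S.tgt e₂), a ≠ 1 ∧ b ≠ 1 ∧
      a * ((q * S.g e₁)⁻¹ * S.g e₂ * b * ((q * S.g e₁)⁻¹ * S.g e₂)⁻¹) =
      ((q * S.g e₁)⁻¹ * S.g e₂ * b * ((q * S.g e₁)⁻¹ * S.g e₂)⁻¹) * a := by
  obtain ⟨c₁, hc₁, hc₁'⟩ := S.tr_eq_zero.1 h₁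
  obtain ⟨c₂, hc₂, hc₂'⟩ := S.tr_eq_zero.1 h₂
  have m₁ := (S.mem_Est).1 (S.map_C_mem_Est hc₁)
  have m₂ := (S.mem_Est).1 (S.map_C_mem_Est hc₂)
  rw [mem_C] at hc₁ hc₂
  have hq := h.mem
  have hc₂1 := hc₂.1
  rw [← h.src] at hc₂1
  have hcomm : ψ (c₁ * (q⁻¹ * c₂ * q)) = ψ ((q⁻¹ * c₂ * q) * c₁) := by
    rw [map_mul ψ c₁, map_mul ψ _ c₁]
    refine hT.comm (S.edge e₁) m₁.1 m₁.2
      (S.fix _ _ (mul_mem (mul_mem (inv_mem hq) hc₂1) hq)) ?_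
    have := h.pos
    rw [← this, map_mul, mul_smul] at m₂
    rw [map_mul, map_mul, map_inv, mul_smul, mul_smul, m₂.2, inv_smul_smul]
  have hcomm' : c₁ * (q⁻¹ * c₂ * q) = (q⁻¹ * c₂ * q) * c₁ := by
    rw [← mul_inv_eq_one]
    refine hS (S.src e₁) _ ?_ ?_
    · have h3 := mul_mem (mul_mem (inv_mem hq) hc₂1) hq
      exact mul_mem (mul_mem hc₁.1 h3) (inv_mem (mul_mem h3 hc₁.1))
    · rw [map_mul, map_inv, hcomm, mul_inv_cancel]
  refine ⟨_, hc₁.2, _, hc₂.2, ?_, ?_, ?_⟩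
  · intro h3
    apply hc₁'
    have : c₁ = S.g e₁ * ((S.g e₁)⁻¹ * c₁ * S.g e₁) * (S.g e₁)⁻¹ := by group
    rw [this, h3]; simp
  · intro h3
    apply hc₂'
    have : c₂ = S.g e₂ * ((S.g e₂)⁻¹ * c₂ * S.g e₂) * (S.g e₂)⁻¹ := by group
    rw [this, h3]; simp
  · calc _ = (S.g e₁)⁻¹ * (c₁ * (q⁻¹ * c₂ * q)) * S.g e₁ := by group
      _ = (S.g e₁)⁻¹ * ((q⁻¹ * c₂ * q) * c₁) * S.g e₁ := by rw [hcomm']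
      _ = _ := by group

theorem FoldData.fix (h : S.FoldData e₁ e₂ q) (ht : S.tgt e₁ = S.tgt e₂) :
    ψ ((q * S.g e₁)⁻¹ * S.g e₂) • S.pos (S.tgt e₁) = S.pos (S.tgt e₁) := by
  rw [map_mul, map_inv, mul_smul, inv_smul_eq_iff, h.pos, ht]

section
variable (S) {E' : Type} [Fintype E'] [DecidableEq E'] (ι : E' → S.E) (j : S.V) (z : P) (m : ℕ)

theorem addGen_fix (hz : ψ z • S.pos j = S.pos j) (v : S.V)
    (q : P) (hq : q ∈ Function.update S.Q j (S.Q j ⊔ Subgroup.zpowers z) v) :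
    ψ q • S.pos v = S.pos v := by
  have : Function.update S.Q j (S.Q j ⊔ Subgroup.zpowers z) v ≤
      (MulAction.stabilizer G (S.pos v)).comap ψ := by
    rcases eq_or_ne v j with rfl | h
    · rw [Function.update_self, sup_le_iff, Subgroup.zpowers_le]
      exact ⟨S.fix v, hz⟩
    · rw [Function.update_of_ne h]
      exact S.fix v
  exact this hq

theorem le_addGen (v : S.V) : S.Q v ≤ Function.update S.Q j (S.Q j ⊔ Subgroup.zpowers z) v := by
  rcases eq_or_ne v j with rfl | h
  · rw [Function.update_self]; exact le_sup_left
  · rw [Function.update_of_ne h]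

theorem mem_addGen : z ∈ Function.update S.Q j (S.Q j ⊔ Subgroup.zpowers z) j := by
  rw [Function.update_self]
  exact Subgroup.mem_sup_right (Subgroup.mem_zpowers z)

/-- Adding an element to a vertex group, possibly deleting redundant edges. -/
abbrev addGen (hz : ψ z • S.pos j = S.pos j) (hgen : GenBy (S.Q j ⊔ Subgroup.zpowers z) m)
    (hdel : ∀ e, (∃ e', ι e' = e) ∨ (∃ e', S.src e = S.src (ι e') ∧ S.tgt e = S.tgt (ι e') ∧
        ∃ a ∈ S.Q (S.src e), S.tgt e = j ∧ S.g e = a * S.g (ι e') * z)) : PreSys ψ adj :=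
  S.fold id (fun _ => 1) ι (Function.update S.Q j (S.Q j ⊔ Subgroup.zpowers z)) S.pos
    (Function.update S.n j m) Function.surjective_id
    (fun x q hq => by simpa using S.le_addGen j z x hq)
    (S.addGen_fix j z hz)
    (fun v => by
      rcases eq_or_ne v j with rfl | h
      · simpa using hgen
      · simpa [h] using S.gen v)
    (fun e => by
      rcases hdel e with h | ⟨e', h1, h2, a, ha, h3, h4⟩
      · exact .inl h
      · refine .inr (.inr ⟨e', h1, h2, a, S.le_addGen j z _ ha, z, ?_, by simpa using h4⟩)
        rw [h3]
        exact S.mem_addGen j z)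
    (fun e' => by simpa using S.edge (ι e'))

end

theorem FoldData.exists_simpler_of_eq {e : S.E} (h : S.FoldData e e q) (hT : IsTreeAction G X adj)
    (hfree : ∀ Q : Subgroup P, (∃ x : X, ∀ q ∈ Q, ψ q • x = x) → IsFreeGroup Q)
    (hS : S.Inj) {K : ℕ} (hK : S.Bdd K) (hz : (q * S.g e)⁻¹ * S.g e ∉ S.Q (S.tgt e)) :
    ∃ S' : PreSys ψ adj, S'.Bdd K ∧ Lt S' S := by
  set z := (q * S.g e)⁻¹ * S.g e with hzdef
  have hzfix := h.fix rfl
  have hq := h.mem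
  have hgen : GenBy (S.Q (S.tgt e) ⊔ Subgroup.zpowers z) (S.n (S.tgt e) + S.tr e) := by
    rcases Nat.eq_zero_or_pos (S.tr e) with h0 | h0
    · obtain ⟨a, ha, b, hb, ha1, hb1, hab⟩ := h.exists_commute hT hS h0 h0
      have := hfree (S.Q (S.tgt e) ⊔ Subgroup.zpowers z) ⟨S.pos (S.tgt e), fun p hp =>
        S.addGen_fix (S.tgt e) z hzfix (S.tgt e) p (by simpa using hp)⟩
      rw [h0]
      exact (S.gen _).sup_zpowers_of_commute z ha hb ha1 hb1 hab
    · have : S.tr e = 1 := le_antisymm (S.tr_le_one e) h0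
      rw [this]
      exact (S.gen _).sup (GenBy.zpowers z)
  let S' := S.addGen id (S.tgt e) z _ hzfix hgen (fun e => .inl ⟨e, rfl⟩)
  have hCle : ∀ e' : S.E, S.C e' ≤ S'.C e' := fun e' p hp => by
    have := (S.mem_C).1 hp
    refine S'.mem_C.2 ⟨S.le_addGen _ _ _ this.1, ?_⟩
    simpa [S'] using S.le_addGen (S.tgt e) z _ this.2
  have htr : ∀ e' : S.E, S'.tr e' ≤ S.tr e' := fun e' => S.tr_fold_le _ _ _ _ _ _ e'
  have hEst : ∀ e' : S.E, S'.Est e' = S.Est e' := fun e' => by simp [Est, S']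
  have hqC : q⁻¹ ∈ S'.C e := by
    refine S'.mem_C.2 ⟨S.le_addGen _ _ _ (inv_mem hq), ?_⟩
    have := S.mem_addGen (S.tgt e) z
    simpa [S', hzdef, mul_assoc] using this
  have hqC' : q⁻¹ ∉ S.C e := fun h1 => by
    apply hz
    have := (S.mem_C.1 h1).2
    simpa [hzdef, mul_assoc] using this
  have hq1 : ψ q⁻¹ ≠ 1 := fun h1 => by
    apply hqC'
    rw [hS _ _ (inv_mem hq) h1]
    exact one_mem _
  have htre : S'.tr e = 0 := S'.tr_eq_zero.2 ⟨_, hqC, hq1⟩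
  have hn : ∑ v, S'.n v + S.n (S.tgt e) = ∑ v, S.n v + (S.n (S.tgt e) + S.tr e) :=
    sum_update_add _ _ _
  have hsum : ∑ e', S'.tr e' + S.tr e ≤ ∑ e', S.tr e' := by
    have h1 := Fintype.sum_eq_add_sum_subtype_ne S.tr e
    have h2 := Fintype.sum_eq_add_sum_subtype_ne S'.tr e
    have h3 : ∑ i : {i : S.E // i ≠ e}, S'.tr i.1 ≤ ∑ i : {i : S.E // i ≠ e}, S.tr i.1 :=
      Finset.sum_le_sum fun i _ => htr i.1
    rw [h1]
    rw [htre, zero_add] at h2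
    have : ∑ e', S'.tr e' = ∑ i : {i : S.E // i ≠ e}, S'.tr i.1 := h2
    omega
  refine ⟨S', ?_, ?_⟩
  · unfold Bdd cost at hK ⊢
    have : Fintype.card S'.V = Fintype.card S.V := rfl
    omega
  · by_cases hall : ∀ e' : S.E, S'.tr e' = S.tr e'
    · right
      refine ⟨?_, ?_⟩
      · unfold m1
        congr 1
        exact Finset.sum_congr rfl fun e' _ => hall e'
      · unfold m2
        have hmap : ∀ e' : S.E, (S.C e').map ψ ≤ (S'.C e').map ψ :=
          fun e' => Subgroup.map_mono (hCle e')
        have hle : ∀ e' : S.E, (S'.C e').map ψ ≤ S.Est e' := fun e' => by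
          rw [← hEst]
          rintro _ ⟨p, hp, rfl⟩
          exact S'.map_C_mem_Est hp
        have hne : ∀ e' : S.E, S.tr e' = 0 → ((S.C e').map ψ).relIndex (S.Est e') ≠ 0 := by
          intro e' h0
          refine hT.relIndex (S.edge e') ((hmap e').trans (hle e')) fun hbot => ?_
          obtain ⟨p, hp, hp1⟩ := S.tr_eq_zero.1 h0
          apply hp1
          rw [← Subgroup.mem_bot, ← hbot]
          exact ⟨p, hp, rfl⟩
        have hmul : ∀ e' : S.E, ((S.C e').map ψ).relIndex ((S'.C e').map ψ) *
            ((S'.C e').map ψ).relIndex (S.Est e') = ((S.C e').map ψ).relIndex (S.Est e') :=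
          fun e' => Subgroup.relIndex_mul_relIndex _ _ _ (hmap e') (hle e')
        refine Finset.sum_lt_sum (fun e' _ => ?_) ⟨e, Finset.mem_univ _, ?_⟩
        · change ((S'.C e').map ψ).relIndex (S'.Est e') ≤ _
          rw [hEst]
          rcases Nat.eq_zero_or_pos (S.tr e') with h0 | h0
          · have h1 := hne e' h0
            rw [← hmul e'] at h1 ⊢
            exact Nat.le_mul_of_pos_left _ (Nat.pos_of_ne_zero (left_ne_zero_of_mul h1))
          · have h1 : S.Triv e' := S.tr_eq_one.1 (le_antisymm (S.tr_le_one _) h0)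
            have h2 : S'.Triv e' := S'.tr_eq_one.1
              ((hall e').trans (le_antisymm (S.tr_le_one _) h0))
            have h3 : (S.C e').map ψ = ⊥ := by
              rw [eq_bot_iff]; rintro _ ⟨p, hp, rfl⟩; exact h1 p hp
            have h4 : (S'.C e').map ψ = ⊥ := by
              rw [eq_bot_iff]; rintro _ ⟨p, hp, rfl⟩; exact h2 p hp
            rw [h3, h4]
        · change ((S'.C e).map ψ).relIndex (S'.Est e) < _
          rw [hEst]
          have h1 := hne e (by rw [← hall, htre])
          rw [← hmul e] at h1 ⊢
          have h2 : ((S.C e).map ψ).relIndex ((S'.C e).map ψ) ≠ 1 := by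
            rw [Ne, Subgroup.relIndex_eq_one]
            intro h3
            obtain ⟨p, hp, hpq⟩ := h3 ⟨_, hqC, rfl⟩
            apply hqC'
            have : q⁻¹ = p := by
              rw [← inv_mul_eq_one]
              refine hS (S.src e) _ (mul_mem (inv_mem (inv_mem hq)) (S.mem_C.1 hp).1) ?_
              rw [map_mul, hpq, map_inv, inv_mul_cancel]
            rw [this]; exact hp
          have h3 := left_ne_zero_of_mul h1
          have h4 := right_ne_zero_of_mul h1
          exact lt_mul_left (Nat.pos_of_ne_zero h4) (by omega)
    · left
      unfold m1
      push Not at hall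
      obtain ⟨e', he'⟩ := hall
      have : ∑ e', S'.tr e' < ∑ e', S.tr e' :=
        Finset.sum_lt_sum (fun e' _ => htr e') ⟨e', Finset.mem_univ _, lt_of_le_of_ne (htr e') he'⟩
      have h2 : Fintype.card S'.E = Fintype.card S.E := rfl
      omega

theorem sum_tr_subtype_le (e : S.E) {F : {i : S.E // i ≠ e} → ℕ} (hF : ∀ i, F i ≤ S.tr i.1) :
    ∑ i, F i + S.tr e ≤ ∑ i, S.tr i := by
  rw [Fintype.sum_eq_add_sum_subtype_ne S.tr e, add_comm]
  gcongr with i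
  exact hF i

theorem FoldData.exists_simpler_of_tgt_eq (h : S.FoldData e₁ e₂ q) (hT : IsTreeAction G X adj)
    (hfree : ∀ Q : Subgroup P, (∃ x : X, ∀ q ∈ Q, ψ q • x = x) → IsFreeGroup Q)
    (hS : S.Inj) {K : ℕ} (hK : S.Bdd K) (hle : S.tr e₁ ≤ S.tr e₂) (hne : e₁ ≠ e₂)
    (ht : S.tgt e₁ = S.tgt e₂) :
    ∃ S' : PreSys ψ adj, S'.Bdd K ∧ Lt S' S := by
  set z := (q * S.g e₁)⁻¹ * S.g e₂ with hzdef
  have hzfix := h.fix ht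
  have hgen : GenBy (S.Q (S.tgt e₁) ⊔ Subgroup.zpowers z) (S.n (S.tgt e₁) + S.tr e₂) := by
    rcases Nat.eq_zero_or_pos (S.tr e₂) with h0 | h0
    · obtain ⟨a, ha, b, hb, ha1, hb1, hab⟩ := h.exists_commute hT hS (by omega) h0
      have := hfree (S.Q (S.tgt e₁) ⊔ Subgroup.zpowers z) ⟨S.pos (S.tgt e₁), fun p hp =>
        S.addGen_fix (S.tgt e₁) z hzfix (S.tgt e₁) p (by simpa using hp)⟩
      rw [h0]
      rw [← ht] at hb
      exact (S.gen _).sup_zpowers_of_commute z ha hb ha1 hb1 hab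
    · have : S.tr e₂ = 1 := le_antisymm (S.tr_le_one e₂) h0
      rw [this]
      exact (S.gen _).sup (GenBy.zpowers z)
  let S' := S.addGen (fun i : {i : S.E // i ≠ e₂} => i.1) (S.tgt e₁) z _ hzfix hgen (fun e => by
    rcases eq_or_ne e e₂ with rfl | he
    · refine .inr ⟨⟨e₁, hne⟩, h.src.symm, ht.symm, q, h.src ▸ h.mem, ht.symm, ?_⟩
      simp only [hzdef]; group
    · exact .inl ⟨⟨e, he⟩, rfl⟩)
  have hsum : ∑ e', S'.tr e' + S.tr e₂ ≤ ∑ e', S.tr e' :=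
    sum_tr_subtype_le e₂ fun e' => S.tr_fold_le _ _ _ _ _ _ e'
  have hn : ∑ v, S'.n v + S.n (S.tgt e₁) = ∑ v, S.n v + (S.n (S.tgt e₁) + S.tr e₂) :=
    sum_update_add _ _ _
  have hE : Fintype.card S'.E + 1 = Fintype.card S.E := by
    have := Fintype.card_subtype_compl (fun i : S.E => i = e₂)
    simp only [Fintype.card_subtype_eq] at this
    have h1 : Fintype.card S'.E = Fintype.card {i : S.E // ¬ i = e₂} := rfl
    have h2 : 0 < Fintype.card S.E := Fintype.card_pos_iff.2 ⟨e₂⟩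
    omega
  refine ⟨S', ?_, ?_⟩
  · unfold Bdd cost at hK ⊢
    have : Fintype.card S'.V = Fintype.card S.V := rfl
    omega
  · left
    unfold m1
    omega

theorem FoldData.exists_simpler_of_tgt_ne (h : S.FoldData e₁ e₂ q) (hT : IsTreeAction G X adj)
    (hfree : ∀ Q : Subgroup P, (∃ x : X, ∀ q ∈ Q, ψ q • x = x) → IsFreeGroup Q)
    (hS : S.Inj) {K : ℕ} (hK : S.Bdd K) (hle : S.tr e₁ ≤ S.tr e₂)
    (ht : S.tgt e₁ ≠ S.tgt e₂) :
    ∃ S' : PreSys ψ adj, S'.Bdd K ∧ Lt S' S := by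
  have hne : e₁ ≠ e₂ := fun h => ht (by rw [h])
  set z := (q * S.g e₁)⁻¹ * S.g e₂ with hzdef
  have hzpos : ψ z⁻¹ • S.pos (S.tgt e₁) = S.pos (S.tgt e₂) := by
    rw [hzdef, mul_inv_rev, inv_inv, map_mul, mul_smul, h.pos, map_inv, inv_smul_smul]
  set Qk := (S.Q (S.tgt e₂)).map (MulAut.conj z).toMonoidHom with hQk
  have hmemQk : ∀ b ∈ S.Q (S.tgt e₂), z * b * z⁻¹ ∈ Qk := fun b hb => ⟨b, hb, by simp⟩
  have hfixj : ∀ p ∈ S.Q (S.tgt e₁) ⊔ Qk, ψ p • S.pos (S.tgt e₁) = S.pos (S.tgt e₁) := by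
    have : S.Q (S.tgt e₁) ⊔ Qk ≤ (MulAction.stabilizer G (S.pos (S.tgt e₁))).comap ψ := by
      rw [sup_le_iff]
      refine ⟨S.fix _, ?_⟩
      rintro _ ⟨b, hb, rfl⟩
      change ψ (z * b * z⁻¹) • S.pos (S.tgt e₁) = S.pos (S.tgt e₁)
      rw [map_mul, mul_smul, hzpos, map_mul, mul_smul, S.fix _ b hb, ← hzpos, map_inv,
        smul_inv_smul]
    exact fun p hp => this hp
  have hgen : GenBy (S.Q (S.tgt e₁) ⊔ Qk)
      (S.n (S.tgt e₁) + S.n (S.tgt e₂) - (1 - S.tr e₂)) := by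
    rcases Nat.eq_zero_or_pos (S.tr e₂) with h0 | h0
    · obtain ⟨a, ha, b, hb, ha1, hb1, hab⟩ := h.exists_commute hT hS (by omega) h0
      have := hfree _ ⟨S.pos (S.tgt e₁), hfixj⟩
      rw [h0]
      refine (S.gen _).sup_of_commute ((S.gen _).map _) ha (hmemQk b hb) ha1 ?_ hab
      simpa using hb1
    · have : S.tr e₂ = 1 := le_antisymm (S.tr_le_one e₂) h0
      rw [this]
      exact (S.gen _).sup ((S.gen _).map _)
  have hpos : S.tr e₂ = 0 → 0 < S.n (S.tgt e₁) := fun h0 => by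
    obtain ⟨a, ha, b, hb, ha1, hb1, hab⟩ := h.exists_commute hT hS (by omega) h0
    by_contra h1
    have h2 := S.gen (S.tgt e₁)
    rw [Nat.eq_zero_of_not_pos h1] at h2
    rw [h2.eq_bot] at ha
    exact ha1 ha
  let f : S.V → {x : S.V // x ≠ S.tgt e₂} := fun x =>
    if hx : x = S.tgt e₂ then ⟨S.tgt e₁, ht⟩ else ⟨x, hx⟩
  let t : S.V → P := fun x => if x = S.tgt e₂ then z⁻¹ else 1
  have hfk : f (S.tgt e₂) = ⟨S.tgt e₁, ht⟩ := by simp [f]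
  have htk : t (S.tgt e₂) = z⁻¹ := by simp [t]
  have hfne : ∀ x (hx : x ≠ S.tgt e₂), f x = ⟨x, hx⟩ := fun x hx => by simp [f, hx]
  have htne : ∀ x, x ≠ S.tgt e₂ → t x = 1 := fun x hx => by simp [t, hx]
  let Q' : {x : S.V // x ≠ S.tgt e₂} → Subgroup P := fun x =>
    Function.update S.Q (S.tgt e₁) (S.Q (S.tgt e₁) ⊔ Qk) x
  have hQ'j : Q' ⟨S.tgt e₁, ht⟩ = S.Q (S.tgt e₁) ⊔ Qk := by simp [Q']
  have hQ'ne : ∀ x hx, x ≠ S.tgt e₁ → Q' ⟨x, hx⟩ = S.Q x := fun x hx h => by simp [Q', h]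
  let n' : {x : S.V // x ≠ S.tgt e₂} → ℕ := fun x =>
    Function.update S.n (S.tgt e₁) (S.n (S.tgt e₁) + S.n (S.tgt e₂) - (1 - S.tr e₂)) x
  have hfpos : ∀ x, ψ (t x) • S.pos (f x).1 = S.pos x := fun x => by
    rcases eq_or_ne x (S.tgt e₂) with rfl | hx
    · rw [hfk, htk, hzpos]
    · rw [hfne x hx, htne x hx, map_one, one_smul]
  have hQ : ∀ x, ∀ q ∈ S.Q x, (t x)⁻¹ * q * t x ∈ Q' (f x) := fun x q hq => by
    rcases eq_or_ne x (S.tgt e₂) with rfl | hx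
    · rw [hfk, htk, hQ'j, inv_inv]
      exact Subgroup.mem_sup_right (hmemQk _ hq)
    · rw [hfne x hx, htne x hx, inv_one, one_mul, mul_one]
      rcases eq_or_ne x (S.tgt e₁) with rfl | hx1
      · rw [hQ'j]; exact Subgroup.mem_sup_left hq
      · rwa [hQ'ne x hx hx1]
  let S' : PreSys ψ adj := S.fold f t (fun i : {i : S.E // i ≠ e₂} => i.1) Q'
    (fun x => S.pos x.1) n'
    (fun x => ⟨x.1, hfne x.1 x.2⟩) hQ
    (fun x q hq => by
      obtain ⟨x, hx⟩ := x
      rcases eq_or_ne x (S.tgt e₁) with rfl | hx1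
      · rw [hQ'j] at hq; exact hfixj q hq
      · rw [hQ'ne x hx hx1] at hq; exact S.fix x q hq)
    (fun x => by
      obtain ⟨x, hx⟩ := x
      rcases eq_or_ne x (S.tgt e₁) with rfl | hx1
      · rw [hQ'j]; simpa [n'] using hgen
      · rw [hQ'ne x hx hx1]; simpa [n', hx1] using S.gen x)
    (fun e => by
      rcases eq_or_ne e e₂ with rfl | he
      · refine .inr (.inr ⟨⟨e₁, hne⟩, by rw [h.src], by rw [hfk, hfne _ ht], _,
          hQ _ q (h.src ▸ h.mem), 1, one_mem _, ?_⟩)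
        simp only [htk, htne _ ht, h.src, hzdef]; group
      · exact .inl ⟨⟨e, he⟩, rfl⟩)
    (fun e' => edge_of_pos hT.smul hfpos e'.1)
  have hsum : ∑ e', S'.tr e' + S.tr e₂ ≤ ∑ e', S.tr e' :=
    sum_tr_subtype_le e₂ fun e' => S.tr_fold_le _ _ _ _ _ _ e'
  have hn : ∑ v, S'.n v + (1 - S.tr e₂) = ∑ v, S.n v := by
    have h1 := sum_update_add S.n (S.tgt e₁)
      (S.n (S.tgt e₁) + S.n (S.tgt e₂) - (1 - S.tr e₂))
    rw [Fintype.sum_eq_add_sum_subtype_ne _ (S.tgt e₂), Function.update_of_ne ht.symm] at h1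
    have h2 : ∑ v, S'.n v = ∑ i : {i : S.V // i ≠ S.tgt e₂}, Function.update S.n (S.tgt e₁)
      (S.n (S.tgt e₁) + S.n (S.tgt e₂) - (1 - S.tr e₂)) i.1 := rfl
    have h3 := S.tr_le_one e₂
    rcases Nat.eq_zero_or_pos (S.tr e₂) with h0 | h0
    · have := hpos h0
      omega
    · omega
  have hE : Fintype.card S'.E + 1 = Fintype.card S.E := by
    have := Fintype.card_subtype_compl (fun i : S.E => i = e₂)
    simp only [Fintype.card_subtype_eq] at this
    have h1 : Fintype.card S'.E = Fintype.card {i : S.E // ¬ i = e₂} := rfl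
    have h2 : 0 < Fintype.card S.E := Fintype.card_pos_iff.2 ⟨e₂⟩
    omega
  have hV : Fintype.card S'.V + 1 = Fintype.card S.V := by
    have := Fintype.card_subtype_compl (fun i : S.V => i = S.tgt e₂)
    simp only [Fintype.card_subtype_eq] at this
    have h1 : Fintype.card S'.V = Fintype.card {i : S.V // ¬ i = S.tgt e₂} := rfl
    have h2 : 0 < Fintype.card S.V := Fintype.card_pos_iff.2 ⟨S.tgt e₂⟩
    omega
  have h3 := S.tr_le_one e₂
  refine ⟨S', ?_, ?_⟩
  · unfold Bdd cost at hK ⊢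
    omega
  · left
    unfold m1
    omega

/-- A nontrivial fold simplifies the system. -/
theorem FoldData.exists_simpler (h : S.FoldData e₁ e₂ q) (hT : IsTreeAction G X adj)
    (hfree : ∀ Q : Subgroup P, (∃ x : X, ∀ q ∈ Q, ψ q • x = x) → IsFreeGroup Q)
    (hS : S.Inj) {K : ℕ} (hK : S.Bdd K)
    (hz : ¬ (e₁ = e₂ ∧ (q * S.g e₁)⁻¹ * S.g e₂ ∈ S.Q (S.tgt e₁))) :
    ∃ S' : PreSys ψ adj, S'.Bdd K ∧ Lt S' S := by
  rcases eq_or_ne e₁ e₂ with rfl | hne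
  · exact h.exists_simpler_of_eq hT hfree hS hK fun h => hz ⟨rfl, h⟩
  · rcases le_total (S.tr e₁) (S.tr e₂) with hle | hle
    · by_cases ht : S.tgt e₁ = S.tgt e₂
      · exact h.exists_simpler_of_tgt_eq hT hfree hS hK hle hne ht
      · exact h.exists_simpler_of_tgt_ne hT hfree hS hK hle ht
    · by_cases ht : S.tgt e₁ = S.tgt e₂
      · exact h.symm.exists_simpler_of_tgt_eq hT hfree hS hK hle hne.symm ht.symm
      · exact h.symm.exists_simpler_of_tgt_ne hT hfree hS hK hle (Ne.symm ht)

end PreSys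

namespace PreSys
variable {P G X : Type} [Group P] [Group G] [MulAction G X] {ψ : P →* G} {adj : X → X → Prop}
variable (S : PreSys ψ adj) (hadj : ∀ (g : G) {x y : X}, adj x y → adj (g • x) (g • y))

include hadj in
theorem edge_symm (e : S.E) : adj (ψ (S.g e)⁻¹ • S.pos (S.src e)) (S.pos (S.tgt e)) := by
  have := hadj (ψ (S.g e))⁻¹ (S.edge e)
  rwa [inv_smul_smul, ← map_inv] at this

/-- The system with all edges reversed. -/
abbrev dual : PreSys ψ (fun x y => adj y x) where
  V := S.V
  E := S.E
  src := S.tgt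
  tgt := S.src
  g e := (S.g e)⁻¹
  Q := S.Q
  pos := S.pos
  n := S.n
  fix := S.fix
  edge := S.edge_symm hadj
  gen := S.gen
  ne := S.ne
  conn R h1 h2 := S.conn R h1 fun p e => by
    rw [h2]; simp

variable {S}

theorem mem_C_dual {e : S.E} {p : P} :
    p ∈ (S.dual hadj).C e ↔ S.g e * p * (S.g e)⁻¹ ∈ S.C e := by
  refine ((S.dual hadj).mem_C).trans ?_
  rw [mem_C, and_comm]
  simp [mul_assoc]

theorem tr_dual (e : S.E) : (S.dual hadj).tr e = S.tr e := by
  have : (S.dual hadj).Triv e ↔ S.Triv e := by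
    constructor
    · intro h p hp
      have := h ((S.g e)⁻¹ * p * S.g e) (by rw [mem_C_dual]; simpa [mul_assoc] using hp)
      have h3 : p = S.g e * ((S.g e)⁻¹ * p * S.g e) * (S.g e)⁻¹ := by group
      rw [h3, map_mul, map_mul, this]
      simp
    · intro h p hp
      rw [mem_C_dual] at hp
      simpa using h _ hp
  rcases Nat.eq_zero_or_pos (S.tr e) with h | h
  · have h1 : ¬ S.Triv e := fun h2 => by rw [S.tr_eq_one.2 h2] at h; omega
    have h2 := (S.dual hadj).tr_le_one e
    have h3 : ¬ (S.dual hadj).tr e = 1 := fun h3 => h1 (this.1 ((S.dual hadj).tr_eq_one.1 h3))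
    omega
  · have h1 : S.tr e = 1 := le_antisymm (S.tr_le_one _) h
    rw [h1]
    exact (S.dual hadj).tr_eq_one.2 (this.2 (S.tr_eq_one.1 h1))

theorem cost_dual : (S.dual hadj).cost = S.cost := by
  unfold cost
  congr 1
  exact Finset.sum_congr rfl fun e _ => tr_dual hadj e

theorem m1_dual : (S.dual hadj).m1 = S.m1 := by
  unfold m1
  congr 1
  exact Finset.sum_congr rfl fun e _ => tr_dual hadj e

theorem m2_dual : (S.dual hadj).m2 = S.m2 := by
  unfold m2
  refine Finset.sum_congr rfl fun e _ => ?_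
  have h1 : ((S.C e).map ψ) =
      (((S.dual hadj).C e).map ψ).map (MulAut.conj (ψ (S.g e))).toMonoidHom := by
    ext x
    simp only [Subgroup.mem_map]
    constructor
    · rintro ⟨p, hp, rfl⟩
      exact ⟨_, ⟨(S.g e)⁻¹ * p * S.g e, by rw [mem_C_dual]; simpa [mul_assoc] using hp, rfl⟩,
        by simp [mul_assoc]⟩
    · rintro ⟨_, ⟨p, hp, rfl⟩, rfl⟩
      rw [mem_C_dual] at hp
      exact ⟨_, hp, by simp⟩
  have h2 : S.Est e = ((S.dual hadj).Est e).map (MulAut.conj (ψ (S.g e))).toMonoidHom := by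
    ext x
    rw [Subgroup.mem_map_equiv, mem_Est]
    refine Iff.trans ?_ ((S.dual hadj).mem_Est).symm
    simp only [MulAut.conj_symm_apply, mul_smul, map_inv, inv_smul_eq_iff, smul_inv_smul]
    rw [and_comm]
  rw [h1, h2, Subgroup.relIndex_map_map_of_injective _ _ (MulEquiv.injective _)]

/-- Systems without possible folds along edges with the same source. -/
def NoFold (S : PreSys ψ adj) : Prop := ∀ e₁ e₂ q, S.FoldData e₁ e₂ q →
  e₁ = e₂ ∧ (q * S.g e₁)⁻¹ * S.g e₂ ∈ S.Q (S.tgt e₁)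

/-- Systems which cannot be simplified. -/
def Minimal (S : PreSys ψ adj) (K : ℕ) : Prop :=
  S.Bdd K ∧ ∀ S' : PreSys ψ adj, S'.Bdd K → ¬ Lt S' S

theorem exists_minimal {K : ℕ} (S : PreSys ψ adj) (h : S.Bdd K) :
    ∃ S : PreSys ψ adj, S.Minimal K := by
  have wf : WellFounded (fun S' S : PreSys ψ adj => Lt S' S) := by
    have := InvImage.wf (fun S : PreSys ψ adj => toLex (S.m1, S.m2))
      (wellFounded_lt (α := ℕ ×ₗ ℕ))
    convert this using 3
    simp [InvImage, Prod.Lex.toLex_lt_toLex, Lt]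
  obtain ⟨S₀, h0, h1⟩ := wf.has_min {S | S.Bdd K} ⟨S, h⟩
  exact ⟨S₀, h0, fun S' h' => h1 S' h'⟩

theorem Minimal.noFold {K : ℕ} (h : S.Minimal K) (hT : IsTreeAction G X adj)
    (hfree : ∀ Q : Subgroup P, (∃ x : X, ∀ q ∈ Q, ψ q • x = x) → IsFreeGroup Q)
    (hS : S.Inj) : S.NoFold := by
  intro e₁ e₂ q hd
  by_contra hz
  obtain ⟨S', h1, h2⟩ := hd.exists_simpler hT hfree hS h.1 hz
  exact h.2 S' h1 h2

theorem Minimal.noFold_dual {K : ℕ} (h : S.Minimal K) (hT : IsTreeAction G X adj)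
    (hfree : ∀ Q : Subgroup P, (∃ x : X, ∀ q ∈ Q, ψ q • x = x) → IsFreeGroup Q)
    (hS : S.Inj) : (S.dual hT.smul).NoFold := by
  intro e₁ e₂ q hd
  by_contra hz
  obtain ⟨S', h1, h2⟩ := hd.exists_simpler hT.flip hfree hS (K := K)
    (by unfold Bdd; rw [cost_dual]; exact h.1) hz
  refine h.2 (S'.dual hT.flip.smul) (by unfold Bdd; rw [cost_dual]; exact h1) ?_
  unfold Lt at h2 ⊢
  rwa [m1_dual, m2_dual, ← m1_dual hT.smul (S := S), ← m2_dual hT.smul (S := S)]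

end PreSys

/-- A locally injective map from a connected graph to a tree is injective. -/
theorem IsTreeAction.eq_of_locally_injective {G X : Type} [Group G] [MulAction G X]
    {adj : X → X → Prop} (hT : IsTreeAction G X adj) {Y : Type} (step : Y → Y → Prop)
    (π : Y → X) (hπ : ∀ {x y}, step x y → adj (π x) (π y) ∨ adj (π y) (π x))
    (hloc : ∀ {x y z}, step x y → step y z → π x = π z → x = z) {x y : Y}
    (h : Relation.ReflTransGen step x y) (hxy : π x = π y) : x = y := by
  classical
  have hex : ∃ n, ∃ f : ℕ → Y, f 0 = x ∧ f n = y ∧ ∀ k < n, step (f k) (f (k + 1)) :=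
    HNNTree.exists_walk_of_reflTransGen h
  obtain ⟨f, h0, h1, h2⟩ := Nat.find_spec hex
  have hmin := fun m => Nat.find_min hex (m := m)
  set n := Nat.find hex
  rcases Nat.eq_zero_or_pos n with hn | hn
  · rw [← h0, ← h1, hn]
  exfalso
  refine hT.no_cycle n (fun k => π (f k)) hn (fun k hk => hπ (h2 k hk)) (fun k hk heq => ?_)
    (by simpa [h0, h1] using hxy)
  have heq' := hloc (h2 k (by omega)) (h2 (k + 1) (by omega)) heq
  refine hmin (n - 2) (by omega) ⟨fun i => if i ≤ k then f i else f (i + 2), by simp [h0], ?_, ?_⟩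
  · dsimp only
    split_ifs with h
    · have : n - 2 = k := by omega
      rw [this, heq', ← h1]
      congr 1; omega
    · rw [← h1]; congr 1; omega
  · intro i hi
    dsimp only
    split_ifs with h h' h'
    · exact h2 i (by omega)
    · have : i = k := by omega
      subst this
      rw [heq']
      exact h2 (i + 2) (by omega)
    · omega
    · have := h2 (i + 2) (by omega)
      rwa [show i + 2 + 1 = i + 1 + 2 by omega] at this

namespace PreSys
variable {P G X : Type} [Group P] [Group G] [MulAction G X] {ψ : P →* G} {adj : X → X → Prop}
variable (S : PreSys ψ adj)

/-- The vertices of the tree of cosets. -/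
abbrev Coset := (v : S.V) × (P ⧸ S.Q v)

variable {S}

theorem coset_eq_iff {v w : S.V} {p q : P} :
    (⟨v, (p : P ⧸ S.Q v)⟩ : S.Coset) = ⟨w, (q : P ⧸ S.Q w)⟩ ↔ v = w ∧ p⁻¹ * q ∈ S.Q v := by
  constructor
  · intro h
    obtain ⟨rfl, h⟩ := Sigma.mk.inj_iff.1 h
    exact ⟨rfl, QuotientGroup.eq.1 (eq_of_heq h)⟩
  · rintro ⟨rfl, h⟩
    rw [QuotientGroup.eq.2 h]

/-- Adjacency between cosets. -/
def fstep (y z : S.Coset) : Prop :=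
  ∃ (p : P) (e : S.E), y = ⟨S.src e, (p : P ⧸ S.Q _)⟩ ∧ z = ⟨S.tgt e, (p * S.g e : P)⟩

/-- The map from cosets to the tree. -/
def cosetPos (y : S.Coset) : X :=
  Quotient.lift (fun p : P => ψ p • S.pos y.1) (fun a b h => by
    have h' := QuotientGroup.leftRel_apply.1 h
    have := S.fix _ _ h'
    rw [map_mul, map_inv, mul_smul, inv_smul_eq_iff] at this
    exact this.symm) y.2

theorem cosetPos_mk (v : S.V) (p : P) :
    cosetPos (⟨v, (p : P ⧸ S.Q v)⟩ : S.Coset) = ψ p • S.pos v := rfl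

/-- A system without folds which is injective on vertex groups is injective. -/
theorem injective_of_noFold (hT : IsTreeAction G X adj) (hS : S.Inj) (h1 : S.NoFold)
    (h2 : (S.dual hT.smul).NoFold) : Function.Injective ψ := by
  obtain ⟨v₀⟩ := S.ne
  rw [injective_iff_map_eq_one]
  intro p₀ hp₀
  let step : S.Coset → S.Coset → Prop := fun y z => fstep y z ∨ fstep z y
  have hadj : ∀ {y z : S.Coset}, fstep y z → adj (cosetPos y) (cosetPos z) := by
    rintro _ _ ⟨p, e, rfl, rfl⟩
    rw [cosetPos_mk, cosetPos_mk, map_mul, mul_smul]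
    exact hT.smul _ (S.edge e)
  have hconn : Relation.ReflTransGen step ⟨v₀, ((1 : P) : P ⧸ S.Q v₀)⟩
      ⟨v₀, (p₀ : P ⧸ S.Q v₀)⟩ := by
    refine S.conn (fun p v => Relation.ReflTransGen step ⟨v₀, ((1 : P) : P ⧸ S.Q v₀)⟩
      ⟨v, (p : P ⧸ S.Q v)⟩) ?_ ?_ 1 v₀ p₀ v₀ .refl
    · intro p v q hq h
      have : (⟨v, ((p * q : P) : P ⧸ S.Q v)⟩ : S.Coset) = ⟨v, (p : P ⧸ S.Q v)⟩ := by
        rw [coset_eq_iff]; simpa using hq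
      rwa [this]
    · intro p e
      exact ⟨fun h => h.tail (.inl ⟨p, e, rfl, rfl⟩), fun h => h.tail (.inr ⟨p, e, rfl, rfl⟩)⟩
  have key := hT.eq_of_locally_injective step cosetPos (fun h => h.imp hadj hadj) ?_ hconn
    (by rw [cosetPos_mk, cosetPos_mk, hp₀, map_one])
  · rw [coset_eq_iff] at key
    exact hS v₀ p₀ (by simpa using key.2) hp₀
  · rintro x y z (hxy | hxy) (hyz | hyz) hxz
    · exact absurd (hxz ▸ hadj hyz) (hT.asymm (hadj hxy))
    · obtain ⟨p, e, rfl, rfl⟩ := hxy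
      obtain ⟨p', e', rfl, h⟩ := hyz
      obtain ⟨h, hm⟩ := coset_eq_iff.1 h
      rw [cosetPos_mk, cosetPos_mk] at hxz
      have := h2 e e' ((p' * S.g e')⁻¹ * (p * S.g e)) ⟨h, by
        change _ ∈ S.Q (S.tgt e); simpa using inv_mem hm, by
          change ψ (_ * (S.g e)⁻¹) • S.pos (S.src e) = ψ (S.g e')⁻¹ • S.pos (S.src e')
          have h3 : (p' * S.g e')⁻¹ * (p * S.g e) * (S.g e)⁻¹ = (S.g e')⁻¹ * p'⁻¹ * p := by group
          rw [h3, map_mul, mul_smul, hxz, ← mul_smul, ← map_mul]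
          simp⟩
      obtain ⟨rfl, hm'⟩ := this
      rw [coset_eq_iff]
      refine ⟨rfl, ?_⟩
      change _ ∈ S.Q (S.src e) at hm'
      simpa [mul_assoc] using hm'
    · obtain ⟨p, e, rfl, rfl⟩ := hxy
      obtain ⟨p', e', h, rfl⟩ := hyz
      obtain ⟨h, hm⟩ := coset_eq_iff.1 h
      rw [cosetPos_mk, cosetPos_mk] at hxz
      have := h1 e e' (p'⁻¹ * p) ⟨h, by simpa using inv_mem hm, by
          rw [mul_assoc, map_mul, mul_smul, hxz, ← mul_smul, ← map_mul]
          simp⟩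
      obtain ⟨rfl, hm'⟩ := this
      rw [coset_eq_iff]
      refine ⟨rfl, ?_⟩
      simpa [mul_assoc] using hm'
    · exact absurd (hxz ▸ hadj hyz) (fun h => hT.asymm h (hadj hxy))

end PreSys

namespace PreSys
variable {P G X : Type} [Group P] [Group G] [MulAction G X] {ψ : P →* G} {adj : X → X → Prop}
variable (S : PreSys ψ adj)

/-- Replacing the group by its image. -/
abbrev push (n' : S.V → ℕ) (hgen : ∀ v, GenBy ((S.Q v).map ψ.rangeRestrict) (n' v)) :
    PreSys ψ.range.subtype adj where
  V := S.V
  E := S.E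
  ne := S.ne
  src := S.src
  tgt := S.tgt
  g e := ψ.rangeRestrict (S.g e)
  Q v := (S.Q v).map ψ.rangeRestrict
  pos := S.pos
  n := n'
  fix := by
    rintro v _ ⟨q, hq, rfl⟩
    exact S.fix v q hq
  edge := S.edge
  gen := hgen
  conn R h1 h2 p v p' v' h := by
    obtain ⟨p, rfl⟩ := ψ.rangeRestrict_surjective p
    obtain ⟨p', rfl⟩ := ψ.rangeRestrict_surjective p'
    refine S.conn (fun p v => R (ψ.rangeRestrict p) v) ?_ ?_ p v p' v' h
    · intro p v q hq h
      rw [map_mul]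
      exact h1 _ _ _ ⟨q, hq, rfl⟩ h
    · intro p e
      rw [map_mul]
      exact h2 _ e

variable {S}

theorem tr_push_le {n' : S.V → ℕ} (hgen : ∀ v, GenBy ((S.Q v).map ψ.rangeRestrict) (n' v))
    (e : S.E) : (S.push n' hgen).tr e ≤ S.tr e := by
  rcases Nat.eq_zero_or_pos (S.tr e) with h | h
  · obtain ⟨p, hp, hp1⟩ := S.tr_eq_zero.1 h
    rw [h, Nat.le_zero]
    have := S.mem_C.1 hp
    refine (tr_eq_zero _).2 ⟨ψ.rangeRestrict p, (mem_C _).2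
      ⟨⟨p, this.1, rfl⟩, ⟨_, this.2, by simp⟩⟩, hp1⟩
  · exact (tr_le_one _ _).trans h

theorem exists_push {K : ℕ} (hK : S.Bdd (K + 1)) (hS : ¬ S.Inj)
    (hfree : ∀ (Q : Subgroup ψ.range), (∃ x : X, ∀ q ∈ Q, (q : G) • x = x) → IsFreeGroup Q) :
    ∃ S' : PreSys ψ.range.subtype adj, S'.Bdd K := by
  unfold Inj at hS
  push Not at hS
  obtain ⟨v₀, q, hq, hq1, hq2⟩ := hS
  have hgen₀ : GenBy ((S.Q v₀).map ψ.rangeRestrict) (S.n v₀ - 1) := by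
    obtain ⟨f, hf⟩ := S.gen v₀
    rw [← hf] at hq
    obtain ⟨w, rfl⟩ := exists_lift_eq hq
    have hw : w ≠ 1 := by rintro rfl; simp at hq2
    have := hfree ((S.Q v₀).map ψ.rangeRestrict) ⟨S.pos v₀, by
      rintro _ ⟨q, hq, rfl⟩; exact S.fix v₀ q hq⟩
    have h3 := genBy_of_relation (Q := (S.Q v₀).map ψ.rangeRestrict) (ψ.rangeRestrict ∘ f)
      (by rw [Set.range_comp, ← MonoidHom.map_closure, hf]) w hw (by
        have : FreeGroup.lift (ψ.rangeRestrict ∘ f) = ψ.rangeRestrict.comp (FreeGroup.lift f) := by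
          ext; simp
        rw [this, MonoidHom.comp_apply]
        ext
        simpa using hq1)
    simpa using h3
  have hpos : 0 < S.n v₀ := by
    by_contra h
    have := S.gen v₀
    rw [Nat.eq_zero_of_not_pos h] at this
    rw [this.eq_bot] at hq
    exact hq2 hq
  have hgen : ∀ v, GenBy ((S.Q v).map ψ.rangeRestrict)
      (Function.update S.n v₀ (S.n v₀ - 1) v) := fun v => by
    rcases eq_or_ne v v₀ with rfl | h
    · simpa using hgen₀
    · simpa [h] using (S.gen v).map _
  let S' := S.push _ hgen
  refine ⟨S', ?_⟩
  have h1 : ∑ e, S'.tr e ≤ ∑ e, S.tr e := Finset.sum_le_sum fun e _ => tr_push_le hgen e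
  have h2 : ∑ v, S'.n v + S.n v₀ = ∑ v, S.n v + (S.n v₀ - 1) := sum_update_add _ _ _
  have h3 : Fintype.card S'.V = Fintype.card S.V := rfl
  unfold Bdd cost at hK ⊢
  omega

theorem card_subtype_ne {α : Type} [Fintype α] [DecidableEq α] (a : α) :
    Fintype.card {i : α // i ≠ a} + 1 = Fintype.card α := by
  have := Fintype.card_subtype_compl (fun i : α => i = a)
  simp only [Fintype.card_subtype_eq] at this
  have h2 : 0 < Fintype.card α := Fintype.card_pos_iff.2 ⟨a⟩
  have h1 : Fintype.card {i : α // i ≠ a} = Fintype.card {i : α // ¬ i = a} := rfl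
  omega

/-- Removal of a leaf whose vertex group is absorbed by its neighbour. -/
theorem exists_simpler_of_leaf {K : ℕ} (hK : S.Bdd K) (e₀ : S.E) (hne : S.src e₀ ≠ S.tgt e₀)
    (hleaf : ∀ e, S.src e = S.tgt e₀ ∨ S.tgt e = S.tgt e₀ → e = e₀)
    (hQ₀ : ∀ q ∈ S.Q (S.tgt e₀), S.g e₀ * q * (S.g e₀)⁻¹ ∈ S.Q (S.src e₀)) :
    ∃ S' : PreSys ψ adj, S'.Bdd K ∧ Lt S' S := by
  let f : S.V → {x : S.V // x ≠ S.tgt e₀} := fun x =>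
    if hx : x = S.tgt e₀ then ⟨S.src e₀, hne⟩ else ⟨x, hx⟩
  let t : S.V → P := fun x => if x = S.tgt e₀ then (S.g e₀)⁻¹ else 1
  have hfk : f (S.tgt e₀) = ⟨S.src e₀, hne⟩ := by simp [f]
  have htk : t (S.tgt e₀) = (S.g e₀)⁻¹ := by simp [t]
  have hfne : ∀ x (hx : x ≠ S.tgt e₀), f x = ⟨x, hx⟩ := fun x hx => by simp [f, hx]
  have htne : ∀ x, x ≠ S.tgt e₀ → t x = 1 := fun x hx => by simp [t, hx]
  let S' : PreSys ψ adj := S.fold f t (fun i : {i : S.E // i ≠ e₀} => i.1)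
    (fun x => S.Q x.1) (fun x => S.pos x.1) (fun x => S.n x.1)
    (fun x => ⟨x.1, hfne x.1 x.2⟩)
    (fun x q hq => by
      rcases eq_or_ne x (S.tgt e₀) with rfl | hx
      · rw [hfk, htk, inv_inv]; exact hQ₀ q hq
      · rw [hfne x hx, htne x hx]; simpa using hq)
    (fun x q hq => S.fix x.1 q hq) (fun x => S.gen x.1)
    (fun e => by
      rcases eq_or_ne e e₀ with rfl | he
      · refine .inr (.inl ?_)
        rw [hfk, hfne _ hne, htk, htne _ hne]
        simp [one_mem]
      · exact .inl ⟨⟨e, he⟩, rfl⟩)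
    (fun e' => by
      have h1 : S.src e'.1 ≠ S.tgt e₀ := fun h => e'.2 (hleaf _ (.inl h))
      have h2 : S.tgt e'.1 ≠ S.tgt e₀ := fun h => e'.2 (hleaf _ (.inr h))
      rw [hfne _ h1, hfne _ h2, htne _ h1, htne _ h2]
      simpa using S.edge e'.1)
  have hsum : ∑ e', S'.tr e' + S.tr e₀ ≤ ∑ e', S.tr e' :=
    sum_tr_subtype_le e₀ fun e' => S.tr_fold_le _ _ _ _ _ _ e'
  have hn : S.n (S.tgt e₀) + ∑ v, S'.n v = ∑ v, S.n v :=
    (Fintype.sum_eq_add_sum_subtype_ne S.n (S.tgt e₀)).symm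
  have hE : Fintype.card S'.E + 1 = Fintype.card S.E := card_subtype_ne e₀
  have hV : Fintype.card S'.V + 1 = Fintype.card S.V := card_subtype_ne (S.tgt e₀)
  have hpos : S.n (S.tgt e₀) = 0 → S.tr e₀ = 1 := fun h0 => by
    rw [tr_eq_one]
    intro p hp
    have := S.gen (S.tgt e₀)
    rw [h0] at this
    have h1 := (S.mem_C.1 hp).2
    rw [this.eq_bot, Subgroup.mem_bot] at h1
    have h3 : p = S.g e₀ * ((S.g e₀)⁻¹ * p * S.g e₀) * (S.g e₀)⁻¹ := by group
    rw [h3, h1]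
    simp
  refine ⟨S', ?_, ?_⟩
  · unfold Bdd cost at hK ⊢
    omega
  · left
    unfold m1
    omega

theorem exists_simpler_of_leaf' (hadj : ∀ (g : G) {x y : X}, adj x y → adj (g • x) (g • y))
    {K : ℕ} (hK : S.Bdd K) (e₀ : S.E) (hne : S.src e₀ ≠ S.tgt e₀)
    (hleaf : ∀ e, S.src e = S.src e₀ ∨ S.tgt e = S.src e₀ → e = e₀)
    (hQ₀ : ∀ q ∈ S.Q (S.src e₀), (S.g e₀)⁻¹ * q * S.g e₀ ∈ S.Q (S.tgt e₀)) :
    ∃ S' : PreSys ψ adj, S'.Bdd K ∧ Lt S' S := by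
  obtain ⟨S', h1, h2⟩ := exists_simpler_of_leaf (S := S.dual hadj) (K := K)
    (by unfold Bdd; rw [cost_dual]; exact hK) e₀ hne.symm (fun e h => hleaf e h.symm)
    (fun q hq => by simpa using hQ₀ q hq)
  have hadj' : ∀ (g : G) {x y : X}, adj y x → adj (g • y) (g • x) := fun g _ _ h => hadj g h
  refine ⟨S'.dual hadj', by unfold Bdd; rw [cost_dual]; exact h1, ?_⟩
  unfold Lt at h2 ⊢
  rwa [m1_dual, m2_dual, ← m1_dual hadj (S := S), ← m2_dual hadj (S := S)]

end PreSys

namespace PreSys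

/-- The fundamental group of a connected graph of groups is generated by the expected number of
elements. -/
theorem genBy_top {P : Type} [Group P] (S : PreSys (1 : P →* Unit) (fun _ _ : Unit => True))
    (k : ℕ) (hk : ∑ v, S.n v + Fintype.card S.E + 1 ≤ k + Fintype.card S.V) :
    GenBy (⊤ : Subgroup P) k := by
  induction hN : Fintype.card S.V generalizing S k with
  | zero =>
    have := S.ne
    exact absurd hN Fintype.card_ne_zero
  | succ N ih =>
  by_cases hloop : ∀ e, S.src e = S.tgt e
  · obtain ⟨v₀⟩ := S.ne
    have hV : ∀ v, v = v₀ := fun v =>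
      S.conn (fun _ v => v = v₀) (fun _ _ _ _ h => h) (fun _ e => by rw [hloop]) 1 v₀ 1 v rfl
    have hcard : Fintype.card S.V = 1 := Fintype.card_eq_one_iff.2 ⟨v₀, hV⟩
    have htop : S.Q v₀ ⊔ Subgroup.closure (Set.range S.g) = ⊤ := by
      rw [eq_top_iff]
      intro p _
      refine S.conn (fun p _ => p ∈ S.Q v₀ ⊔ Subgroup.closure (Set.range S.g)) ?_ ?_ 1 v₀ p v₀
        (one_mem _)
      · intro p v q hq h
        rw [hV v] at hq
        exact mul_mem h (Subgroup.mem_sup_left hq)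
      · intro p e
        refine (Subgroup.mul_mem_cancel_right _ (Subgroup.mem_sup_right ?_)).symm
        exact Subgroup.subset_closure ⟨e, rfl⟩
    rw [← htop]
    refine ((S.gen v₀).sup (GenBy.of_fintype S.g rfl le_rfl)).mono ?_
    have : S.n v₀ ≤ ∑ v, S.n v :=
      Finset.single_le_sum (fun _ _ => Nat.zero_le _) (Finset.mem_univ _)
    rw [Nat.card_eq_fintype_card]
    omega
  · push Not at hloop
    obtain ⟨e₀, hne⟩ := hloop
    let f : S.V → {x : S.V // x ≠ S.tgt e₀} := fun x =>
      if hx : x = S.tgt e₀ then ⟨S.src e₀, hne⟩ else ⟨x, hx⟩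
    let t : S.V → P := fun x => if x = S.tgt e₀ then (S.g e₀)⁻¹ else 1
    have hfk : f (S.tgt e₀) = ⟨S.src e₀, hne⟩ := by simp [f]
    have htk : t (S.tgt e₀) = (S.g e₀)⁻¹ := by simp [t]
    have hfne : ∀ x (hx : x ≠ S.tgt e₀), f x = ⟨x, hx⟩ := fun x hx => by simp [f, hx]
    have htne : ∀ x, x ≠ S.tgt e₀ → t x = 1 := fun x hx => by simp [t, hx]
    set Qk := (S.Q (S.tgt e₀)).map (MulAut.conj (S.g e₀)).toMonoidHom with hQk
    have hmemQk : ∀ b ∈ S.Q (S.tgt e₀), S.g e₀ * b * (S.g e₀)⁻¹ ∈ Qk := fun b hb => ⟨b, hb, by simp⟩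
    let Q' : {x : S.V // x ≠ S.tgt e₀} → Subgroup P := fun x =>
      Function.update S.Q (S.src e₀) (S.Q (S.src e₀) ⊔ Qk) x
    have hQ'j : Q' ⟨S.src e₀, hne⟩ = S.Q (S.src e₀) ⊔ Qk := by simp [Q']
    have hQ'ne : ∀ x hx, x ≠ S.src e₀ → Q' ⟨x, hx⟩ = S.Q x := fun x hx h => by simp [Q', h]
    let n' : {x : S.V // x ≠ S.tgt e₀} → ℕ := fun x =>
      Function.update S.n (S.src e₀) (S.n (S.src e₀) + S.n (S.tgt e₀)) x
    let S' : PreSys (1 : P →* Unit) (fun _ _ : Unit => True) :=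
      S.fold f t (fun i : {i : S.E // i ≠ e₀} => i.1) Q' (fun _ => ()) n'
      (fun x => ⟨x.1, hfne x.1 x.2⟩)
      (fun x q hq => by
        rcases eq_or_ne x (S.tgt e₀) with rfl | hx
        · rw [hfk, htk, inv_inv, hQ'j]; exact Subgroup.mem_sup_right (hmemQk q hq)
        · rw [hfne x hx, htne x hx]
          rcases eq_or_ne x (S.src e₀) with rfl | hx1
          · rw [hQ'j]; exact Subgroup.mem_sup_left (by simpa using hq)
          · rw [hQ'ne _ hx hx1]; simpa using hq)
      (fun _ _ _ => rfl)
      (fun x => by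
        obtain ⟨x, hx⟩ := x
        rcases eq_or_ne x (S.src e₀) with rfl | hx1
        · rw [hQ'j]; simpa [n'] using (S.gen (S.src e₀)).sup ((S.gen (S.tgt e₀)).map _)
        · rw [hQ'ne x hx hx1]; simpa [n', hx1] using S.gen x)
      (fun e => by
        rcases eq_or_ne e e₀ with rfl | he
        · refine .inr (.inl ?_)
          rw [hfk, hfne _ hne, htk, htne _ hne]
          simp [one_mem]
        · exact .inl ⟨⟨e, he⟩, rfl⟩)
      (fun _ => trivial)
    have hE : Fintype.card S'.E + 1 = Fintype.card S.E := card_subtype_ne e₀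
    have hV : Fintype.card S'.V + 1 = Fintype.card S.V := card_subtype_ne (S.tgt e₀)
    have hn : ∑ v, S'.n v = ∑ v, S.n v := by
      have h1 := sum_update_add S.n (S.src e₀) (S.n (S.src e₀) + S.n (S.tgt e₀))
      rw [Fintype.sum_eq_add_sum_subtype_ne _ (S.tgt e₀), Function.update_of_ne hne.symm] at h1
      have h2 : ∑ v, S'.n v = ∑ i : {i : S.V // i ≠ S.tgt e₀}, Function.update S.n (S.src e₀)
        (S.n (S.src e₀) + S.n (S.tgt e₀)) i.1 := rfl
      omega
    exact ih S' k (by omega) (by omega)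

/-- The rose with subdivided petals, mapped to a tree. -/
theorem exists_initial {G X : Type} [Group G] [MulAction G X] {adj : X → X → Prop}
    (hT : IsTreeAction G X adj) {x₀ y₀ : X} (hxy : adj x₀ y₀) {r : ℕ}
    (ψ : FreeGroup (Fin r) →* G) : ∃ S : PreSys ψ adj, S.Bdd r := by
  have hwalk : ∀ i, ∃ (n : ℕ) (f : ℕ → X), f 0 = x₀ ∧ f (n + 1) = ψ (.of i) • x₀ ∧
      ∀ k < n + 1, adj (f k) (f (k + 1)) ∨ adj (f (k + 1)) (f k) := by
    intro i
    obtain ⟨n, f, h0, h1, h2⟩ := hT.conn x₀ (ψ (.of i) • x₀)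
    rcases n with _ | n
    · have h3 : x₀ = ψ (.of i) • x₀ := h0.symm.trans h1
      refine ⟨1, fun k => if k = 1 then y₀ else x₀, by simp, by simpa using h3, fun k hk => ?_⟩
      interval_cases k
      · simpa using .inl hxy
      · simpa using .inr hxy
    · exact ⟨n, f, h0, h1, h2⟩
  choose N f hf0 hf1 hf2 using hwalk
  let V := Option (Σ i : Fin r, Fin (N i))
  let E := Σ i : Fin r, Fin (N i + 1)
  let vert : Fin r → ℕ → V := fun i k => match k with
    | 0 => none
    | k + 1 => if h : k < N i then some ⟨i, k, h⟩ else none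
  let h : Fin r → ℕ → FreeGroup (Fin r) := fun i k => if k < N i + 1 then 1 else .of i
  let pos : V → X := fun v => match v with
    | none => x₀
    | some ⟨i, k⟩ => f i (k + 1)
  have hpos : ∀ i, ∀ k ≤ N i + 1, ψ (h i k) • pos (vert i k) = f i k := by
    intro i k hk
    rcases k with _ | k
    · simp [h, pos, vert, hf0]
    · by_cases hk' : k < N i
      · simp [h, pos, vert, hk']
      · have : k = N i := by omega
        subst this
        simp [h, pos, vert, hf1]
  have hedge : ∀ i, ∀ k < N i + 1, adj (pos (vert i k)) (ψ ((h i k)⁻¹ * h i (k + 1)) •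
      pos (vert i (k + 1))) ∨ adj (pos (vert i (k + 1))) (ψ ((h i (k + 1))⁻¹ * h i k) •
      pos (vert i k)) := by
    intro i k hk
    refine (hf2 i k hk).imp (fun h1 => ?_) (fun h1 => ?_)
    · have := hT.smul (ψ (h i k))⁻¹ h1
      rw [← hpos i k (by omega), ← hpos i (k + 1) (by omega), inv_smul_smul] at this
      simpa [mul_smul] using this
    · have := hT.smul (ψ (h i (k + 1)))⁻¹ h1
      rw [← hpos i k (by omega), ← hpos i (k + 1) (by omega), inv_smul_smul] at this
      simpa [mul_smul] using this
  have hedge' : ∀ e : E, ∃ a b : V, ∃ g : FreeGroup (Fin r), adj (pos a) (ψ g • pos b) ∧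
      ∀ R : FreeGroup (Fin r) → V → Prop, (∀ p, R p a ↔ R (p * g) b) →
        ∀ p, R (p * h e.1 e.2) (vert e.1 e.2) ↔ R (p * h e.1 (e.2 + 1)) (vert e.1 (e.2 + 1)) := by
    rintro ⟨i, k⟩
    rcases hedge i k k.2 with h1 | h1
    · refine ⟨_, _, _, h1, fun R hR p => ?_⟩
      rw [hR]; simp
    · refine ⟨_, _, _, h1, fun R hR p => ?_⟩
      refine Iff.symm ?_
      rw [hR]; simp
  choose src tgt g hadj hR using hedge'
  let S : PreSys ψ adj :=
    { V := V, E := E, ne := ⟨none⟩, src := src, tgt := tgt, g := g, Q := fun _ => ⊥, pos := pos,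
      n := fun _ => 0
      fix := by
        intro v q hq
        rw [Subgroup.mem_bot] at hq
        simp [hq]
      edge := hadj
      gen := fun _ => GenBy.bot
      conn := by
        intro R _ hstep
        have h1 : ∀ i k (_ : k < N i + 1) p, R (p * h i k) (vert i k) ↔
            R (p * h i (k + 1)) (vert i (k + 1)) :=
          fun i k hk p => hR ⟨i, k, hk⟩ R (fun p => hstep p _) p
        have h2 : ∀ i k (_ : k ≤ N i + 1) p, R p none ↔ R (p * h i k) (vert i k) := by
          intro i k hk p
          induction k with
          | zero => simp [h, vert]
          | succ k ih => rw [ih (by omega), h1 i k (by omega)]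
        have h3 : ∀ v p, R p v ↔ R p none := by
          rintro (_ | ⟨i, k, hk⟩) p
          · rfl
          · rw [h2 i (k + 1) (by omega)]
            simp [h, vert, hk]
        have h4 : ∀ w p, R p none ↔ R (p * w) none := by
          intro w
          induction w using FreeGroup.induction_on with
          | C1 => simp
          | of i =>
            intro p
            rw [h2 i (N i + 1) le_rfl]
            simp [h, vert]
          | inv_of i ih =>
            intro p
            rw [ih (p * _)]; simp
          | mul x y hx hy => intro p; rw [hx, hy, mul_assoc]
        intro p v p' v' hp
        rw [h3] at hp ⊢
        rw [h4 (p⁻¹ * p')] at hp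
        simpa using hp }
  refine ⟨S, ?_⟩
  have h1 : ∑ e, S.tr e ≤ ∑ e : S.E, 1 := Finset.sum_le_sum fun e _ => S.tr_le_one e
  have h2 : ∑ v, S.n v = 0 := Finset.sum_const_zero
  have h3 : Fintype.card S.E = Fintype.card E := rfl
  have h4 : Fintype.card S.V = Fintype.card V := rfl
  have h5 : Fintype.card E = ∑ i, N i + r := by simp [E, Finset.sum_add_distrib]
  have h6 : Fintype.card V = ∑ i, N i + 1 := by simp [V]
  unfold Bdd cost
  rw [h2]
  simp only [Finset.sum_const, Finset.card_univ, smul_eq_mul, mul_one] at h1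
  omega

end PreSys

namespace PreSys
variable {P G X : Type} [Group P] [Group G] [MulAction G X] {ψ : P →* G} {adj : X → X → Prop}
variable {S : PreSys ψ adj} (hT : IsTreeAction G X adj)

include hT in
theorem gen_smul_eq {e : S.E} {a : P} (ha : S.Q (S.src e) = Subgroup.zpowers a)
    (he : S.tr e = 0) :
    ψ a ≠ 1 ∧ ψ a • ψ (S.g e) • S.pos (S.tgt e) = ψ (S.g e) • S.pos (S.tgt e) := by
  obtain ⟨p, hp, hp1⟩ := S.tr_eq_zero.1 he
  have h1 := (S.mem_Est.1 (S.map_C_mem_Est hp)).2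
  have h2 := (S.mem_C.1 hp).1
  rw [ha] at h2
  obtain ⟨n, rfl⟩ := Subgroup.mem_zpowers_iff.1 h2
  rw [map_zpow] at h1 hp1
  exact ⟨fun h => hp1 (by rw [h, one_zpow]),
    hT.root (S.fix _ a (ha ▸ Subgroup.mem_zpowers a)) h1 hp1 (.inl (S.edge e))⟩

include hT in
theorem NoFold.conj_mem (h : S.NoFold) {e : S.E} {a : P}
    (ha : S.Q (S.src e) = Subgroup.zpowers a) (he : S.tr e = 0) :
    ∀ q ∈ S.Q (S.src e), (S.g e)⁻¹ * q * S.g e ∈ S.Q (S.tgt e) := by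
  have h1 := gen_smul_eq hT ha he
  have h2 := (h e e a ⟨rfl, ha ▸ Subgroup.mem_zpowers a, by
    rw [map_mul, mul_smul]; exact h1.2⟩).2
  intro q hq
  rw [ha] at hq
  obtain ⟨n, rfl⟩ := Subgroup.mem_zpowers_iff.1 hq
  have h3 : (S.g e)⁻¹ * a ^ n * S.g e = ((a * S.g e)⁻¹ * S.g e) ^ (-n) := by
    have : (a * S.g e)⁻¹ * S.g e = (S.g e)⁻¹ * a⁻¹ * (S.g e)⁻¹⁻¹ := by group
    rw [this, conj_zpow]
    simp
  rw [h3]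
  exact zpow_mem h2 _

include hT in
theorem NoFold.eq_of_src_eq (h : S.NoFold) {e e' : S.E} {a : P}
    (ha : S.Q (S.src e) = Subgroup.zpowers a) (hs : S.src e = S.src e')
    (he : S.tr e = 0) (he' : S.tr e' = 0) : e = e' := by
  have h1 := gen_smul_eq hT ha he
  have h2 := gen_smul_eq hT (hs ▸ ha) he'
  have := S.edge e'
  rw [← hs] at this
  have h3 := hT.unique h1.1 (S.fix _ a (ha ▸ Subgroup.mem_zpowers a)) h1.2 h2.2
    (.inl (S.edge e)) (.inl this)
  exact (h e e' 1 ⟨hs, one_mem _, by simpa using h3⟩).1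

include hT in
theorem src_ne_tgt_of_tr_eq_zero {e e' : S.E} {a : P}
    (ha : S.Q (S.src e) = Subgroup.zpowers a)
    (he : S.tr e = 0) (he' : S.tr e' = 0) : S.src e ≠ S.tgt e' := by
  intro hs
  have h1 := gen_smul_eq hT ha he
  have h2 := gen_smul_eq (S := S.dual hT.smul) hT.flip (e := e') (a := a)
    (show S.Q (S.tgt e') = _ from hs ▸ ha)
    (by rw [tr_dual]; exact he')
  have h4 := (S.dual hT.smul).edge e'
  change adj (ψ (S.g e')⁻¹ • S.pos (S.src e')) (S.pos (S.tgt e')) at h4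
  change _ ∧ ψ a • ψ (S.g e')⁻¹ • S.pos (S.src e') = ψ (S.g e')⁻¹ • S.pos (S.src e') at h2
  rw [← hs] at h4
  have h3 := hT.unique h1.1 (S.fix _ a (ha ▸ Subgroup.mem_zpowers a)) h1.2 h2.2
    (.inl (S.edge e)) (.inr h4)
  exact hT.asymm h4 (h3 ▸ S.edge e)

theorem n_pos_of_tr_eq_zero {e : S.E} (he : S.tr e = 0) :
    0 < S.n (S.src e) ∧ 0 < S.n (S.tgt e) := by
  obtain ⟨p, hp, hp1⟩ := S.tr_eq_zero.1 he
  have h1 := S.mem_C.1 hp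
  have h2 : p ≠ 1 := by rintro rfl; simp at hp1
  refine ⟨Nat.pos_of_ne_zero fun h => h2 ?_, Nat.pos_of_ne_zero fun h => h2 ?_⟩
  · have := S.gen (S.src e)
    rw [h] at this
    simpa [this.eq_bot] using h1.1
  · have := S.gen (S.tgt e)
    rw [h] at this
    have h3 := h1.2
    rw [this.eq_bot, Subgroup.mem_bot] at h3
    have : p = S.g e * ((S.g e)⁻¹ * p * S.g e) * (S.g e)⁻¹ := by group
    rw [this, h3]; simp

include hT in
/-- If all vertex groups are cyclic then the group needs few generators. -/
theorem genBy_top_of_cyclic {K : ℕ} (hK : S.Bdd K) (h2 : (S.dual hT.smul).NoFold)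
    (hc : ∀ v, ∃ a, S.Q v = Subgroup.zpowers a) : GenBy (⊤ : Subgroup P) K := by
  classical
  let D : S.V → Prop := fun v => ∃ e, S.tgt e = v ∧ S.tr e = 0
  let Q' : S.V → Subgroup P := fun v => if D v then ⊥ else S.Q v
  let n' : S.V → ℕ := fun v => if D v then 0 else S.n v
  have hsub : ∀ v, Q' v ≤ S.Q v := fun v => by
    by_cases h : D v <;> simp [Q', h]
  let S' : PreSys (1 : P →* Unit) (fun _ _ : Unit => True) :=
    { V := S.V, E := S.E, ne := S.ne, src := S.src, tgt := S.tgt, g := S.g, Q := Q'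
      pos := fun _ => (), n := n'
      fix := fun _ _ _ => rfl
      edge := fun _ => trivial
      gen := fun v => by
        by_cases h : D v
        · simpa [Q', n', h] using GenBy.bot
        · simpa [Q', n', h] using S.gen v
      conn := by
        intro R h1 h3
        refine S.conn R ?_ h3
        intro p v q hq hR
        by_cases h : D v
        · obtain ⟨e, rfl, he⟩ := h
          obtain ⟨a, ha⟩ := hc (S.tgt e)
          have h4 := h2.conj_mem hT.flip (e := e) (a := a) ha (by rw [tr_dual]; exact he) q hq
          change (S.g e)⁻¹⁻¹ * q * (S.g e)⁻¹ ∈ S.Q (S.src e) at h4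
          have hD : ¬ D (S.src e) := by
            rintro ⟨e', h5, h6⟩
            obtain ⟨b, hb⟩ := hc (S.src e)
            exact src_ne_tgt_of_tr_eq_zero hT hb he h6 h5.symm
          have h7 : R (p * (S.g e)⁻¹) (S.src e) := by rw [h3]; simpa using hR
          have h8 := h1 _ _ _ (show _ ∈ Q' (S.src e) by simpa [Q', hD] using h4) h7
          rw [h3] at h8
          simpa [mul_assoc] using h8
        · exact h1 _ _ _ (by simpa [Q', h] using hq) hR }
  refine S'.genBy_top K ?_
  have key : ∑ v, n' v + Fintype.card S.E ≤ ∑ v, S.n v + ∑ e, S.tr e := by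
    have h1 : ∀ v, n' v + ∑ e with S.tgt e = v, (1 - S.tr e) ≤ S.n v := by
      intro v
      by_cases h : D v
      · have hn : n' v = 0 := by simp [n', h]
        rw [hn, zero_add]
        obtain ⟨e, rfl, he⟩ := h
        rw [Finset.sum_eq_single e]
        · have := (n_pos_of_tr_eq_zero he).2
          omega
        · intro e' he' hne
          have h3 := S.tr_le_one e'
          by_contra h4
          have h5 : S.tr e' = 0 := by omega
          obtain ⟨a, ha⟩ := hc (S.tgt e)
          simp only [Finset.mem_filter, Finset.mem_univ, true_and] at he'
          exact hne (h2.eq_of_src_eq hT.flip (e := e) (e' := e') (a := a) ha he'.symm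
            (by rw [tr_dual]; exact he) (by rw [tr_dual]; exact h5)).symm
        · simp
      · have hn : n' v = S.n v := by simp [n', h]
        rw [hn, Finset.sum_eq_zero]
        · simp
        · intro e' he'
          simp only [Finset.mem_filter, Finset.mem_univ, true_and] at he'
          have : S.tr e' ≠ 0 := fun h0 => h ⟨e', he', h0⟩
          omega
    have h3 := Finset.sum_le_sum fun v (_ : v ∈ Finset.univ) => h1 v
    rw [Finset.sum_add_distrib, Finset.sum_fiberwise] at h3
    have h4 : ∑ e, (1 - S.tr e) + ∑ e, S.tr e = Fintype.card S.E := by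
      rw [← Finset.sum_add_distrib, Finset.sum_congr rfl (g := fun _ => 1)]
      · simp
      · intro e _
        have := S.tr_le_one e
        omega
    omega
  unfold Bdd cost at hK
  have h5 : ∑ v, S'.n v = ∑ v, n' v := rfl
  have h6 : Fintype.card S'.E = Fintype.card S.E := rfl
  have h7 : Fintype.card S'.V = Fintype.card S.V := rfl
  omega

end PreSys

namespace PreSys
variable {P G X : Type} [Group P] [Group G] [MulAction G X] {ψ : P →* G} {adj : X → X → Prop}
variable {S : PreSys ψ adj}

theorem exists_nonloop {v p : S.V} (h : v ≠ p) :
    ∃ e, S.src e = v ∧ S.tgt e ≠ v ∨ S.tgt e = v ∧ S.src e ≠ v := by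
  by_contra hc
  push Not at hc
  refine h (S.conn (fun _ w => w = v) (fun _ _ _ _ h => h) (fun _ e => ⟨(hc e).1, (hc e).2⟩)
    1 v 1 p rfl).symm

/-- The weighted number of endpoints of edges with trivial edge group at a vertex. -/
noncomputable def deg (S : PreSys ψ adj) (v : S.V) : ℕ :=
  ∑ e with S.src e = v, S.tr e + ∑ e with S.tgt e = v, S.tr e

theorem sum_n_deg : ∑ v, (2 * S.n v + S.deg v) = 2 * S.cost := by
  unfold deg cost
  rw [Finset.sum_add_distrib, Finset.sum_add_distrib, Finset.sum_fiberwise, Finset.sum_fiberwise,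
    ← Finset.mul_sum]
  ring

theorem tr_le_deg_src (e : S.E) : S.tr e ≤ S.deg (S.src e) :=
  (Finset.single_le_sum (f := S.tr) (fun _ _ => Nat.zero_le _)
    (show e ∈ Finset.univ.filter (fun e' => S.src e' = S.src e) by simp)).trans
    (Nat.le_add_right _ _)

theorem tr_le_deg_tgt (e : S.E) : S.tr e ≤ S.deg (S.tgt e) :=
  (Finset.single_le_sum (f := S.tr) (fun _ _ => Nat.zero_le _)
    (show e ∈ Finset.univ.filter (fun e' => S.tgt e' = S.tgt e) by simp)).trans
    (Nat.le_add_left _ _)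

theorem tr_add_tr_le_deg {e e' : S.E} {v : S.V} (he : S.src e = v ∨ S.tgt e = v)
    (he' : S.src e' = v ∨ S.tgt e' = v) (hne : e' ≠ e) : S.tr e + S.tr e' ≤ S.deg v := by
  have hs : ∀ f : S.E → S.V, (f e = v → f e' = v → S.tr e + S.tr e' ≤ ∑ e with f e = v, S.tr e) ∧
      (f e = v → S.tr e ≤ ∑ e with f e = v, S.tr e) ∧
      (f e' = v → S.tr e' ≤ ∑ e with f e = v, S.tr e) := fun f =>
    ⟨fun h1 h2 => by
      rw [← Finset.sum_pair hne.symm]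
      refine Finset.sum_le_sum_of_subset ?_
      intro x
      simp only [Finset.mem_insert, Finset.mem_singleton, Finset.mem_filter, Finset.mem_univ,
        true_and]
      rintro (rfl | rfl) <;> assumption,
    fun h1 => Finset.single_le_sum (f := S.tr) (fun _ _ => Nat.zero_le _) (by simpa using h1),
    fun h1 => Finset.single_le_sum (f := S.tr) (fun _ _ => Nat.zero_le _) (by simpa using h1)⟩
  have h1 := hs S.src
  have h2 := hs S.tgt
  unfold deg
  rcases he with he | he <;> rcases he' with he' | he'
  · exact (h1.1 he he').trans (Nat.le_add_right _ _)
  · exact add_le_add (h1.2.1 he) (h2.2.2 he')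
  · rw [add_comm]; exact add_le_add (h1.2.2 he') (h2.2.1 he)
  · exact (h2.1 he he').trans (Nat.le_add_left _ _)

theorem Minimal.leaf {K : ℕ} (h : S.Minimal K) (hT : IsTreeAction G X adj) {v : S.V} (e : S.E)
    (hleaf : ∀ e', S.src e' = v ∨ S.tgt e' = v → e' = e)
    (hv : S.src e = v ∧ S.tgt e ≠ v ∧ (∀ q ∈ S.Q v, (S.g e)⁻¹ * q * S.g e ∈ S.Q (S.tgt e)) ∨
      S.tgt e = v ∧ S.src e ≠ v ∧ (∀ q ∈ S.Q v, S.g e * q * (S.g e)⁻¹ ∈ S.Q (S.src e))) :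
    False := by
  rcases hv with ⟨rfl, hne, hq⟩ | ⟨rfl, hne, hq⟩
  · obtain ⟨S', h1, h2⟩ := exists_simpler_of_leaf' hT.smul h.1 e hne.symm hleaf hq
    exact h.2 S' h1 h2
  · obtain ⟨S', h1, h2⟩ := exists_simpler_of_leaf h.1 e hne hleaf hq
    exact h.2 S' h1 h2

theorem Minimal.two_le {K : ℕ} (h : S.Minimal K) (hT : IsTreeAction G X adj) {v p : S.V}
    (hvp : v ≠ p) : 2 ≤ 2 * S.n v + S.deg v := by
  by_contra hlt
  have hn : S.n v = 0 := by omega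
  have hQ : S.Q v = ⊥ := GenBy.eq_bot (hn ▸ S.gen v)
  have htr : ∀ e, (S.src e = v ∨ S.tgt e = v) → S.tr e = 1 := by
    intro e he
    have h1 := S.tr_le_one e
    by_contra h2
    have h3 := n_pos_of_tr_eq_zero (e := e) (by omega)
    rcases he with rfl | rfl <;> omega
  obtain ⟨e, he⟩ := exists_nonloop hvp
  have hev : S.src e = v ∨ S.tgt e = v := he.imp And.left And.left
  refine h.leaf hT (v := v) e ?_ ?_
  · intro e' he'
    by_contra hne
    have h1 := tr_add_tr_le_deg hev he' hne
    rw [htr e hev, htr e' he'] at h1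
    omega
  · refine he.imp (fun h => ⟨h.1, h.2, ?_⟩) (fun h => ⟨h.1, h.2, ?_⟩) <;>
    · intro q hq
      rw [hQ, Subgroup.mem_bot] at hq
      simp [hq]

/-- A minimal system of small complexity with a noncyclic vertex group has a single vertex. -/
theorem Minimal.eq_of_not_cyclic {K : ℕ} (h : S.Minimal K) (hT : IsTreeAction G X adj)
    (hK : K ≤ 2) (h1 : S.NoFold) (h2 : (S.dual hT.smul).NoFold) {p : S.V}
    (hp : ∀ a, S.Q p ≠ Subgroup.zpowers a) :
    K = 2 ∧ S.n p = 2 ∧ (∀ v, v = p) ∧ ∀ e, S.tr e = 0 := by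
  have hnp : 2 ≤ S.n p := by
    by_contra hlt
    obtain ⟨a, ha⟩ := ((S.gen p).mono (show S.n p ≤ 1 by omega)).eq_zpowers
    exact hp a ha
  let w : S.V → ℕ := fun v => if v = p then 4 else 2
  have hw : ∀ v ∈ Finset.univ, w v ≤ 2 * S.n v + S.deg v := by
    intro v _
    by_cases hv : v = p
    · subst hv; simp only [w, if_true]; omega
    · simp only [w, hv, if_false]; exact h.two_le hT hv
  have hws : ∑ v, w v = 2 * Fintype.card S.V + 2 := by
    have : ∀ v, w v = 2 + if v = p then 2 else 0 := fun v => by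
      by_cases hv : v = p <;> simp [w, hv]
    rw [Finset.sum_congr rfl fun v _ => this v, Finset.sum_add_distrib]
    simp [mul_comm]
  have hb := h.1
  unfold Bdd at hb
  have hle := Finset.sum_le_sum hw
  have hsum := S.sum_n_deg
  have hK2 : K = 2 := by omega
  have heq := (Finset.sum_eq_sum_iff_of_le hw).1 (by omega)
  have hpd : S.n p = 2 ∧ S.deg p = 0 := by
    have := heq p (Finset.mem_univ _)
    simp only [w, if_true] at this
    omega
  have hv2 : ∀ v, v ≠ p → 2 * S.n v + S.deg v = 2 := fun v hv => by
    have := heq v (Finset.mem_univ _)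
    simp only [w, hv, if_false] at this
    exact this.symm
  have hR : ∀ v, v = p ∨ S.n v = 1 := by
    have hd : ∀ v, (v = p ∨ S.n v = 1) → S.deg v = 0 := by
      rintro v (rfl | hv)
      · exact hpd.2
      · by_cases hvp : v = p
        · rw [hvp]; exact hpd.2
        · have := hv2 v hvp; omega
    have hn : ∀ v, 0 < S.n v → (v = p ∨ S.n v = 1) := fun v hv => by
      by_cases hvp : v = p
      · exact .inl hvp
      · have := hv2 v hvp; omega
    intro v
    refine S.conn (fun _ v => v = p ∨ S.n v = 1) (fun _ _ _ _ h => h) (fun _ e => ⟨?_, ?_⟩)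
      1 p 1 v (.inl rfl)
    · intro he
      have h3 := S.tr_le_deg_src e
      rw [hd _ he] at h3
      exact hn _ (n_pos_of_tr_eq_zero (Nat.le_zero.1 h3)).2
    · intro he
      have h3 := S.tr_le_deg_tgt e
      rw [hd _ he] at h3
      exact hn _ (n_pos_of_tr_eq_zero (Nat.le_zero.1 h3)).1
  have hd : ∀ v, S.deg v = 0 := by
    intro v
    by_cases hvp : v = p
    · rw [hvp]; exact hpd.2
    · have := hv2 v hvp
      have := (hR v).resolve_left hvp
      omega
  have htr : ∀ e, S.tr e = 0 := fun e => by
    have h3 := S.tr_le_deg_src e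
    rw [hd] at h3
    exact Nat.le_zero.1 h3
  refine ⟨hK2, hpd.1, fun v => ?_, htr⟩
  by_contra hvp
  have hnv : S.n v = 1 := (hR v).resolve_left hvp
  obtain ⟨a, ha⟩ := GenBy.eq_zpowers (hnv ▸ S.gen v)
  obtain ⟨e, he⟩ := exists_nonloop hvp
  refine h.leaf hT (v := v) e ?_ ?_
  · intro e' he'
    have hsrc : ∀ {e e'}, S.src e = v → S.src e' = v → e' = e := fun {e e'} h3 h4 =>
      h1.eq_of_src_eq hT (a := a) (h4.symm ▸ ha) (h4.trans h3.symm) (htr _) (htr _)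
    have htgt : ∀ {e e'}, S.tgt e = v → S.tgt e' = v → e' = e := fun {e e'} h3 h4 =>
      h2.eq_of_src_eq hT.flip (e := e') (e' := e) (a := a)
        (show S.Q (S.tgt e') = _ from h4.symm ▸ ha) (h4.trans h3.symm)
        (by rw [tr_dual]; exact htr _) (by rw [tr_dual]; exact htr _)
    have hst : ∀ {e e'}, S.src e = v → S.tgt e' = v → False := fun {e e'} h3 h4 =>
      src_ne_tgt_of_tr_eq_zero hT (a := a) (h3.symm ▸ ha) (htr e) (htr e') (h3.trans h4.symm)
    rcases he with ⟨h3, _⟩ | ⟨h3, _⟩ <;> rcases he' with h4 | h4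
    · exact hsrc h3 h4
    · exact (hst h3 h4).elim
    · exact (hst h4 h3).elim
    · exact htgt h3 h4
  · refine he.imp (fun h => ⟨h.1, h.2, ?_⟩) (fun h => ⟨h.1, h.2, ?_⟩)
    · rw [← h.1]
      exact h1.conj_mem hT (a := a) (h.1.symm ▸ ha) (htr e)
    · rw [← h.1]
      have := h2.conj_mem hT.flip (e := e) (a := a) (show S.Q (S.tgt e) = _ from h.1.symm ▸ ha)
        (by rw [tr_dual]; exact htr e)
      simpa using this

end PreSys

/-- A group `F ≅ FreeGroup (Fin m)` with `m ≤ 1` generators is cyclic; otherwise `m` is two. -/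
theorem exists_basis_two {P : Type} [Group P] {Q : Subgroup P} [IsFreeGroup Q] (hQ : GenBy Q 2)
    (hc : ∀ a, Q ≠ Subgroup.zpowers a) :
    ∃ b : FreeGroup (Fin 2) →* P, Function.Injective b ∧ b.range = Q := by
  obtain ⟨f, hf⟩ := hQ
  have hmem : ∀ i, f i ∈ Q := fun i => hf ▸ Subgroup.subset_closure ⟨i, rfl⟩
  let π : FreeGroup (Fin 2) →* Q := FreeGroup.lift fun i => ⟨f i, hmem i⟩
  have hπ : Function.Surjective π := by
    rintro ⟨q, hq⟩
    obtain ⟨w, hw⟩ := exists_lift_eq (hf.symm ▸ hq : q ∈ Subgroup.closure (Set.range f))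
    refine ⟨w, Subtype.ext ?_⟩
    refine Eq.trans ?_ hw
    have : FreeGroup.lift f = Q.subtype.comp π := by ext i; simp [π]
    rw [this]; rfl
  obtain ⟨m, hm, ⟨e⟩⟩ := exists_basis_le π hπ
  rw [Nat.card_fin] at hm
  have hb : ∀ b : FreeGroup (Fin m) →* P, b = Q.subtype.comp e.symm.toMonoidHom →
      Function.Injective b ∧ b.range = Q := by
    rintro _ rfl
    refine ⟨Subtype.val_injective.comp e.symm.injective, ?_⟩
    rw [MonoidHom.range_comp, MonoidHom.range_eq_top.2 e.symm.surjective,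
      ← MonoidHom.range_eq_map, Subgroup.range_subtype]
  obtain ⟨h1, h2⟩ := hb _ rfl
  have hgen : GenBy Q m := by
    refine ⟨fun i => Q.subtype.comp e.symm.toMonoidHom (.of i), ?_⟩
    refine Eq.trans ?_ h2
    rw [← range_lift_eq_closure]
    congr 1
    ext i; simp
  have hm2 : m = 2 := by
    by_contra hne
    obtain ⟨a, ha⟩ := (hgen.mono (show m ≤ 1 by omega)).eq_zpowers
    exact hc a ha
  subst hm2
  exact ⟨_, h1, h2⟩

namespace PreSys
variable {P G X : Type} [Group P] [Group G] [MulAction G X] {ψ : P →* G} {adj : X → X → Prop}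
variable {S : PreSys ψ adj}

/-- Edge groups are cyclic. -/
theorem C_eq_zpowers (hT : IsTreeAction G X adj) (hψ : Function.Injective ψ) (e : S.E) :
    ∃ c, S.C e = Subgroup.zpowers c := by
  have h0 := S.edge e
  obtain ⟨d, hd⟩ := hT.cyclic h0
  have h1 : (S.C e).map ψ ≤ Subgroup.zpowers d := by
    rw [← hd]
    rintro _ ⟨p, hp, rfl⟩
    exact S.map_C_mem_Est hp
  have h2 : IsCyclic ((S.C e).map ψ) := by
    have : IsCyclic (Subgroup.zpowers d) := inferInstance
    exact isCyclic_of_injective (Subgroup.inclusion h1) (Subgroup.inclusion_injective h1)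
  have h3 : IsCyclic (S.C e) :=
    isCyclic_of_injective ((S.C e).equivMapOfInjective ψ hψ).toMonoidHom
      (MulEquiv.injective _)
  exact (Subgroup.isCyclic_iff_exists_zpowers_eq_top _).1 h3 |>.imp fun _ h => h.symm

/-- An HNN extension of a free group of rank two along cyclic subgroups is a one-relator group. -/
theorem exists_presentation (hT : IsTreeAction G X adj) (hψ : Function.Injective ψ)
    (h1 : S.NoFold) (h2 : (S.dual hT.smul).NoFold) {p : S.V} (hV : ∀ v, v = p)
    {b : FreeGroup (Fin 2) →* P} (hb : Function.Injective b) (hbr : b.range = S.Q p)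
    (e : S.E) (hE : ∀ e', e' = e) :
    ∃ r : FreeGroup (Fin 3), Nonempty (P ≃* PresentedGroup {r}) := by
  have hQs : S.Q (S.src e) = b.range := by rw [hV (S.src e), hbr]
  have hQt : S.Q (S.tgt e) = b.range := by rw [hV (S.tgt e), hbr]
  have hps : S.pos (S.src e) = S.pos p := by rw [hV (S.src e)]
  have hpt : S.pos (S.tgt e) = S.pos p := by rw [hV (S.tgt e)]
  have hfix : ∀ w, ψ (b w) • S.pos p = S.pos p := fun w =>
    S.fix p _ (hbr ▸ ⟨w, rfl⟩)
  obtain ⟨c, hc⟩ := C_eq_zpowers hT hψ e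
  have hcC := S.mem_C.1 (hc ▸ Subgroup.mem_zpowers c : c ∈ S.C e)
  rw [hQs, hQt] at hcC
  obtain ⟨⟨x, rfl⟩, ⟨y, hy⟩⟩ := hcC
  let ι : FreeGroup (Fin 2) →* FreeGroup (Fin 3) := FreeGroup.map Fin.castSucc
  let s : FreeGroup (Fin 3) := .of (Fin.last 2)
  let r : FreeGroup (Fin 3) := s⁻¹ * ι x * s * (ι y)⁻¹
  let f : Fin 3 → P := Fin.snoc (α := fun _ => P) (fun i : Fin 2 => b (.of i)) (S.g e)
  have hfι : ∀ w, FreeGroup.lift f (ι w) = b w := fun w => by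
    have : (FreeGroup.lift f).comp ι = b := by
      ext i
      simp [ι, f]
    rw [← this]; rfl
  have hfs : FreeGroup.lift f s = S.g e := by
    rw [FreeGroup.lift_apply_of]; exact Fin.snoc_last (α := fun _ => P) _ _
  have hr : ∀ r' ∈ ({r} : Set (FreeGroup (Fin 3))), FreeGroup.lift f r' = 1 := by
    rintro _ rfl
    rw [map_mul, map_mul, map_mul, map_inv, map_inv, hfι, hfι, hfs, hy, mul_inv_cancel]
  let π : PresentedGroup {r} →* P := PresentedGroup.toGroup hr
  let j : FreeGroup (Fin 2) →* PresentedGroup {r} := (PresentedGroup.mk {r}).comp ι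
  let σ : PresentedGroup {r} := PresentedGroup.mk {r} s
  have hπj : ∀ w, π (j w) = b w := fun w => hfι w
  have hπσ : π σ = S.g e := hfs
  have hrel : σ⁻¹ * j x * σ = j y := by
    have : PresentedGroup.mk {r} r = 1 := PresentedGroup.one_of_mem rfl
    simp only [r, map_mul, map_inv] at this
    exact mul_inv_eq_one.1 this
  have hreln : ∀ n : ℤ, σ⁻¹ * j x ^ n * σ = j y ^ n := fun n => by
    rw [← hrel]
    have := conj_zpow (a := σ⁻¹) (b := j x) (i := n)
    simpa using this.symm
  refine ⟨r, ⟨(MulEquiv.ofBijective π ⟨?_, ?_⟩).symm⟩⟩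
  · let S' : PreSys (ψ.comp π) adj :=
      { V := Unit, E := Unit, ne := ⟨()⟩, src := fun _ => (), tgt := fun _ => ()
        g := fun _ => σ, Q := fun _ => j.range, pos := fun _ => S.pos p, n := fun _ => 2
        fix := by
          rintro _ _ ⟨w, rfl⟩
          rw [MonoidHom.comp_apply, hπj, hfix]
        edge := fun _ => by
          have := S.edge e
          rw [hps, hpt] at this
          rwa [MonoidHom.comp_apply, hπσ]
        gen := fun _ => ⟨fun i => j (.of i), by
          rw [← range_lift_eq_closure]
          congr 1
          ext i; simp⟩
        conn := by
          intro R hR1 hR2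
          have key : ∀ w q, R q () ↔ R (q * PresentedGroup.mk {r} w) () := by
            intro w
            induction w using FreeGroup.induction_on with
            | C1 => simp
            | of i =>
              intro q
              induction i using Fin.lastCases with
              | last => exact hR2 q ()
              | cast i =>
                have : PresentedGroup.mk {r} (.of (Fin.castSucc i)) = j (.of i) := by
                  simp [j, ι]
                rw [this]
                refine ⟨hR1 q () _ ⟨_, rfl⟩, fun h => ?_⟩
                simpa using hR1 _ () (j (.of i))⁻¹ (inv_mem ⟨_, rfl⟩) h
            | inv_of i ih =>
              intro q
              rw [map_inv, ih (q * _)]; simp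
            | mul x y hx hy => intro q; rw [hx, hy, map_mul, mul_assoc]
          intro q _ q' _ h
          obtain ⟨w, hw⟩ := PresentedGroup.mk_surjective _ (q⁻¹ * q')
          have := (key w q).1 h
          rw [hw] at this
          simpa using this }
    have hinj : Function.Injective (ψ.comp π) := by
      refine S'.injective_of_noFold hT ?_ ?_ ?_
      · rintro _ _ ⟨w, rfl⟩ hw
        rw [MonoidHom.comp_apply, hπj] at hw
        rw [hb (hψ (hw.trans (by simp)) : b w = b 1), map_one]
      · rintro _ _ _ ⟨_, ⟨w, rfl⟩, hpos⟩
        change ψ (π (j w * σ)) • S.pos p = ψ (π σ) • S.pos p at hpos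
        rw [map_mul, hπj, hπσ] at hpos
        refine ⟨rfl, ?_⟩
        change (j w * σ)⁻¹ * σ ∈ j.range
        have h3 := (h1 e e (b w) ⟨rfl, by rw [hQs]; exact ⟨w, rfl⟩, by rw [hpt]; exact hpos⟩).2
        have h4 : b w ∈ S.C e := by
          rw [mem_C, hQs]
          refine ⟨⟨w, rfl⟩, ?_⟩
          have := inv_mem h3
          simpa [mul_assoc] using this
        rw [hc] at h4
        obtain ⟨n, hn⟩ := Subgroup.mem_zpowers_iff.1 h4
        rw [← map_zpow] at hn
        rw [← hb hn, map_zpow]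
        have h5 : (j x ^ n * σ)⁻¹ * σ = (σ⁻¹ * j x ^ n * σ)⁻¹ := by group
        rw [h5, hreln]
        exact inv_mem (zpow_mem (show j y ∈ j.range from ⟨y, rfl⟩) n)
      · rintro _ _ _ ⟨_, ⟨w, rfl⟩, hpos⟩
        change ψ (π (j w * σ⁻¹)) • S.pos p = ψ (π σ⁻¹) • S.pos p at hpos
        rw [map_mul, map_inv, hπj, hπσ] at hpos
        refine ⟨rfl, ?_⟩
        change (j w * σ⁻¹)⁻¹ * σ⁻¹ ∈ j.range
        have h3 := (h2 e e (b w) ⟨rfl, by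
          change b w ∈ S.Q (S.tgt e); rw [hQt]; exact ⟨w, rfl⟩, by
          change ψ (b w * (S.g e)⁻¹) • S.pos (S.src e) = ψ (S.g e)⁻¹ • S.pos (S.src e)
          rw [hps]; exact hpos⟩).2
        change (b w * (S.g e)⁻¹)⁻¹ * (S.g e)⁻¹ ∈ S.Q (S.src e) at h3
        have h4 : S.g e * b w * (S.g e)⁻¹ ∈ S.C e := by
          rw [mem_C]
          refine ⟨?_, ?_⟩
          · have := inv_mem h3
            simpa [mul_assoc] using this
          · rw [hQt]
            exact ⟨w, by simp [mul_assoc]⟩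
        rw [hc] at h4
        obtain ⟨n, hn⟩ := Subgroup.mem_zpowers_iff.1 h4
        have h6 : b (y ^ n) = b w := by
          rw [map_zpow, hy]
          have := conj_zpow (a := (S.g e)⁻¹) (b := b x) (i := n)
          rw [inv_inv] at this
          rw [this, hn]; group
        rw [← hb h6, map_zpow, ← hreln]
        exact ⟨(x ^ n)⁻¹, by rw [map_inv, map_zpow]; group⟩
    exact fun a a' h => hinj (congrArg ψ h)
  · intro q
    refine S.conn (fun q _ => q ∈ π.range) ?_ ?_ 1 p q p (one_mem _)
    · intro q v q' hq' hq
      rw [hV v, ← hbr] at hq'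
      obtain ⟨w, rfl⟩ := hq'
      exact mul_mem hq ⟨j w, hπj w⟩
    · intro q e'
      rw [hE e']
      have hσ : S.g e ∈ π.range := ⟨σ, hπσ⟩
      exact (Subgroup.mul_mem_cancel_right _ hσ).symm

end PreSys

section Classification

variable {G X : Type} [Group G] [MulAction G X] {adj : X → X → Prop}

/-- There are two `M`-inequivalent out-neighbours of `x`, each fixed by a nontrivial element of
`M`. -/
def HasTwo (adj : X → X → Prop) (M : Subgroup G) (x : X) : Prop :=
  ∃ y₁ y₂, adj x y₁ ∧ adj x y₂ ∧ (∃ m ∈ M, m ≠ 1 ∧ m • y₁ = y₁) ∧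
    (∃ m ∈ M, m ≠ 1 ∧ m • y₂ = y₂) ∧ ∀ m ∈ M, m • y₁ ≠ y₂

theorem IsTreeAction.isFreeGroup_of_fixed (hT : IsTreeAction G X adj) {L : Subgroup G}
    (Q : Subgroup L) (h : ∃ x : X, ∀ q ∈ Q, (q : G) • x = x) : IsFreeGroup Q := by
  obtain ⟨x, hx⟩ := h
  have := hT.free x
  let f : Q →* MulAction.stabilizer G x :=
    { toFun := fun q => ⟨q.1.1, hx _ q.2⟩
      map_one' := rfl
      map_mul' := fun _ _ => rfl }
  have hf : Function.Injective f := fun a b h => Subtype.ext (Subtype.ext (congrArg (·.1) h))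
  exact IsFreeGroup.ofMulEquiv (MonoidHom.ofInjective hf).symm

theorem PreSys.hasTwo {P : Type} [Group P] {ψ : P →* G} {S : PreSys ψ adj} (h1 : S.NoFold) {p : S.V}
    (hV : ∀ v, v = p) (htr : ∀ e, S.tr e = 0) {e e' : S.E} (he : e ≠ e') :
    HasTwo adj ((S.Q p).map ψ) (S.pos p) := by
  have hm : ∀ e, ∃ m ∈ (S.Q p).map ψ, m ≠ 1 ∧
      m • ψ (S.g e) • S.pos (S.tgt e) = ψ (S.g e) • S.pos (S.tgt e) := fun e => by
    obtain ⟨q, hq, hq1⟩ := S.tr_eq_zero.1 (htr e)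
    exact ⟨ψ q, ⟨q, hV (S.src e) ▸ (S.mem_C.1 hq).1, rfl⟩, hq1, (S.map_C_mem_Est hq).2⟩
  refine ⟨_, _, ?_, ?_, hm e, hm e', ?_⟩
  · have := S.edge e
    rwa [hV (S.src e)] at this
  · have := S.edge e'
    rwa [hV (S.src e')] at this
  · rintro _ ⟨q, hq, rfl⟩ h
    refine he (h1 e e' q ⟨?_, ?_, ?_⟩).1
    · rw [hV (S.src e), hV (S.src e')]
    · rw [hV (S.src e)]; exact hq
    · rw [map_mul, mul_smul, h]

theorem classify (hT : IsTreeAction G X adj) {x₀ y₀ : X} (hxy : adj x₀ y₀)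
    (hcc : ∀ x (M : Subgroup G), M ≤ MulAction.stabilizer G x → GenBy M 2 →
      ¬ (HasTwo adj M x ∧ HasTwo (fun x y => adj y x) M x)) (r : ℕ) (hr : r ≤ 3)
    (L : Subgroup G) (hL : GenBy L r) :
    (∃ k : ℕ, k ≤ r ∧ Nonempty (L ≃* FreeGroup (Fin k))) ∨
      ∃ r : FreeGroup (Fin 3), Nonempty (L ≃* PresentedGroup {r}) := by
  induction r generalizing L with
  | zero =>
    have := hL.eq_bot
    subst this
    have : Unique (FreeGroup (Fin 0)) := inferInstance
    exact .inl ⟨0, le_rfl, ⟨MulEquiv.ofUnique⟩⟩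
  | succ K ih =>
  have ih' : GenBy L K → (∃ k : ℕ, k ≤ K + 1 ∧ Nonempty (L ≃* FreeGroup (Fin k))) ∨
      ∃ r : FreeGroup (Fin 3), Nonempty (L ≃* PresentedGroup {r}) := fun h =>
    (ih (by omega) L h).imp_left fun ⟨k, hk, h⟩ => ⟨k, by omega, h⟩
  obtain ⟨f, rfl⟩ := hL
  rw [← range_lift_eq_closure] at *
  set ψ := FreeGroup.lift f
  by_cases hall : ∀ S : PreSys ψ adj, S.Bdd (K + 1) → S.Inj
  · obtain ⟨S₀, hS₀⟩ := PreSys.exists_initial hT hxy ψ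
    obtain ⟨S, hS⟩ := S₀.exists_minimal hS₀
    have hinj := hall S hS.1
    have hfree : ∀ Q : Subgroup (FreeGroup (Fin (K + 1))),
        (∃ x : X, ∀ q ∈ Q, ψ q • x = x) → IsFreeGroup Q := fun Q _ => inferInstance
    have := S.injective_of_noFold hT hinj (hS.noFold hT hfree hinj) (hS.noFold_dual hT hfree hinj)
    exact .inl ⟨K + 1, le_rfl, ⟨(MonoidHom.ofInjective this).symm⟩⟩
  · push Not at hall
    obtain ⟨S₀, hS₀, hni⟩ := hall
    have hfree : ∀ Q : Subgroup ψ.range, (∃ x : X, ∀ q ∈ Q, (q : G) • x = x) → IsFreeGroup Q :=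
      fun Q h => hT.isFreeGroup_of_fixed Q h
    obtain ⟨S₁, hS₁⟩ := PreSys.exists_push hS₀ hni hfree
    obtain ⟨S, hS⟩ := S₁.exists_minimal hS₁
    have hψ : Function.Injective ψ.range.subtype := Subtype.val_injective
    have hinj : S.Inj := fun v q _ hq => hψ (hq.trans (map_one _).symm)
    have h1 := hS.noFold hT hfree hinj
    have h2 := hS.noFold_dual hT hfree hinj
    have htop : GenBy (⊤ : Subgroup ψ.range) K → GenBy ψ.range K := fun h => by
      have := h.map ψ.range.subtype
      rwa [← MonoidHom.range_eq_map, Subgroup.range_subtype] at this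
    by_cases hc : ∀ v, ∃ a, S.Q v = Subgroup.zpowers a
    · exact ih' (htop (PreSys.genBy_top_of_cyclic hT hS.1 h2 hc))
    push Not at hc
    obtain ⟨p, hp⟩ := hc
    obtain ⟨rfl, hnp, hV, htr⟩ := hS.eq_of_not_cyclic hT (by omega) h1 h2 hp
    have hQ2 : GenBy (S.Q p) 2 := by
      have := S.gen p
      rwa [hnp] at this
    by_cases hE : ∀ e e' : S.E, e = e'
    · by_cases hne : Nonempty S.E
      · obtain ⟨e⟩ := hne
        have := hfree (S.Q p) ⟨S.pos p, S.fix p⟩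
        obtain ⟨b, hb, hbr⟩ := exists_basis_two hQ2 hp
        exact .inr (PreSys.exists_presentation hT hψ h1 h2 hV hb hbr e (fun e' => hE e' e))
      · refine ih' (htop ?_)
        have : S.Q p = ⊤ := by
          rw [eq_top_iff]
          intro q _
          refine S.conn (fun q _ => q ∈ S.Q p) ?_ ?_ 1 p q p (one_mem _)
          · intro q v q' hq' hq
            rw [hV v] at hq'
            exact mul_mem hq hq'
          · exact fun _ e => (hne ⟨e⟩).elim
        rwa [this] at hQ2
    · exfalso
      push Not at hE
      obtain ⟨e, e', he⟩ := hE
      refine hcc (S.pos p) ((S.Q p).map ψ.range.subtype) ?_ (hQ2.map _)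
        ⟨PreSys.hasTwo h1 hV htr he, PreSys.hasTwo (S := S.dual hT.smul) h2 hV
          (fun e => by rw [PreSys.tr_dual]; exact htr e) he⟩
      rintro _ ⟨q, hq, rfl⟩
      exact S.fix p q hq

end Classification

namespace FreeGroup

section Magnus

open PowerSeries

variable {X : Type}

/-- The ring of noncommutative power series, graded by an auxiliary central variable. -/
abbrev MagnusRing (X : Type) : Type := PowerSeries (MonoidAlgebra ℤ (FreeMonoid X))

/-- The noncommutative monomial `x`, placed in degree one. -/
noncomputable def magnusVar (x : X) : MagnusRing X :=
  C (MonoidAlgebra.single (FreeMonoid.of x) (1 : ℤ)) * PowerSeries.X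

/-- The unit `1 + x` of the Magnus ring. -/
noncomputable def magnusUnit (x : X) : (MagnusRing X)ˣ where
  val := 1 + magnusVar x
  inv := invOfUnit (1 + magnusVar x) 1
  val_inv := mul_invOfUnit _ _ (by simp [magnusVar])
  inv_val := invOfUnit_mul _ _ (by simp [magnusVar])

/-- The Magnus expansion. -/
noncomputable def magnus (X : Type) : FreeGroup X →* (MagnusRing X)ˣ := FreeGroup.lift magnusUnit

/-- The coefficient of a noncommutative monomial in the Magnus expansion. -/
noncomputable def magnusCoeff (w : FreeGroup X) (l : List X) : ℤ :=
  (coeff l.length (magnus X w : MagnusRing X)).coeff (FreeMonoid.ofList l)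

theorem coeff_magnusVar_mul_nil (p : MagnusRing X) (x : X) :
    coeff 0 (magnusVar x * p) = 0 := by
  simp [magnusVar, mul_assoc, coeff_C_mul]

open Classical in
theorem coeff_magnusVar_mul (p : MagnusRing X) (x y : X) (l : List X) :
    (coeff (y :: l).length (magnusVar x * p)).coeff (FreeMonoid.ofList (y :: l)) =
      if x = y then (coeff l.length p).coeff (FreeMonoid.ofList l) else 0 := by
  rw [magnusVar, mul_assoc, coeff_C_mul, List.length_cons, coeff_succ_X_mul]
  split_ifs with h
  · subst h
    rw [MonoidAlgebra.coeff_single_mul_eq_mul_coeff (m₂ := FreeMonoid.ofList l), one_mul]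
    intro m _
    rw [FreeMonoid.ofList_cons, mul_right_inj]
  · apply MonoidAlgebra.coeff_single_mul_of_forall_mul_ne
    intro d hd
    have := congrArg FreeMonoid.toList hd
    simp at this
    exact h this.1

theorem magnus_of_mul (x : X) (w : FreeGroup X) :
    (magnus X (of x * w) : MagnusRing X) =
      (magnus X w : MagnusRing X) + magnusVar x * (magnus X w : MagnusRing X) := by
  rw [_root_.map_mul, Units.val_mul, magnus, lift_apply_of]
  simp [magnusUnit, add_mul]

open Classical in
theorem magnusCoeff_of_mul_cons (x y : X) (w : FreeGroup X) (l : List X) :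
    magnusCoeff (of x * w) (y :: l) =
      magnusCoeff w (y :: l) + if x = y then magnusCoeff w l else 0 := by
  rw [magnusCoeff, magnus_of_mul, map_add, MonoidAlgebra.coeff_add, Finsupp.add_apply,
    coeff_magnusVar_mul]
  rfl

theorem magnusCoeff_of_mul_nil (x : X) (w : FreeGroup X) :
    magnusCoeff (of x * w) [] = magnusCoeff w [] := by
  rw [magnusCoeff, magnus_of_mul, map_add, MonoidAlgebra.coeff_add, Finsupp.add_apply,
    List.length_nil, coeff_magnusVar_mul_nil]
  simp [magnusCoeff]

theorem magnusCoeff_of_mul_of_head_ne (x : X) (w : FreeGroup X) (l : List X)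
    (h : l.head? ≠ some x) : magnusCoeff (of x * w) l = magnusCoeff w l := by
  cases l with
  | nil => exact magnusCoeff_of_mul_nil x w
  | cons y l =>
    rw [magnusCoeff_of_mul_cons, if_neg, add_zero]
    rintro rfl
    simp at h

theorem magnusCoeff_inv_mul_of_head_ne (x : X) (w : FreeGroup X) (l : List X)
    (h : l.head? ≠ some x) : magnusCoeff ((of x)⁻¹ * w) l = magnusCoeff w l := by
  have := magnusCoeff_of_mul_of_head_ne x ((of x)⁻¹ * w) l h
  rwa [mul_inv_cancel_left, eq_comm] at this

theorem magnusCoeff_inv_mul_cons (x : X) (w : FreeGroup X) (l : List X)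
    (h : l.head? ≠ some x) :
    magnusCoeff ((of x)⁻¹ * w) (x :: l) = magnusCoeff w (x :: l) - magnusCoeff w l := by
  have := magnusCoeff_of_mul_cons x x ((of x)⁻¹ * w) l
  rw [mul_inv_cancel_left, if_pos rfl, magnusCoeff_inv_mul_of_head_ne x w l h] at this
  omega

theorem magnusCoeff_one_cons (y : X) (l : List X) : magnusCoeff (1 : FreeGroup X) (y :: l) = 0 := by
  simp [magnusCoeff, coeff_one]

theorem magnusCoeff_one_nil : magnusCoeff (1 : FreeGroup X) [] = 1 := by
  simp [magnusCoeff, MonoidAlgebra.one_def]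

/-- The sign of a letter. -/
def letterSign (b : Bool) : ℤ := cond b 1 (-1)

/-- A letter of a word as an element of the free group. -/
def letter (a : X × Bool) : FreeGroup X := cond a.2 (of a.1) (of a.1)⁻¹

theorem mk_cons (a : X × Bool) (L : List (X × Bool)) : mk (a :: L) = letter a * mk L := by
  obtain ⟨x, b⟩ := a
  cases b <;> simp [letter, of, invRev]

theorem magnusCoeff_letter_mul_of_head_ne (x : X) (b : Bool) (w : FreeGroup X) (l : List X)
    (h : l.head? ≠ some x) : magnusCoeff (letter (x, b) * w) l = magnusCoeff w l := by
  cases b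
  · exact magnusCoeff_inv_mul_of_head_ne x w l h
  · exact magnusCoeff_of_mul_of_head_ne x w l h

theorem magnusCoeff_letter_mul_cons (x : X) (b : Bool) (w : FreeGroup X) (l : List X)
    (h : l.head? ≠ some x) : magnusCoeff (letter (x, b) * w) (x :: l) =
      magnusCoeff w (x :: l) + letterSign b * magnusCoeff w l := by
  cases b
  · have := magnusCoeff_inv_mul_cons x w l h
    rw [letter, letterSign, cond, cond, this]
    ring
  · have := magnusCoeff_of_mul_cons x x w l
    rw [if_pos rfl] at this
    rw [letter, letterSign, cond, cond, this, one_mul]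

theorem exists_magnusCoeff_ne_zero (L : List (X × Bool)) (a : X × Bool)
    (hL : IsReduced (a :: L)) :
    ∃ (T : List X) (p : ℤ) (k : ℕ), T.head? ≠ some a.1 ∧ T.IsChain (· ≠ ·) ∧ p ≠ 0 ∧ k ≠ 0 ∧
      magnusCoeff (mk (a :: L)) (a.1 :: T) = letterSign a.2 * k * p ∧
      magnusCoeff (mk (a :: L)) T = p ∧
      (∀ l : List X, l.IsChain (· ≠ ·) → T.length + 1 < l.length →
        magnusCoeff (mk (a :: L)) l = 0) ∧
      (∀ l : List X, l.IsChain (· ≠ ·) → l.length = T.length + 1 → l.head? ≠ some a.1 →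
        magnusCoeff (mk (a :: L)) l = 0) := by
  have key : ∀ (w : FreeGroup X) (x : X) (b : Bool) (l : List X) (n : ℕ) , l.IsChain (· ≠ ·) →
      n + 1 < l.length → (∀ l : List X, l.IsChain (· ≠ ·) → n + 1 < l.length →
        magnusCoeff w l = 0) →
      (∀ l : List X, l.IsChain (· ≠ ·) → l.length = n + 1 → l.head? ≠ some x →
        magnusCoeff w l = 0) → magnusCoeff (letter (x, b) * w) l = 0 := by
    intro w x b l n hl hn h1 h2
    by_cases hx : l.head? = some x
    · cases l with
      | nil => simp at hx
      | cons y l =>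
        obtain rfl : y = x := by simpa using hx
        have hy : l.head? ≠ some y := by
          cases l with
          | nil => simp
          | cons z l =>
            rw [List.isChain_cons_cons] at hl
            simpa using fun h => hl.1 h.symm
        rw [magnusCoeff_letter_mul_cons _ _ _ _ hy, h1 _ hl hn, zero_add]
        have hl' : l.IsChain (· ≠ ·) := hl.tail
        rw [List.length_cons] at hn
        rcases Nat.lt_or_ge (n + 1) l.length with h | h
        · rw [h1 _ hl' h, mul_zero]
        · rw [h2 _ hl' (by omega) hy, mul_zero]
    · rw [magnusCoeff_letter_mul_of_head_ne _ _ _ _ hx, h1 _ hl hn]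
  induction L generalizing a with
  | nil =>
    obtain ⟨x, b⟩ := a
    refine ⟨[], 1, 1, by simp, by simp, one_ne_zero, one_ne_zero, ?_, ?_, ?_, ?_⟩
    · rw [mk_cons, magnusCoeff_letter_mul_cons _ _ _ _ (by simp), ← one_eq_mk,
        magnusCoeff_one_cons, magnusCoeff_one_nil]
      simp
    · rw [mk_cons, magnusCoeff_letter_mul_of_head_ne _ _ _ _ (by simp), ← one_eq_mk,
        magnusCoeff_one_nil]
    · intro l hl hn
      rw [mk_cons, ← one_eq_mk]
      refine key _ _ _ l 0 hl (by simpa using hn) ?_ ?_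
      · rintro (_ | ⟨y, l⟩) _ h
        · simp at h
        · exact magnusCoeff_one_cons y l
      · rintro (_ | ⟨y, l⟩) _ h
        · simp at h
        · intro _
          exact magnusCoeff_one_cons y l
    · intro l hl hn hx
      rw [mk_cons, magnusCoeff_letter_mul_of_head_ne _ _ _ _ hx, ← one_eq_mk]
      cases l with
      | nil => simp at hn
      | cons y l => exact magnusCoeff_one_cons y l
  | cons c L ih =>
    have hr := isReduced_cons_cons.1 hL
    obtain ⟨T, p, k, hT, hTc, hp, hk, h1, h2, h3, h4⟩ := ih c hr.2
    obtain ⟨x, b⟩ := a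
    obtain ⟨y, b'⟩ := c
    by_cases hxy : x = y
    · subst hxy
      obtain rfl : b = b' := hr.1 rfl
      have h2' : magnusCoeff (mk ((x, b) :: (x, b) :: L)) T = p := by
        rw [mk_cons, magnusCoeff_letter_mul_of_head_ne _ _ _ _ hT, h2]
      refine ⟨T, p, k + 1, hT, hTc, hp, by omega, ?_, h2', ?_, ?_⟩
      · rw [mk_cons, magnusCoeff_letter_mul_cons _ _ _ _ hT, h1, h2]
        push_cast
        ring
      · intro l hl hn
        rw [mk_cons]
        exact key _ _ _ l _ hl hn h3 h4
      · intro l hl hn hx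
        rw [mk_cons, magnusCoeff_letter_mul_of_head_ne _ _ _ _ hx, h4 l hl hn hx]
    · have hh : (y :: T).head? ≠ some x := by simpa using fun h => hxy h.symm
      have hc : (y :: T).IsChain (· ≠ ·) := by
        rw [List.isChain_cons]
        refine ⟨fun z hz => ?_, hTc⟩
        rintro rfl
        exact hT hz
      have hs : letterSign b' * k * p ≠ 0 := by
        have : letterSign b' ≠ 0 := by cases b' <;> simp [letterSign]
        positivity
      refine ⟨y :: T, letterSign b' * k * p, 1, hh, hc, hs, one_ne_zero, ?_, ?_, ?_, ?_⟩
      · rw [mk_cons, magnusCoeff_letter_mul_cons _ _ _ _ hh, h1, h3]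
        · simp
        · rw [List.isChain_cons_cons]
          exact ⟨hxy, hc⟩
        · simp
      · rw [mk_cons, magnusCoeff_letter_mul_of_head_ne _ _ _ _ hh, h1]
      · intro l hl hn
        rw [List.length_cons] at hn
        rw [mk_cons]
        refine key _ _ _ l (T.length + 1) hl (by omega) (fun l hl h => h3 l hl (by omega))
          (fun l hl h _ => h3 l hl (by omega))
      · intro l hl hn hx
        rw [List.length_cons] at hn
        rw [mk_cons, magnusCoeff_letter_mul_of_head_ne _ _ _ _ hx, h3 l hl (by omega)]

theorem magnus_injective : Function.Injective (magnus X) := by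
  classical
  rw [injective_iff_map_eq_one]
  intro w hw
  by_contra hne
  have h1 := isReduced_toWord (x := w)
  have h2 : mk w.toWord = w := mk_toWord
  rcases hwd : w.toWord with _ | ⟨a, L⟩
  · exact hne (toWord_eq_nil_iff.1 hwd)
  rw [hwd] at h1 h2
  obtain ⟨T, p, k, -, -, hp, hk, h, -⟩ := exists_magnusCoeff_ne_zero L a h1
  rw [h2] at h
  have h0 : magnusCoeff w (a.1 :: T) = 0 := by
    rw [← magnusCoeff_one_cons a.1 T, magnusCoeff, magnusCoeff, hw, _root_.map_one]
  have : letterSign a.2 ≠ 0 := by cases a.2 <;> simp [letterSign]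
  rw [h0] at h
  have : letterSign a.2 * k * p ≠ 0 := by positivity
  exact this h.symm

theorem constantCoeff_magnus (w : FreeGroup X) :
    constantCoeff (magnus X w : MagnusRing X) = 1 := by
  have : (Units.map (constantCoeff (R := MonoidAlgebra ℤ (FreeMonoid X))).toMonoidHom).comp
      (magnus X) = 1 := by
    ext1 x
    ext1
    simp [magnus, magnusUnit, magnusVar]
  exact congrArg Units.val (DFunLike.congr_fun this w)

/-- Free groups carry an injection into a linear order which is monotone under conjugation. -/
theorem exists_conj_strictMono (X : Type) : ∃ (O : Type) (_ : LinearOrder O) (r : FreeGroup X → O),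
    Function.Injective r ∧ ∀ a b g, r a < r b → r (g * a * g⁻¹) < r (g * b * g⁻¹) := by
  classical
  let : LinearOrder (FreeMonoid X) := linearOrderOfSTO WellOrderingRel
  let := Finsupp.Lex.linearOrder (α := FreeMonoid X) (N := ℤ)
  let : LinearOrder (Lex (ℕ → Lex (FreeMonoid X →₀ ℤ))) := Pi.Lex.linearOrder
  refine ⟨Lex (ℕ → Lex (FreeMonoid X →₀ ℤ)), inferInstance,
    fun a => toLex fun d => toLex (coeff d (magnus X a : MagnusRing X)).coeff, ?_, ?_⟩
  · intro a b h
    apply magnus_injective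
    ext1
    ext d : 1
    have := congrFun (toLex_inj.1 h) d
    exact MonoidAlgebra.coeff_inj.1 (toLex_inj.1 this)
  · rintro a b g ⟨d, hd, hlt⟩
    have hdvd : (PowerSeries.X : MagnusRing X) ^ d ∣ (magnus X a - magnus X b : MagnusRing X) := by
      rw [X_pow_dvd_iff]
      intro m hm
      rw [map_sub, sub_eq_zero]
      exact MonoidAlgebra.coeff_inj.1 (toLex_inj.1 (hd m hm))
    obtain ⟨q, hq⟩ := hdvd
    have hconj : (magnus X (g * a * g⁻¹) - magnus X (g * b * g⁻¹) : MagnusRing X) =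
        PowerSeries.X ^ d * ((magnus X g : MagnusRing X) * q * (magnus X g⁻¹ : MagnusRing X)) := by
      simp only [_root_.map_mul, Units.val_mul]
      rw [← sub_mul, ← mul_sub, hq, ← mul_assoc, ← X_pow_mul]
      simp only [mul_assoc]
    have hcd : coeff d (magnus X (g * a * g⁻¹) - magnus X (g * b * g⁻¹) : MagnusRing X) =
        coeff d (magnus X a - magnus X b : MagnusRing X) := by
      rw [hconj, hq]
      have h1 := coeff_X_pow_mul q d 0
      have h2 := coeff_X_pow_mul ((magnus X g : MagnusRing X) * q *
        (magnus X g⁻¹ : MagnusRing X)) d 0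
      rw [zero_add] at h1 h2
      rw [h1, h2]
      simp [-_root_.map_inv, constantCoeff_magnus]
    refine ⟨d, fun m hm => ?_, ?_⟩
    · have : coeff m (magnus X (g * a * g⁻¹) - magnus X (g * b * g⁻¹) : MagnusRing X) = 0 := by
        refine X_pow_dvd_iff.1 ⟨_, hconj⟩ m hm
      rw [map_sub, sub_eq_zero] at this
      exact congrArg (fun z : MonoidAlgebra ℤ (FreeMonoid X) => toLex z.coeff) this
    · rw [← sub_neg] at hlt ⊢
      rw [map_sub, map_sub] at hcd
      have := congrArg (fun z : MonoidAlgebra ℤ (FreeMonoid X) => toLex z.coeff) hcd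
      simp only [MonoidAlgebra.coeff_sub, toLex_sub] at this
      refine lt_of_eq_of_lt this hlt

end Magnus

end FreeGroup

namespace FreeGroup

variable {X : Type}

/-- The inverse of a letter. -/
def letterInv (a : X × Bool) : X × Bool := (a.1, !a.2)

@[simp] theorem letterInv_letterInv (a : X × Bool) : letterInv (letterInv a) = a := by
  simp [letterInv]

theorem letter_letterInv (a : X × Bool) : letter (letterInv a) = (letter a)⁻¹ := by
  obtain ⟨x, _ | _⟩ := a <;> simp [letter, letterInv]

/-- The product of `m` consecutive letters of a cyclic word, starting at position `k`. -/
def cycProd {n : ℕ} (l : ZMod n → X × Bool) (k : ZMod n) : ℕ → FreeGroup X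
  | 0 => 1
  | m + 1 => letter (l (k + m)) * cycProd l k m

/-- A cyclically reduced cyclic word representing the conjugacy class of `v`, none of whose
nontrivial rotations represent the same element. -/
structure CycWord (v : FreeGroup X) where
  /-- The length of the word. -/
  n : ℕ
  n_ne_zero : NeZero n
  /-- The letters of the word. -/
  l : ZMod n → X × Bool
  /-- The conjugates of `v` read off from the various starting points. -/
  rot : ZMod n → FreeGroup X
  isConj : ∀ k, IsConj v (rot k)
  rot_injective : Function.Injective rot
  rot_succ : ∀ k, rot (k + 1) = letter (l k) * rot k * (letter (l k))⁻¹
  ne_inv : ∀ k, l (k + 1) ≠ letterInv (l k)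
  cycProd_eq : ∀ k, cycProd l k n = rot k

/-- The word made from the first `m` letters of a cyclic word, in reverse order. -/
def cycList {n : ℕ} (l : ZMod n → X × Bool) : ℕ → List (X × Bool)
  | 0 => []
  | m + 1 => l m :: cycList l m

theorem length_cycList {n : ℕ} (l : ZMod n → X × Bool) (m : ℕ) : (cycList l m).length = m := by
  induction m with
  | zero => rfl
  | succ m ih => simp [cycList, ih]

theorem isReduced_cycList {n : ℕ} (l : ZMod n → X × Bool)
    (hl : ∀ k, l (k + 1) ≠ letterInv (l k)) (m : ℕ) : IsReduced (cycList l m) := by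
  induction m with
  | zero => exact IsReduced.nil
  | succ m ih =>
    cases m with
    | zero => exact IsReduced.singleton
    | succ m =>
      rw [cycList, cycList, isReduced_cons_cons]
      refine ⟨fun h => ?_, ih⟩
      by_contra h2
      apply hl m
      ext1
      · simpa [letterInv] using h
      · simpa [letterInv, Bool.eq_not] using h2

theorem norm_mk_cycList [DecidableEq X] {n : ℕ} (l : ZMod n → X × Bool)
    (hl : ∀ k, l (k + 1) ≠ letterInv (l k)) (m : ℕ) : (mk (cycList l m)).norm = m := by
  rw [norm, toWord_mk, (isReduced_cycList l hl m).reduce_eq, length_cycList]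

theorem mk_cycList_add {n : ℕ} (l : ZMod n → X × Bool) (j : ℕ) :
    mk (cycList l (j + n)) = mk (cycList l j) * mk (cycList l n) := by
  induction j with
  | zero => simp [cycList, ← one_eq_mk]
  | succ j ih =>
    rw [show j + 1 + n = (j + n) + 1 by ring, cycList, cycList, mk_cons, ih, mk_cons, mul_assoc]
    simp

theorem mk_cycList_add_mul {n : ℕ} (l : ZMod n → X × Bool) (j t : ℕ) :
    mk (cycList l (j + t * n)) = mk (cycList l j) * mk (cycList l n) ^ t := by
  induction t with
  | zero => simp
  | succ t ih =>
    rw [show j + (t + 1) * n = (j + t * n) + n by ring, mk_cycList_add, ih, pow_succ, mul_assoc]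

theorem cycProd_natCast {n : ℕ} (l : ZMod n → X × Bool) (j m : ℕ) :
    cycProd l j m = mk (cycList l (j + m)) * (mk (cycList l j))⁻¹ := by
  induction m with
  | zero => simp [cycProd, -inv_mk]
  | succ m ih => rw [cycProd, ih, ← Nat.add_assoc, cycList, mk_cons, mul_assoc]; simp

/-- A cyclic word without cancellation whose value is not a proper power. -/
def cycWordOfLetters (v : FreeGroup X) {n : ℕ} (hn : NeZero n) (l : ZMod n → X × Bool)
    (hl : ∀ k, l (k + 1) ≠ letterInv (l k)) (hv : IsConj v (mk (cycList l n)))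
    (hv1 : mk (cycList l n) ≠ 1) (hvp : ¬ IsProperPower (mk (cycList l n))) : CycWord v where
  n := n
  n_ne_zero := hn
  l := l
  rot k := mk (cycList l k.val) * mk (cycList l n) * (mk (cycList l k.val))⁻¹
  isConj k := hv.trans (isConj_iff.2 ⟨_, rfl⟩)
  rot_injective := by
    classical
    have key : ∀ i j : ℕ, i ≤ j → j < n →
        mk (cycList l i) * mk (cycList l n) * (mk (cycList l i))⁻¹ =
        mk (cycList l j) * mk (cycList l n) * (mk (cycList l j))⁻¹ → i = j := by
      intro i j hij hj h
      have hc : ((mk (cycList l i))⁻¹ * mk (cycList l j)) * mk (cycList l n) =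
          mk (cycList l n) * ((mk (cycList l i))⁻¹ * mk (cycList l j)) := by
        rw [eq_mul_inv_iff_mul_eq] at h
        rw [mul_assoc, ← h]
        group
      obtain ⟨t, ht⟩ := Subgroup.mem_zpowers_iff.1 (mem_zpowers_of_commute hv1 hvp hc)
      rw [eq_inv_mul_iff_mul_eq] at ht
      obtain ⟨s, rfl | rfl⟩ := t.eq_nat_or_neg
      · rw [zpow_natCast, ← mk_cycList_add_mul] at ht
        have := congrArg norm ht
        rw [norm_mk_cycList l hl, norm_mk_cycList l hl] at this
        rcases s with _ | s
        · simpa using this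
        · nlinarith
      · rw [zpow_neg, zpow_natCast, mul_inv_eq_iff_eq_mul, ← mk_cycList_add_mul] at ht
        have := congrArg norm ht
        rw [norm_mk_cycList l hl, norm_mk_cycList l hl] at this
        nlinarith
    intro i j h
    apply ZMod.val_injective n
    rcases le_total i.val j.val with h1 | h1
    · exact key _ _ h1 (ZMod.val_lt j) h
    · exact (key _ _ h1 (ZMod.val_lt i) h.symm).symm
  rot_succ k := by
    have hk : ∀ m : ℕ, m ≤ n → mk (cycList l (m : ZMod n).val) * mk (cycList l n) *
        (mk (cycList l (m : ZMod n).val))⁻¹ =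
        mk (cycList l m) * mk (cycList l n) * (mk (cycList l m))⁻¹ := by
      intro m hm
      rcases hm.lt_or_eq with h | rfl
      · rw [ZMod.val_natCast_of_lt h]
      · simp [cycList, ← one_eq_mk, -inv_mk, -mul_mk]
    have h1 := hk (k.val + 1) (ZMod.val_lt k)
    rw [Nat.cast_add, ZMod.natCast_zmod_val, Nat.cast_one] at h1
    rw [h1, cycList, mk_cons, ZMod.natCast_zmod_val]
    group
  ne_inv := hl
  cycProd_eq k := by
    conv_lhs => rw [← ZMod.natCast_zmod_val k, cycProd_natCast, mk_cycList_add]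

theorem nonempty_cycWord (v : FreeGroup X) (hv : v ≠ 1) (hvp : ¬ IsProperPower v) :
    Nonempty (CycWord v) := by
  classical
  obtain ⟨W, hW⟩ : ∃ W, W = reduceCyclically v.toWord := ⟨_, rfl⟩
  have hred : IsCyclicallyReduced W := hW ▸ reduceCyclically.isCyclicallyReduced isReduced_toWord
  have hconj : mk (reduceCyclically.conjugator v.toWord) * mk W *
      (mk (reduceCyclically.conjugator v.toWord))⁻¹ = v := by
    rw [inv_mk, mul_mk, mul_mk, hW, reduceCyclically.conj_conjugator_reduceCyclically, mk_toWord]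
  have hW0 : W ≠ [] := by
    rintro rfl
    rw [← one_eq_mk] at hconj
    simp [-inv_mk] at hconj
    exact hv hconj.symm
  have hne : NeZero W.length := ⟨by simpa using hW0⟩
  let w : ZMod W.length → X × Bool := fun k => W[k.val]'(ZMod.val_lt k)
  have hw : ∀ k, w k ≠ letterInv (w (k + 1)) := by
    intro k
    by_cases hk : k.val + 1 < W.length
    · have h1 : (k + 1).val = k.val + 1 := by
        rw [ZMod.val_add_of_lt]
        · rw [ZMod.val_one_eq_one_mod, Nat.mod_eq_of_lt (by omega)]
        · rw [ZMod.val_one_eq_one_mod, Nat.mod_eq_of_lt (by omega)]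
          exact hk
      have := List.isChain_iff_getElem.1 hred.1 k.val hk
      intro h
      have h2 : w (k + 1) = W[k.val + 1] := by simp only [w, h1]
      rw [h2] at h
      have h3 := this (by simpa [letterInv] using congrArg Prod.fst h)
      have h4 := congrArg Prod.snd h
      simp only [letterInv] at h4
      change W[k.val].2 = _ at h4
      rw [h3] at h4
      simp at h4
    · have h0 : k.val = W.length - 1 := by
        have := ZMod.val_lt k
        omega
      have h1 : k + 1 = 0 := by
        have : ((k.val + 1 : ℕ) : ZMod W.length) = 0 := by
          rw [h0, Nat.sub_add_cancel (Nat.pos_of_ne_zero hne.1)]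
          simp
        simpa using this
      intro h
      have h2 : w (k + 1) = W[0]'(Nat.pos_of_ne_zero hne.1) := by simp only [w, h1, ZMod.val_zero]
      have h3 : w k = W[W.length - 1]'(by have := Nat.pos_of_ne_zero hne.1; omega) := by
        simp only [w, h0]
      rw [h2, h3] at h
      have h5 := hred.2 (W[W.length - 1]'(by have := Nat.pos_of_ne_zero hne.1; omega))
        (by rw [List.getLast?_eq_getElem?]; simp) (W[0]'(Nat.pos_of_ne_zero hne.1))
        (by rw [List.head?_eq_getElem?]; simp) (by simpa [letterInv] using congrArg Prod.fst h)
      have h4 := congrArg Prod.snd h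
      simp only [letterInv] at h4
      rw [h5] at h4
      simp at h4
  let l : ZMod W.length → X × Bool := fun k => w (-1 - k)
  have hl : ∀ k, l (k + 1) ≠ letterInv (l k) := by
    intro k
    have := hw (-1 - (k + 1))
    rwa [show (-1 - (k + 1) + 1 : ZMod W.length) = -1 - k by ring] at this
  have hlist : ∀ j ≤ W.length, cycList l j = W.drop (W.length - j) := by
    intro j
    induction j with
    | zero => intro _; simp [cycList]
    | succ j ih =>
      intro hj
      rw [cycList, ih (by omega), List.drop_eq_getElem_cons (i := W.length - (j + 1)) (by omega),
        show W.length - (j + 1) + 1 = W.length - j by omega]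
      congr 1
      have h1 : (-1 - (j : ZMod W.length)) = ((W.length - (j + 1) : ℕ) : ZMod W.length) := by
        rw [Nat.cast_sub hj]
        simp
        ring
      have h2 : (-1 - (j : ZMod W.length)).val = W.length - (j + 1) := by
        rw [h1, ZMod.val_natCast_of_lt (by omega)]
      simp only [l, w, h2]
  have hval : cycList l W.length = W := by simpa using hlist _ le_rfl
  refine ⟨cycWordOfLetters v hne l hl ?_ ?_ ?_⟩
  · rw [hval]
    exact (isConj_iff.2 ⟨_, hconj⟩).symm
  · rw [hval]
    intro h
    rw [h] at hconj
    simp [-inv_mk] at hconj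
    exact hv hconj.symm
  · rw [hval]
    intro h
    rw [← IsProperPower.conj_iff (mk (reduceCyclically.conjugator v.toWord)), hconj] at h
    exact hvp h

end FreeGroup

namespace FreeGroup

section Chains

variable {X Y : Type} [MulAction (FreeGroup X) Y]

/-- The action of a generator on pairs of a vertex and a chain of edges modulo two: the edge
traversed is added to the chain. -/
noncomputable def chainPerm (x : X) : Equiv.Perm (Y × (Y × X →₀ ZMod 2)) where
  toFun p := (of x • p.1, p.2 + Finsupp.single (p.1, x) 1)
  invFun p := ((of x)⁻¹ • p.1, p.2 - Finsupp.single ((of x)⁻¹ • p.1, x) 1)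
  left_inv p := by simp
  right_inv p := by simp

/-- The action of the free group on pairs of a vertex and a chain of edges modulo two. -/
noncomputable def chainHom (X Y : Type) [MulAction (FreeGroup X) Y] :
    FreeGroup X →* Equiv.Perm (Y × (Y × X →₀ ZMod 2)) :=
  FreeGroup.lift chainPerm

/-- The chain modulo two of edges traversed by a word, read from a starting vertex. -/
noncomputable def chain (w : FreeGroup X) (y : Y) : Y × X →₀ ZMod 2 := (chainHom X Y w (y, 0)).2

theorem chainHom_apply (w : FreeGroup X) (y : Y) (c : Y × X →₀ ZMod 2) :
    chainHom X Y w (y, c) = (w • y, c + chain w y) := by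
  suffices h : ∀ w : FreeGroup X, ∀ y : Y, ∃ d, ∀ c, chainHom X Y w (y, c) = (w • y, c + d) by
    obtain ⟨d, hd⟩ := h w y
    rw [chain, hd, hd, zero_add]
  intro w
  induction w using FreeGroup.induction_on with
  | C1 => intro y; exact ⟨0, fun c => by simp⟩
  | of x => intro y; exact ⟨Finsupp.single (y, x) 1, fun c => by simp [chainHom, chainPerm]⟩
  | inv_of x h =>
    intro y
    obtain ⟨d, hd⟩ := h ((of x)⁻¹ • y)
    refine ⟨-d, fun c => ?_⟩
    rw [_root_.map_inv, Equiv.Perm.inv_eq_iff_eq, hd]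
    simp
  | mul a b ha hb =>
    intro y
    obtain ⟨d, hd⟩ := hb y
    obtain ⟨e, he⟩ := ha (b • y)
    refine ⟨d + e, fun c => ?_⟩
    rw [_root_.map_mul, Equiv.Perm.mul_apply, hd, he, mul_smul, add_assoc]

theorem chain_mul (a b : FreeGroup X) (y : Y) : chain (a * b) y = chain b y + chain a (b • y) := by
  have h := chainHom_apply (a * b) y 0
  rw [_root_.map_mul, Equiv.Perm.mul_apply, chainHom_apply, chainHom_apply] at h
  simpa using (congrArg Prod.snd h).symm

@[simp] theorem chain_one (y : Y) : chain (1 : FreeGroup X) y = 0 := by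
  simp [chain]

theorem chain_of (x : X) (y : Y) : chain (of x) y = Finsupp.single (y, x) 1 := by
  simp [chain, chainHom, chainPerm]

theorem chain_inv_smul (a : FreeGroup X) (y : Y) : chain a⁻¹ (a • y) = - chain a y := by
  have := chain_mul a⁻¹ a y
  rw [inv_mul_cancel, chain_one] at this
  exact (neg_eq_of_add_eq_zero_right this.symm).symm

theorem neg_eq_self_of_zmod_two {α : Type} (d : α →₀ ZMod 2) : -d = d := by
  ext e
  simp

/-- The edge traversed by a letter read from a vertex. -/
def edge (y : Y) (a : X × Bool) : Y × X := cond a.2 (y, a.1) ((of a.1)⁻¹ • y, a.1)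

theorem chain_letter (a : X × Bool) (y : Y) :
    chain (letter a) y = Finsupp.single (edge y a) 1 := by
  obtain ⟨x, _ | _⟩ := a
  · have := chain_inv_smul (of x) ((of x)⁻¹ • y)
    rw [smul_inv_smul, chain_of, neg_eq_self_of_zmod_two] at this
    exact this
  · exact chain_of x y

theorem edge_letterInv (a : X × Bool) (y : Y) : edge (letter a • y) (letterInv a) = edge y a := by
  obtain ⟨x, _ | _⟩ := a <;> simp [edge, letter, letterInv]

theorem eq_or_of_edge_eq {y y' : Y} {a a' : X × Bool} (h : edge y a = edge y' a') :
    (y = y' ∧ a = a') ∨ (y' = letter a • y ∧ a' = letterInv a) := by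
  obtain ⟨x, b⟩ := a
  obtain ⟨x', b'⟩ := a'
  cases b <;> cases b' <;> simp only [edge, cond, Prod.mk.injEq] at h <;> obtain ⟨h, rfl⟩ := h
  · left; simpa using h
  · right; simp [letter, letterInv, h]
  · right; simp [letter, letterInv, h]
  · left; simp [h]

/-- The closed chains read off generators of a vertex stabilizer span all closed chains. -/
theorem chain_mem_span {y₀ : Y} (htr : ∀ y : Y, ∃ s : FreeGroup X, s • y₀ = y) {n : ℕ}
    {f : Fin n → FreeGroup X} (hf : Subgroup.closure (Set.range f) = MulAction.stabilizer _ y₀)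
    {m : FreeGroup X} {y : Y} (hm : m • y = y) :
    chain m y ∈ Submodule.span (ZMod 2) (Set.range fun i => chain (f i) y₀) := by
  have key : ∀ m ∈ Subgroup.closure (Set.range f), m • y₀ = y₀ ∧
      chain m y₀ ∈ Submodule.span (ZMod 2) (Set.range fun i => chain (f i) y₀) := by
    intro m hm
    induction hm using Subgroup.closure_induction with
    | mem m hm =>
      obtain ⟨i, rfl⟩ := hm
      refine ⟨?_, Submodule.subset_span ⟨i, rfl⟩⟩
      have : f i ∈ MulAction.stabilizer (FreeGroup X) y₀ := hf ▸ Subgroup.subset_closure ⟨i, rfl⟩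
      exact this
    | one => simp
    | mul a b _ _ ha hb =>
      refine ⟨by rw [mul_smul, hb.1, ha.1], ?_⟩
      rw [chain_mul, hb.1]
      exact add_mem hb.2 ha.2
    | inv a _ ha =>
      have h1 : a⁻¹ • y₀ = y₀ := by rw [inv_smul_eq_iff, ha.1]
      refine ⟨h1, ?_⟩
      have := chain_inv_smul a y₀
      rw [ha.1] at this
      rw [this]
      exact neg_mem ha.2
  obtain ⟨s, rfl⟩ := htr y
  have h1 : s⁻¹ * m * s ∈ Subgroup.closure (Set.range f) := by
    rw [hf, MulAction.mem_stabilizer_iff, mul_smul, mul_smul, hm, inv_smul_smul]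
  have h2 := (key _ h1).2
  rw [chain_mul, chain_mul, hm, chain_inv_smul] at h2
  simpa using h2

theorem card_add_card_le_of_chain {y₀ : Y} (htr : ∀ y : Y, ∃ s : FreeGroup X, s • y₀ = y) {n : ℕ}
    {f : Fin n → FreeGroup X} (hf : Subgroup.closure (Set.range f) = MulAction.stabilizer _ y₀)
    (E : Finset (Y × X)) (V W : Finset Y) (hWV : W ⊆ V)
    (hE : ∀ e ∈ E, e.1 ∈ V ∧ of e.2 • e.1 ∈ V) (β : Y → Y) (hβ : ∀ w ∈ W, β w = w)
    (hβE : ∀ e ∈ E, β (of e.2 • e.1) = β e.1) :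
    E.card + W.card ≤ V.card + n := by
  classical
  choose s hs using htr
  let D : Y → (Y × X →₀ ZMod 2) := fun y => chain (s y) y₀ - chain (s (β y)) y₀
  let S : Finset (Y × X →₀ ZMod 2) :=
    Finset.univ.image (fun i => chain (f i) y₀) ∪ (V \ W).image D
  have hD : ∀ y ∈ V, D y ∈ Submodule.span (ZMod 2) (S : Set (Y × X →₀ ZMod 2)) := by
    intro y hy
    by_cases hw : y ∈ W
    · have : D y = 0 := by simp only [D, hβ y hw, sub_self]
      rw [this]
      exact zero_mem _
    · apply Submodule.subset_span
      simp only [S, Finset.coe_union, Finset.coe_image]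
      exact Or.inr ⟨y, by simp [hy, hw], rfl⟩
  have hsub : Submodule.span (ZMod 2) (Set.range fun i => chain (f i) y₀) ≤
      Submodule.span (ZMod 2) (S : Set (Y × X →₀ ZMod 2)) := by
    apply Submodule.span_mono
    rintro _ ⟨i, rfl⟩
    simp only [S, Finset.coe_union, Finset.coe_image]
    exact Or.inl ⟨i, by simp, rfl⟩
  have hmem : ∀ e ∈ E, Finsupp.single e (1 : ZMod 2) ∈
      Submodule.span (ZMod 2) (S : Set (Y × X →₀ ZMod 2)) := by
    rintro ⟨y, x⟩ he
    have hV := hE _ he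
    have h1 : ((s (of x • y))⁻¹ * of x * s y) • y₀ = y₀ := by
      rw [mul_smul, mul_smul, hs, inv_smul_eq_iff, hs]
    have h2 := hsub (chain_mem_span (fun y => ⟨s y, hs y⟩) hf h1)
    have h3 := chain_inv_smul (s (of x • y)) y₀
    rw [hs] at h3
    rw [chain_mul, chain_mul, hs, h3, chain_of] at h2
    have h4 : Finsupp.single (y, x) (1 : ZMod 2) = chain (s y) y₀ +
        (Finsupp.single (y, x) 1 + -chain (s (of x • y)) y₀) + D (of x • y) - D y := by
      simp only [D]
      have := hβE _ he
      simp only at this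
      rw [this]
      abel
    rw [h4]
    exact sub_mem (add_mem h2 (hD _ hV.2)) (hD _ hV.1)
  have hli : LinearIndependent (ZMod 2) (fun e : E => Finsupp.single e.1 (1 : ZMod 2)) :=
    (Finsupp.linearIndependent_single_one (ZMod 2) (Y × X)).comp _ Subtype.val_injective
  have hfin := finrank_span_eq_card hli
  rw [Fintype.card_coe] at hfin
  have hle : Module.finrank (ZMod 2) (Submodule.span (ZMod 2)
      (Set.range fun e : E => Finsupp.single e.1 (1 : ZMod 2))) ≤
      Module.finrank (ZMod 2) (Submodule.span (ZMod 2) (S : Set (Y × X →₀ ZMod 2))) := by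
    apply Submodule.finrank_mono
    rw [Submodule.span_le]
    rintro _ ⟨e, rfl⟩
    exact hmem e.1 e.2
  have h1 := finrank_span_finset_le_card (R := ZMod 2) S
  have h2 : S.card ≤ n + (V.card - W.card) := by
    refine (Finset.card_union_le _ _).trans (add_le_add ?_ ?_)
    · simpa using Finset.card_image_le (s := Finset.univ) (f := fun i => chain (f i) y₀)
    · rw [← Finset.card_sdiff_of_subset hWV]
      exact Finset.card_image_le
  have h3 := Finset.card_le_card hWV
  rw [Set.finrank] at h1
  omega

/-- If a vertex stabilizer is generated by two elements, there are at most four closed chains. -/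
theorem exists_chain_eq {y₀ : Y} (htr : ∀ y : Y, ∃ s : FreeGroup X, s • y₀ = y)
    {f : Fin 2 → FreeGroup X} (hf : Subgroup.closure (Set.range f) = MulAction.stabilizer _ y₀)
    {ι : Type} [Fintype ι] (hι : 4 < Fintype.card ι)
    (m : ι → FreeGroup X) (y : ι → Y) (hm : ∀ i, m i • y i = y i) :
    ∃ i j, i ≠ j ∧ chain (m i) (y i) = chain (m j) (y j) := by
  have h := fun i => (Submodule.mem_span_range_iff_exists_fun (ZMod 2)).1
    (chain_mem_span htr hf (hm i))
  choose c hc using h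
  obtain ⟨i, j, hij, he⟩ := Fintype.exists_ne_map_eq_of_card_lt c (by simpa using hι)
  exact ⟨i, j, hij, by rw [← hc, ← hc, he]⟩

end Chains

end FreeGroup

namespace FreeGroup

section Top

variable {X Y : Type} [MulAction (FreeGroup X) Y] {v : FreeGroup X} (w : CycWord v)

/-- Reading one letter of a cyclic word from a vertex. -/
noncomputable def CycWord.step (Y : Type) [MulAction (FreeGroup X) Y] :
    Equiv.Perm (Y × ZMod w.n) where
  toFun a := (letter (w.l a.2) • a.1, a.2 + 1)
  invFun a := ((letter (w.l (a.2 - 1)))⁻¹ • a.1, a.2 - 1)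
  left_inv a := by simp
  right_inv a := by simp

theorem CycWord.step_apply (a : Y × ZMod w.n) :
    w.step Y a = (letter (w.l a.2) • a.1, a.2 + 1) := rfl

theorem CycWord.step_pow_apply (m : ℕ) (a : Y × ZMod w.n) :
    (w.step Y ^ m) a = (cycProd w.l a.2 m • a.1, a.2 + m) := by
  induction m with
  | zero => simp [cycProd]
  | succ m ih =>
    rw [pow_succ', Equiv.Perm.mul_apply, ih, CycWord.step_apply, cycProd, mul_smul]
    simp [add_assoc]

/-- An order on the positions of a cyclic word, compatible with reading letters. -/
structure CycWord.IsOrder {O : Type} [LinearOrder O] (ρ : ZMod w.n → O) : Prop where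
  injective : Function.Injective ρ
  lt_iff_of_eq : ∀ k k', w.l k = w.l k' → (ρ k < ρ k' ↔ ρ (k + 1) < ρ (k' + 1))
  lt_iff_of_inv : ∀ k k', w.l k = letterInv (w.l k') → (ρ k < ρ (k' + 1) ↔ ρ (k + 1) < ρ k')

theorem CycWord.IsOrder.dual {w : CycWord v} {O : Type} [LinearOrder O] {ρ : ZMod w.n → O}
    (h : w.IsOrder ρ) : w.IsOrder (fun k => OrderDual.toDual (ρ k)) where
  injective k k' e := h.injective (OrderDual.toDual.injective e)
  lt_iff_of_eq k k' e := h.lt_iff_of_eq k' k e.symm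
  lt_iff_of_inv k k' e := by
    have := h.lt_iff_of_inv k' k (by rw [e, letterInv_letterInv])
    simpa only [OrderDual.toDual_lt_toDual] using this.symm

theorem CycWord.exists_isOrder : ∃ (O : Type) (_ : LinearOrder O) (ρ : ZMod w.n → O),
    w.IsOrder ρ := by
  obtain ⟨O, _, r, hr, hc⟩ := exists_conj_strictMono X
  have hiff : ∀ a b g, r (g * a * g⁻¹) < r (g * b * g⁻¹) ↔ r a < r b := by
    refine fun a b g => ⟨fun h => ?_, hc a b g⟩
    have := hc _ _ g⁻¹ h
    simpa [mul_assoc] using this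
  refine ⟨O, inferInstance, fun k => r (w.rot k), hr.comp w.rot_injective, ?_, ?_⟩
  · intro k k' h
    rw [w.rot_succ, w.rot_succ, ← h, hiff]
  · intro k k' h
    have h1 : w.rot k' = letter (w.l k) * w.rot (k' + 1) * (letter (w.l k))⁻¹ := by
      rw [w.rot_succ, h, letter_letterInv]
      group
    rw [w.rot_succ k, h1, hiff]

variable {w} {O : Type} [LinearOrder O] {ρ : ZMod w.n → O}

/-- A flag is on top if its position is largest among the flags of `A` at the same vertex. -/
def IsTop (ρ : ZMod w.n → O) (A : Finset (Y × ZMod w.n)) (a : Y × ZMod w.n) : Prop :=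
  ∀ b ∈ A, b.1 = a.1 → ρ b.2 ≤ ρ a.2

theorem IsTop.eq {A : Finset (Y × ZMod w.n)} (hρ : w.IsOrder ρ) {a b : Y × ZMod w.n}
    (ha : a ∈ A) (hb : b ∈ A) (h : a.1 = b.1) (hta : IsTop ρ A a) (htb : IsTop ρ A b) : a = b :=
  Prod.ext h (hρ.injective (le_antisymm (htb a ha h) (hta b hb h.symm)))

theorem edge_injOn_top {A : Finset (Y × ZMod w.n)} (hρ : w.IsOrder ρ)
    (hA : ∀ a ∈ A, w.step Y a ∈ A) {a a' : Y × ZMod w.n} (ha : a ∈ A) (ha' : a' ∈ A)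
    (hta : IsTop ρ A a ∨ IsTop ρ A (w.step Y a)) (hta' : IsTop ρ A a' ∨ IsTop ρ A (w.step Y a'))
    (h : edge a.1 (w.l a.2) = edge a'.1 (w.l a'.2)) : a = a' := by
  obtain ⟨y, k⟩ := a
  obtain ⟨y', k'⟩ := a'
  have hs := hA _ ha
  have hs' := hA _ ha'
  rw [CycWord.step_apply] at hta hta' hs hs'
  have key : ∀ y k k', (y, k) ∈ A → (y, k') ∈ A →
      (letter (w.l k) • y, k + 1) ∈ A → (letter (w.l k') • y, k' + 1) ∈ A →
      IsTop ρ A (y, k) → IsTop ρ A (letter (w.l k') • y, k' + 1) → w.l k = w.l k' → k = k' := by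
    intro y k k' ha ha' hs hs' h1 h2 h
    by_contra hne
    have h3 := lt_of_le_of_ne (h1 _ ha' rfl) (hρ.injective.ne (Ne.symm hne))
    have h4 := (hρ.lt_iff_of_eq k' k h.symm).1 h3
    exact absurd (h2 _ hs (by rw [h])) (not_le.2 h4)
  rcases eq_or_of_edge_eq h with ⟨h1, h2⟩ | ⟨h1, h2⟩
  · simp only at h1 h2
    subst h1
    congr 1
    rcases hta with hta | hta <;> rcases hta' with hta' | hta'
    · exact congrArg Prod.snd (hta.eq hρ ha ha' rfl hta')
    · exact key y k k' ha ha' hs hs' hta hta' h2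
    · exact (key y k' k ha' ha hs' hs hta' hta h2.symm).symm
    · exact add_right_cancel (congrArg Prod.snd (hta.eq hρ hs hs' (by simp only [h2]) hta'))
  · exfalso
    simp only at h1 h2 hs hs' hta hta'
    have h3 : letter (w.l k') • y' = y := by rw [h1, h2, letter_letterInv, inv_smul_smul]
    rw [h3] at hs' hta'
    rw [← h1] at hs hta
    have hk : k ≠ k' + 1 := by
      rintro rfl
      exact w.ne_inv k' (by rw [h2, letterInv_letterInv])
    have hk' : k' ≠ k + 1 := by
      rintro rfl
      exact w.ne_inv k h2
    have hiff := hρ.lt_iff_of_inv k k' (by rw [h2, letterInv_letterInv])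
    rcases hta with hta | hta <;> rcases hta' with hta' | hta'
    · have h4 := hta _ hs' rfl
      have h5 := hta' _ hs rfl
      have h6 := lt_of_le_of_ne h5 (hρ.injective.ne hk'.symm)
      exact absurd h4 (not_le.2 (hiff.2 h6))
    · exact hk (congrArg Prod.snd (hta.eq hρ ha hs' rfl hta'))
    · exact hk' (congrArg Prod.snd (hta'.eq hρ ha' hs rfl hta))
    · have h4 := lt_of_le_of_ne (hta' _ ha rfl) (hρ.injective.ne hk)
      exact absurd (hta _ ha' rfl) (not_le.2 (hiff.1 h4))

open Classical in
theorem card_descents_le {y₀ : Y} (htr : ∀ y : Y, ∃ s : FreeGroup X, s • y₀ = y)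
    {f : Fin 2 → FreeGroup X} (hf : Subgroup.closure (Set.range f) = MulAction.stabilizer _ y₀)
    {A : Finset (Y × ZMod w.n)} (hρ : w.IsOrder ρ) (hA : ∀ a ∈ A, w.step Y a ∈ A)
    (W : Finset Y) (hW : W ⊆ A.image Prod.fst) (β : Y → Y) (hβ : ∀ y ∈ W, β y = y)
    (hβA : ∀ a ∈ A, β (w.step Y a).1 = β a.1) :
    (A.filter fun a => ¬ IsTop ρ A a ∧ IsTop ρ A (w.step Y a)).card + W.card ≤ 2 := by
  have h1 : (A.image Prod.fst).card ≤ (A.filter fun a => IsTop ρ A a).card := by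
    refine le_trans (Finset.card_le_card ?_) (Finset.card_image_le (f := Prod.fst))
    intro y hy
    obtain ⟨a, ha, rfl⟩ := Finset.mem_image.1 hy
    obtain ⟨b, hb, hmax⟩ := Finset.exists_max_image (A.filter fun b => b.1 = a.1) (fun b => ρ b.2)
      ⟨a, by simp [ha]⟩
    rw [Finset.mem_filter] at hb
    refine Finset.mem_image.2 ⟨b, Finset.mem_filter.2 ⟨hb.1, fun c hc hcb => hmax c ?_⟩, hb.2⟩
    rw [Finset.mem_filter]
    exact ⟨hc, hcb.trans hb.2⟩
  have h2 : (A.filter fun a => IsTop ρ A a).card +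
      (A.filter fun a => ¬ IsTop ρ A a ∧ IsTop ρ A (w.step Y a)).card ≤
      (A.image fun a => edge a.1 (w.l a.2)).card := by
    rw [← Finset.card_union_of_disjoint, ← Finset.card_image_of_injOn
      (f := fun a => edge a.1 (w.l a.2))]
    · apply Finset.card_le_card
      apply Finset.image_subset_image
      intro a
      simp only [Finset.mem_union, Finset.mem_filter]
      tauto
    · intro a ha a' ha' h
      simp only [Finset.coe_union, Finset.coe_filter, Set.mem_union, Set.mem_ofPred_eq] at ha ha'
      exact edge_injOn_top hρ hA (by tauto) (by tauto) (by tauto) (by tauto) h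
    · rw [Finset.disjoint_left]
      intro a
      simp only [Finset.mem_filter]
      tauto
  have hends : ∀ e ∈ A.image (fun a => edge a.1 (w.l a.2)), ∃ a ∈ A,
      (e.1 = a.1 ∧ of e.2 • e.1 = (w.step Y a).1) ∨
        (of e.2 • e.1 = a.1 ∧ e.1 = (w.step Y a).1) := by
    intro e he
    obtain ⟨⟨y, k⟩, ha, rfl⟩ := Finset.mem_image.1 he
    refine ⟨_, ha, ?_⟩
    rw [CycWord.step_apply]
    obtain ⟨⟨x, b⟩, hx⟩ : ∃ c, c = w.l k := ⟨_, rfl⟩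
    simp only [← hx]
    cases b <;> simp [edge, letter]
  have h3 := card_add_card_le_of_chain htr hf (A.image fun a => edge a.1 (w.l a.2))
    (A.image Prod.fst) W hW (fun e he => ?_) β hβ (fun e he => ?_)
  · omega
  · obtain ⟨a, ha, ⟨h4, h5⟩ | ⟨h4, h5⟩⟩ := hends e he <;> first | rw [h5, h4] | rw [h4, h5]
    · exact ⟨Finset.mem_image_of_mem _ ha, Finset.mem_image_of_mem _ (hA _ ha)⟩
    · exact ⟨Finset.mem_image_of_mem _ (hA _ ha), Finset.mem_image_of_mem _ ha⟩
  · obtain ⟨a, ha, ⟨h4, h5⟩ | ⟨h4, h5⟩⟩ := hends e he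
    · rw [h5, h4, hβA _ ha]
    · rw [h4, h5, hβA _ ha]

/-- A finite orbit of flags. -/
structure IsFlagOrbit (S : Finset (Y × ZMod w.n)) : Prop where
  nonempty : S.Nonempty
  mem_iff : ∀ a ∈ S, ∀ b, b ∈ S ↔ ∃ m : ℕ, (w.step Y ^ m) a = b

theorem IsFlagOrbit.step_mem {S : Finset (Y × ZMod w.n)} (hS : IsFlagOrbit S) :
    ∀ a ∈ S, w.step Y a ∈ S :=
  fun a ha => (hS.mem_iff a ha _).2 ⟨1, by simp⟩

theorem IsFlagOrbit.exists_isTop (ρ : ZMod w.n → O) {S : Finset (Y × ZMod w.n)}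
    (hS : IsFlagOrbit S) (A : Finset (Y × ZMod w.n)) : ∃ a ∈ S, IsTop ρ A a := by
  have := w.n_ne_zero
  obtain ⟨a, ha⟩ := hS.nonempty
  obtain ⟨k, hk⟩ := Finite.exists_max ρ
  refine ⟨_, (hS.mem_iff a ha _).2 ⟨(k - a.2).val, rfl⟩, fun b _ _ => ?_⟩
  rw [CycWord.step_pow_apply, ZMod.natCast_zmod_val]
  simpa using hk b.2

theorem IsFlagOrbit.exists_descent (ρ : ZMod w.n → O) {S : Finset (Y × ZMod w.n)}
    (hS : IsFlagOrbit S) (A : Finset (Y × ZMod w.n)) (h : ¬ ∀ a ∈ S, IsTop ρ A a) :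
    ∃ a ∈ S, ¬ IsTop ρ A a ∧ IsTop ρ A (w.step Y a) := by
  push Not at h
  obtain ⟨a, ha, hna⟩ := h
  obtain ⟨b, hb, htb⟩ := hS.exists_isTop ρ A
  obtain ⟨m, rfl⟩ := (hS.mem_iff a ha b).1 hb
  clear hb
  induction m with
  | zero => exact absurd htb hna
  | succ m ih =>
    by_cases hm : IsTop ρ A ((w.step Y ^ m) a)
    · exact ih hm
    · refine ⟨_, (hS.mem_iff a ha _).2 ⟨m, rfl⟩, hm, ?_⟩
      rwa [pow_succ', Equiv.Perm.mul_apply] at htb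

open Classical in
theorem isTop_or_isTop {y₀ : Y} (htr : ∀ y : Y, ∃ s : FreeGroup X, s • y₀ = y)
    {f : Fin 2 → FreeGroup X} (hf : Subgroup.closure (Set.range f) = MulAction.stabilizer _ y₀)
    (hρ : w.IsOrder ρ) {S₁ S₂ : Finset (Y × ZMod w.n)} (h₁ : IsFlagOrbit S₁)
    (h₂ : IsFlagOrbit S₂) (hd : Disjoint S₁ S₂) :
    ((∀ a ∈ S₁, IsTop ρ (S₁ ∪ S₂) a) ∨ ∀ a ∈ S₂, IsTop ρ (S₁ ∪ S₂) a) ∧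
    ((∀ a ∈ S₁, ∀ b ∈ S₂, a.1 ≠ b.1) → ∀ a ∈ S₂, IsTop ρ (S₁ ∪ S₂) a) := by
  have hA : ∀ a ∈ S₁ ∪ S₂, w.step Y a ∈ S₁ ∪ S₂ := by
    intro a ha
    rw [Finset.mem_union] at ha ⊢
    exact ha.imp (h₁.step_mem a) (h₂.step_mem a)
  obtain ⟨a₁, ha₁⟩ := h₁.nonempty
  obtain ⟨a₂, ha₂⟩ := h₂.nonempty
  constructor
  · by_contra hc
    rw [not_or] at hc
    obtain ⟨b₁, hb₁, hb₁'⟩ := h₁.exists_descent ρ (S₁ ∪ S₂) hc.1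
    obtain ⟨b₂, hb₂, hb₂'⟩ := h₂.exists_descent ρ (S₁ ∪ S₂) hc.2
    have h3 := card_descents_le htr hf hρ hA {a₁.1}
      (by simpa using ⟨a₁.2, Or.inl ha₁⟩) (fun _ => a₁.1) (by simp) (by simp)
    have h4 : ({b₁, b₂} : Finset (Y × ZMod w.n)).card = 2 := by
      rw [Finset.card_pair]
      rintro rfl
      exact Finset.disjoint_left.1 hd hb₁ hb₂
    have h5 : ({b₁, b₂} : Finset (Y × ZMod w.n)) ⊆ (S₁ ∪ S₂).filter
        fun a => ¬ IsTop ρ (S₁ ∪ S₂) a ∧ IsTop ρ (S₁ ∪ S₂) (w.step Y a) := by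
      intro b hb
      rw [Finset.mem_insert, Finset.mem_singleton] at hb
      rw [Finset.mem_filter, Finset.mem_union]
      rcases hb with rfl | rfl
      · exact ⟨Or.inl hb₁, hb₁'⟩
      · exact ⟨Or.inr hb₂, hb₂'⟩
    have h6 := Finset.card_le_card h5
    rw [Finset.card_singleton] at h3
    omega
  · intro hne
    by_contra hc
    obtain ⟨b, hb, hb'⟩ := h₂.exists_descent ρ (S₁ ∪ S₂) hc
    have hS₁ : ∀ a ∈ S₁, (∃ c ∈ S₁, c.1 = a.1) := fun a ha => ⟨a, ha, rfl⟩
    have hS₂ : ∀ a ∈ S₂, ¬ (∃ c ∈ S₁, c.1 = a.1) := by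
      rintro a ha ⟨c, hc, h⟩
      exact hne c hc a ha h
    have h3 := card_descents_le htr hf hρ hA {a₁.1, a₂.1}
      (by
        intro y hy
        rw [Finset.mem_insert, Finset.mem_singleton] at hy
        rw [Finset.mem_image]
        rcases hy with rfl | rfl
        · exact ⟨a₁, Finset.mem_union_left _ ha₁, rfl⟩
        · exact ⟨a₂, Finset.mem_union_right _ ha₂, rfl⟩)
      (fun y => if ∃ c ∈ S₁, c.1 = y then a₁.1 else a₂.1)
      (by
        intro y hy
        rw [Finset.mem_insert, Finset.mem_singleton] at hy
        rcases hy with rfl | rfl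
        · exact if_pos (hS₁ _ ha₁)
        · exact if_neg (hS₂ _ ha₂))
      (by
        intro a ha
        rcases Finset.mem_union.1 ha with ha | ha
        · rw [if_pos (hS₁ _ ha), if_pos (hS₁ _ (h₁.step_mem _ ha))]
        · rw [if_neg (hS₂ _ ha), if_neg (hS₂ _ (h₂.step_mem _ ha))])
    rw [Finset.card_pair (hne _ ha₁ _ ha₂)] at h3
    have h4 : b ∈ (S₁ ∪ S₂).filter
        fun a => ¬ IsTop ρ (S₁ ∪ S₂) a ∧ IsTop ρ (S₁ ∪ S₂) (w.step Y a) := by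
      rw [Finset.mem_filter, Finset.mem_union]
      exact ⟨Or.inr hb, hb'⟩
    have := Finset.card_pos.2 ⟨b, h4⟩
    omega

/-- If a vertex stabilizer is generated by two elements, then of two disjoint finite flag orbits
of a cyclic word, the second one visits each vertex at most once. -/
theorem IsFlagOrbit.injOn {y₀ : Y} (htr : ∀ y : Y, ∃ s : FreeGroup X, s • y₀ = y)
    {f : Fin 2 → FreeGroup X} (hf : Subgroup.closure (Set.range f) = MulAction.stabilizer _ y₀)
    {S₁ S₂ : Finset (Y × ZMod w.n)} (h₁ : IsFlagOrbit S₁)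
    (h₂ : IsFlagOrbit S₂) (hd : Disjoint S₁ S₂) {a b : Y × ZMod w.n} (ha : a ∈ S₂) (hb : b ∈ S₂)
    (h : a.1 = b.1) : a = b := by
  classical
  obtain ⟨O, _, ρ, hρ⟩ := w.exists_isOrder
  obtain ⟨h3, h3'⟩ := isTop_or_isTop htr hf hρ h₁ h₂ hd
  obtain ⟨h4, h4'⟩ := isTop_or_isTop htr hf hρ.dual h₁ h₂ hd
  have hau := Finset.mem_union_right S₁ ha
  have hbu := Finset.mem_union_right S₁ hb
  suffices hT : (∀ a ∈ S₂, IsTop ρ (S₁ ∪ S₂) a) ∨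
      ∀ a ∈ S₂, IsTop (fun k => OrderDual.toDual (ρ k)) (S₁ ∪ S₂) a by
    rcases hT with hT | hT
    · exact (hT a ha).eq hρ hau hbu h (hT b hb)
    · exact (hT a ha).eq hρ.dual hau hbu h (hT b hb)
  by_contra hc
  rw [not_or] at hc
  have h5 := h3.resolve_right hc.1
  have h6 := h4.resolve_right hc.2
  refine hc.1 (h3' fun c hc d hd' hcd => ?_)
  have h7 := h5 c hc d (Finset.mem_union_right _ hd') hcd.symm
  have h8 := h6 c hc d (Finset.mem_union_right _ hd') hcd.symm
  have h9 : c = d := Prod.ext hcd (hρ.injective (le_antisymm h8 h7))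
  exact Finset.disjoint_left.1 hd hc (h9 ▸ hd')

end Top

end FreeGroup

namespace FreeGroup

section Circle

variable {X Y : Type} [MulAction (FreeGroup X) Y]

/-- A simple closed reduced path, as a periodic sequence of vertices and letters. -/
structure Circle (X Y : Type) [MulAction (FreeGroup X) Y] where
  /-- The vertices and the letters read from them. -/
  c : ℤ → Y × (X × Bool)
  step : ∀ k, (c (k + 1)).1 = letter (c k).2 • (c k).1
  ne_inv : ∀ k, (c (k + 1)).2 ≠ letterInv (c k).2
  simple : ∀ i j, (c i).1 = (c j).1 → ∀ t, c (i + t) = c (j + t)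
  periodic : ∃ N : ℕ, 0 < N ∧ c N = c 0

namespace Circle

/-- The edges of a circle. -/
def e (C : Circle X Y) (k : ℤ) : Y × X := edge (C.c k).1 (C.c k).2

/-- The reversed circle. -/
def rev (C : Circle X Y) : Circle X Y where
  c k := ((C.c (1 - k)).1, letterInv (C.c (-k)).2)
  step k := by
    have := C.step (-k)
    rw [show -k + 1 = 1 - k by ring] at this
    simp only
    rw [show 1 - (k + 1) = -k by ring, this, letter_letterInv, inv_smul_smul]
  ne_inv k h := by
    simp only [letterInv_letterInv] at h
    apply C.ne_inv (-(k + 1))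
    rw [show -(k + 1) + 1 = -k by ring, h]
  simple i j h t := by
    simp only at h ⊢
    rw [show 1 - (i + t) = 1 - i + -t by ring, show 1 - (j + t) = 1 - j + -t by ring,
      C.simple _ _ h, show -(i + t) = 1 - i + (- t - 1) by ring,
      show -(j + t) = 1 - j + (-t - 1) by ring, C.simple _ _ h]
  periodic := by
    obtain ⟨N, hN, h⟩ := C.periodic
    have h1 := C.simple _ _ (congrArg Prod.fst h)
    refine ⟨N, hN, ?_⟩
    have h2 := h1 (1 - N)
    have h3 := h1 (- N)
    rw [show (N : ℤ) + (1 - N) = 1 - 0 by ring, show (0 : ℤ) + (1 - N) = 1 - N by ring] at h2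
    rw [show (N : ℤ) + (- N) = - 0 by ring, show (0 : ℤ) + (- N) = - N by ring] at h3
    rw [h2, h3]

theorem e_rev (C : Circle X Y) (k : ℤ) : C.rev.e k = C.e (-k) := by
  rw [e, e, ← edge_letterInv (C.c (-k)).2 (C.c (-k)).1, ← C.step, show -k + 1 = 1 - k by ring]
  rfl

theorem eq_of_e_eq (C : Circle X Y) {i j : ℤ} (h : C.e i = C.e j) : C.c i = C.c j := by
  rcases eq_or_of_edge_eq h with ⟨h1, h2⟩ | ⟨h1, h2⟩
  · exact Prod.ext h1 h2
  · rw [← C.step] at h1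
    have := C.simple _ _ h1 0
    rw [add_zero, add_zero] at this
    rw [this] at h2
    exact absurd h2 (C.ne_inv i)

theorem eq_add_of_eq (C C' : Circle X Y) (h : ∀ k, ∃ j, C.e k = C'.e j) {q : ℤ}
    (h0 : C.c 0 = C'.c q) (m : ℕ) : C.c m = C'.c (q + m) := by
  induction m with
  | zero => simpa using h0
  | succ m ih =>
    have hv : (C.c (m + 1)).1 = (C'.c (q + m + 1)).1 := by rw [C.step, C'.step, ih]
    push_cast
    rw [← add_assoc]
    obtain ⟨j, hj⟩ := h (m + 1)
    rcases eq_or_of_edge_eq hj with ⟨h1, h2⟩ | ⟨h1, h2⟩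
    · have h3 : C.c (m + 1) = C'.c j := Prod.ext h1 h2
      have h4 := C'.simple _ _ (h1.symm.trans hv) 0
      rw [add_zero, add_zero] at h4
      rw [h3, h4]
    · have h3 : (C'.c (j + 1)).1 = (C'.c (q + m + 1)).1 := by
        rw [← hv, C'.step, h1, h2, letter_letterInv, inv_smul_smul]
      have h4 := C'.simple _ _ h3 (-1)
      rw [add_neg_cancel_right, add_neg_cancel_right, ← ih] at h4
      have h5 : C.c (m + 1) = C.c m := by
        apply C.eq_of_e_eq
        rw [hj, e, e, h4]
      rw [h5, ih]
      have h6 : (C'.c (q + m + 1)).1 = (C'.c (q + m)).1 := by rw [← hv, h5, ih]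
      have := C'.simple _ _ h6 0
      rw [add_zero, add_zero] at this
      rw [this]

theorem eq_add_or_eq_rev_add (C C' : Circle X Y) (h : ∀ k, ∃ j, C.e k = C'.e j) :
    (∃ q : ℤ, ∀ m : ℕ, C.c m = C'.c (q + m)) ∨ ∃ q : ℤ, ∀ m : ℕ, C.c m = C'.rev.c (q + m) := by
  obtain ⟨q, hq⟩ := h 0
  rcases eq_or_of_edge_eq hq with ⟨h1, h2⟩ | ⟨h1, h2⟩
  · exact Or.inl ⟨q, C.eq_add_of_eq C' h (Prod.ext h1 h2)⟩
  · refine Or.inr ⟨-q, C.eq_add_of_eq C'.rev (fun k => ?_) ?_⟩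
    · obtain ⟨j, hj⟩ := h k
      exact ⟨-j, by rw [hj, e_rev, neg_neg]⟩
    · simp only [rev, neg_neg]
      rw [h2, letterInv_letterInv, show 1 - -q = q + 1 by ring, C'.step, h1, h2, letter_letterInv,
        inv_smul_smul]

/-- The product of `m` consecutive letters of a circle. -/
def hol (C : Circle X Y) (k : ℤ) : ℕ → FreeGroup X
  | 0 => 1
  | m + 1 => letter (C.c (k + m)).2 * hol C k m

theorem hol_succ' (C : Circle X Y) (k : ℤ) (m : ℕ) :
    C.hol k (m + 1) = C.hol (k + 1) m * letter (C.c k).2 := by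
  induction m with
  | zero => simp [hol]
  | succ m ih =>
    rw [hol, ih, hol, mul_assoc]
    push_cast
    rw [add_assoc, add_comm 1]

theorem hol_congr (C C' : Circle X Y) {k q : ℤ} (h : ∀ m : ℕ, C.c (k + m) = C'.c (q + m)) (m : ℕ) :
    C.hol k m = C'.hol q m := by
  induction m with
  | zero => rfl
  | succ m ih => rw [hol, hol, ih, h]

theorem hol_rev (C : Circle X Y) (k : ℤ) (m : ℕ) : C.rev.hol k m = (C.hol (1 - k - m) m)⁻¹ := by
  induction m with
  | zero => simp [hol]
  | succ m ih =>
    rw [hol, ih, hol_succ', mul_inv_rev]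
    simp only [rev, letter_letterInv]
    push_cast
    rw [show 1 - k - (m + 1) + 1 = 1 - k - m by ring, show 1 - k - (m + 1) = -(k + m) by ring]

theorem hol_smul (C : Circle X Y) (k : ℤ) (m : ℕ) : C.hol k m • (C.c k).1 = (C.c (k + m)).1 := by
  induction m with
  | zero => simp [hol]
  | succ m ih =>
    rw [hol, mul_smul, ih, ← C.step]
    push_cast
    rw [add_assoc]

theorem chain_hol (C : Circle X Y) (k : ℤ) (m : ℕ) :
    chain (C.hol k m) (C.c k).1 = ∑ i ∈ Finset.range m, Finsupp.single (C.e (k + i)) 1 := by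
  induction m with
  | zero => simp [hol]
  | succ m ih => rw [hol, chain_mul, ih, hol_smul, chain_letter, Finset.sum_range_succ, e]

theorem exists_chain (C : Circle X Y) : ∃ (m : FreeGroup X) (y : Y), m • y = y ∧
    (∀ k, chain m y (C.e k) = 1) ∧ ∀ a, chain m y a = 1 → ∃ k, a = C.e k := by
  classical
  obtain ⟨hN, h⟩ := Nat.find_spec C.periodic
  have hmin := fun m => Nat.find_min C.periodic (m := m)
  set N := Nat.find C.periodic
  have hper := C.simple _ _ (congrArg Prod.fst h)
  have hinj : ∀ i j : ℕ, i < j → j < N → C.e i ≠ C.e j := by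
    intro i j hij hj he
    have h1 := C.simple _ _ (congrArg Prod.fst (C.eq_of_e_eq he)) (-i)
    refine hmin (j - i) (by omega) ⟨by omega, ?_⟩
    rw [add_neg_cancel] at h1
    rw [h1, Nat.cast_sub hij.le, sub_eq_add_neg]
  have hperiod : ∀ t : ℤ, C.c (t + N) = C.c t := by
    intro t
    have := hper t
    rwa [zero_add, add_comm] at this
  have hmod : ∀ k : ℤ, ∃ i : ℕ, i < N ∧ C.c k = C.c i := by
    intro k
    refine ⟨(k % N).toNat, ?_, ?_⟩
    · have := Int.emod_lt_of_pos k (b := N) (by exact_mod_cast hN)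
      have := Int.emod_nonneg k (b := N) (by omega)
      omega
    · rw [Int.toNat_of_nonneg (Int.emod_nonneg k (by omega))]
      have hp : Function.Periodic C.c (N : ℤ) := hperiod
      have h2 := hp.sub_zsmul_eq (x := k) (k / N)
      rw [← h2]
      congr 1
      have := Int.emod_add_mul_ediv k N
      rw [smul_eq_mul]
      linarith
  have hsum := C.chain_hol 0 N
  refine ⟨C.hol 0 N, (C.c 0).1, ?_, ?_, ?_⟩
  · rw [hol_smul, zero_add, h]
  · intro k
    obtain ⟨i, hi, hk⟩ := hmod k
    have he : C.e k = C.e i := by rw [e, e, hk]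
    rw [hsum, Finsupp.finsetSum_apply, Finset.sum_eq_single i]
    · rw [zero_add, he, Finsupp.single_eq_same]
    · intro j hj hji
      rw [Finset.mem_range] at hj
      rw [zero_add, he, Finsupp.single_eq_of_ne]
      rcases lt_or_gt_of_ne hji with h1 | h1
      · exact (hinj j i h1 hi).symm
      · exact hinj i j h1 hj
    · intro h1
      exact absurd (Finset.mem_range.2 hi) h1
  · intro a ha
    by_contra! hne
    rw [hsum, Finsupp.finsetSum_apply, Finset.sum_eq_zero] at ha
    · exact zero_ne_one ha
    · intro i _
      exact Finsupp.single_eq_of_ne (hne _)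

end Circle

end Circle

end FreeGroup

namespace FreeGroup

section Parity

variable {X Y : Type} [MulAction (FreeGroup X) Y] {v : FreeGroup X} {w : CycWord v}

theorem cycProd_add {n : ℕ} (l : ZMod n → X × Bool) (k : ZMod n) (i j : ℕ) :
    cycProd l k (i + j) = cycProd l (k + i) j * cycProd l k i := by
  induction j with
  | zero => simp [cycProd]
  | succ j ih => rw [← add_assoc, cycProd, ih, cycProd, mul_assoc, Nat.cast_add, add_assoc]

theorem CycWord.cycProd_mul (w : CycWord v) (k : ZMod w.n) (t : ℕ) :
    cycProd w.l k (w.n * t) = w.rot k ^ t := by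
  induction t with
  | zero => rfl
  | succ t ih =>
    rw [mul_add_one, cycProd_add, ih, pow_succ', Nat.cast_mul, ZMod.natCast_self, zero_mul,
      add_zero, w.cycProd_eq]

/-- A circle which is traced by reading a cyclic word. -/
structure IsReading (w : CycWord v) (C : Circle X Y) (b : ℤ → Y × ZMod w.n) : Prop where
  step : ∀ k, b (k + 1) = w.step Y (b k)
  eq : ∀ k, C.c k = ((b k).1, w.l (b k).2)

theorem IsReading.hol_eq {C : Circle X Y} {b : ℤ → Y × ZMod w.n} (h : IsReading w C b) (k : ℤ)
    (m : ℕ) : C.hol k m = cycProd w.l (b k).2 m := by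
  have hb : ∀ m : ℕ, (b (k + m)).2 = (b k).2 + m := by
    intro m
    induction m with
    | zero => simp
    | succ m ih =>
      push_cast
      rw [← add_assoc, h.step, CycWord.step_apply, ih, add_assoc]
  induction m with
  | zero => rfl
  | succ m ih => rw [Circle.hol, cycProd, ih, h.eq, hb]

theorem IsReading.hol_mul {C : Circle X Y} {b : ℤ → Y × ZMod w.n} (h : IsReading w C b) (k : ℤ)
    (t : ℕ) : C.hol k (w.n * t) = w.rot (b k).2 ^ t := by
  rw [h.hol_eq, w.cycProd_mul]

theorem IsFlagOrbit.exists_isReading {S : Finset (Y × ZMod w.n)} (hS : IsFlagOrbit S)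
    (hinj : ∀ a ∈ S, ∀ b ∈ S, a.1 = b.1 → a = b) :
    ∃ (C : Circle X Y) (b : ℤ → Y × ZMod w.n), IsReading w C b ∧ ∀ k, b k ∈ S := by
  obtain ⟨a, ha⟩ := hS.nonempty
  have hper : ∀ b ∈ S, ∃ m : ℕ, (w.step Y ^ (m + 1)) b = b := fun b hb => by
    obtain ⟨m, hm⟩ := (hS.mem_iff _ (hS.step_mem b hb) b).1 hb
    exact ⟨m, by rw [pow_succ, Equiv.Perm.mul_apply, hm]⟩
  have hmem : ∀ k : ℤ, (w.step Y ^ k) a ∈ S := by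
    intro k
    induction k with
    | zero => simpa using ha
    | succ k ih =>
      rw [add_comm, zpow_one_add, Equiv.Perm.mul_apply]
      exact hS.step_mem _ ih
    | pred k ih =>
      obtain ⟨m, hm⟩ := hper _ ih
      rw [sub_eq_add_neg, add_comm, zpow_add, zpow_neg_one, Equiv.Perm.mul_apply]
      refine (hS.mem_iff _ ih _).2 ⟨m, ?_⟩
      rw [Equiv.Perm.eq_inv_iff_eq, ← Equiv.Perm.mul_apply, ← pow_succ', hm]
  have hstep : ∀ k : ℤ, (w.step Y ^ (k + 1)) a = w.step Y ((w.step Y ^ k) a) := by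
    intro k
    rw [add_comm, zpow_one_add, Equiv.Perm.mul_apply]
  refine ⟨⟨fun k => (((w.step Y ^ k) a).1, w.l ((w.step Y ^ k) a).2), fun k => ?_, fun k => ?_,
    fun i j h t => ?_, ?_⟩, fun k => (w.step Y ^ k) a, ⟨hstep, fun k => rfl⟩, hmem⟩
  · simp only [hstep]
    rfl
  · simp only [hstep]
    exact w.ne_inv _
  · have h1 := hinj _ (hmem i) _ (hmem j) h
    have h2 : (w.step Y ^ (i + t)) a = (w.step Y ^ (j + t)) a := by
      rw [add_comm i, add_comm j, zpow_add, zpow_add, Equiv.Perm.mul_apply, h1,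
        Equiv.Perm.mul_apply]
    simp only [h2]
  · obtain ⟨m, hm⟩ := hper a ha
    refine ⟨m + 1, by omega, ?_⟩
    simp only [zpow_natCast, hm, zpow_zero, Equiv.Perm.one_apply]

theorem CycWord.exists_isFlagOrbit {a : Y × ZMod w.n} {N : ℕ} (hN : N ≠ 0)
    (h : (w.step Y ^ N) a = a) : ∃ S : Finset (Y × ZMod w.n), IsFlagOrbit S ∧ a ∈ S := by
  classical
  have hq : ∀ q : ℕ, (w.step Y ^ (N * q)) a = a := by
    intro q
    induction q with
    | zero => simp
    | succ q ih => rw [mul_add_one, pow_add, Equiv.Perm.mul_apply, h, ih]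
  have hmem : ∀ b, b ∈ (Finset.range N).image (fun i => (w.step Y ^ i) a) ↔
      ∃ m : ℕ, (w.step Y ^ m) a = b := by
    intro b
    rw [Finset.mem_image]
    constructor
    · rintro ⟨i, -, hi⟩
      exact ⟨i, hi⟩
    · rintro ⟨m, rfl⟩
      refine ⟨m % N, Finset.mem_range.2 (Nat.mod_lt _ (Nat.pos_of_ne_zero hN)), ?_⟩
      conv_rhs => rw [← Nat.mod_add_div m N, pow_add, Equiv.Perm.mul_apply, hq]
  refine ⟨(Finset.range N).image (fun i => (w.step Y ^ i) a), ⟨⟨a, (hmem a).2 ⟨0, rfl⟩⟩, ?_⟩,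
    (hmem a).2 ⟨0, rfl⟩⟩
  intro c hc b
  obtain ⟨i, rfl⟩ := (hmem c).1 hc
  rw [hmem]
  constructor
  · rintro ⟨j, rfl⟩
    refine ⟨j + (N * i - i), ?_⟩
    rw [← Equiv.Perm.mul_apply, ← pow_add, add_assoc, Nat.sub_add_cancel, pow_add,
      Equiv.Perm.mul_apply, hq]
    exact Nat.le_mul_of_pos_left _ (Nat.pos_of_ne_zero hN)
  · rintro ⟨j, rfl⟩
    exact ⟨j + i, by rw [pow_add, Equiv.Perm.mul_apply]⟩

/-- Two different orbits of points fixed by powers of `v`. -/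
def HasTwoFixed {G : Type} [Group G] (Y : Type) [MulAction G Y] (v : G) : Prop :=
  ∃ (y₁ y₂ : Y) (c₁ c₂ : ℤ), c₁ ≠ 0 ∧ c₂ ≠ 0 ∧ v ^ c₁ • y₁ = y₁ ∧ v ^ c₂ • y₂ = y₂ ∧
    ∀ k : ℤ, v ^ k • y₁ ≠ y₂

theorem HasTwoFixed.exists_isReading (w : CycWord v) (h : HasTwoFixed Y v) {y₀ : Y}
    (htr : ∀ y : Y, ∃ s : FreeGroup X, s • y₀ = y)
    {f : Fin 2 → FreeGroup X} (hf : Subgroup.closure (Set.range f) = MulAction.stabilizer _ y₀) :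
    ∃ (C C' : Circle X Y) (b b' : ℤ → Y × ZMod w.n), IsReading w C b ∧ IsReading w C' b' ∧
      ∀ i j, b i ≠ b' j := by
  obtain ⟨y₁, y₂, c₁, c₂, hc₁, hc₂, h₁, h₂, hne⟩ := h
  obtain ⟨g, hg⟩ := isConj_iff.1 (w.isConj 0)
  have hstep : ∀ (y : Y) (t : ℕ), (w.step Y ^ (w.n * t)) (g • y, 0) = (g • v ^ t • y, 0) := by
    intro y t
    rw [CycWord.step_pow_apply, w.cycProd_mul, ← hg, conj_pow]
    simp [mul_smul]
  have horb : ∀ (y : Y) (c : ℤ), c ≠ 0 → v ^ c • y = y →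
      ∃ S : Finset (Y × ZMod w.n), IsFlagOrbit S ∧ (g • y, 0) ∈ S := by
    intro y c hc hy
    refine CycWord.exists_isFlagOrbit (N := w.n * c.natAbs)
      (mul_ne_zero w.n_ne_zero.1 (Int.natAbs_ne_zero.2 hc)) ?_
    rw [hstep, ← zpow_natCast]
    rcases Int.natAbs_eq c with h | h
    · rw [← h, hy]
    · rw [h, zpow_neg] at hy
      rw [← inv_smul_eq_iff.1 hy]
  obtain ⟨S₁, hS₁, ha₁⟩ := horb y₁ c₁ hc₁ h₁
  obtain ⟨S₂, hS₂, ha₂⟩ := horb y₂ c₂ hc₂ h₂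
  have hd : Disjoint S₁ S₂ := by
    rw [Finset.disjoint_left]
    intro b hb₁ hb₂
    obtain ⟨i, rfl⟩ := (hS₁.mem_iff _ ha₁ _).1 hb₁
    obtain ⟨j, hj⟩ := (hS₂.mem_iff _ hb₂ _).1 ha₂
    rw [← Equiv.Perm.mul_apply, ← pow_add] at hj
    have hph := congrArg Prod.snd hj
    rw [CycWord.step_pow_apply] at hph
    simp only [zero_add] at hph
    obtain ⟨t, ht⟩ := (ZMod.natCast_eq_zero_iff _ _).1 hph
    rw [ht, hstep] at hj
    exact hne t (by simpa using congrArg Prod.fst hj)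
  obtain ⟨C, b, hC, hb⟩ := hS₁.exists_isReading
    (fun a ha b hb => hS₂.injOn htr hf hS₁ hd.symm ha hb)
  obtain ⟨C', b', hC', hb'⟩ := hS₂.exists_isReading
    (fun a ha b hb => hS₁.injOn htr hf hS₂ hd ha hb)
  exact ⟨C, C', b, b', hC, hC', fun i j h => Finset.disjoint_left.1 hd (hb i) (h ▸ hb' j)⟩

theorem Circle.exists_hol_eq (C C' : Circle X Y) (h : ∀ k, ∃ j, C.e k = C'.e j) (m : ℕ) :
    (∃ q, C.c 0 = C'.c q ∧ C.hol 0 m = C'.hol q m) ∨ ∃ q, C.hol 0 m = (C'.hol q m)⁻¹ := by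
  rcases C.eq_add_or_eq_rev_add C' h with ⟨q, hq⟩ | ⟨q, hq⟩
  · exact Or.inl ⟨q, by simpa using hq 0, C.hol_congr C' (by simpa using hq) m⟩
  · refine Or.inr ⟨1 - q - m, ?_⟩
    rw [← hol_rev]
    exact C.hol_congr C'.rev (by simpa using hq) m

theorem IsReading.not_match {C C' : Circle X Y} {b b' : ℤ → Y × ZMod w.n} (hv : v ≠ 1)
    (hvp : ¬ IsProperPower v) (h : IsReading w C b) (h' : IsReading w C' b')
    (hne : ∀ i j, b i ≠ b' j) : ¬ ∀ k, ∃ j, C.e k = C'.e j := by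
  intro hm
  have key := fun q => h'.hol_mul q 1
  have key0 := h.hol_mul 0 1
  simp only [pow_one] at key key0
  rcases C.exists_hol_eq C' hm (w.n * 1) with ⟨q, h1, h2⟩ | ⟨q, h2⟩
  · rw [key, key0] at h2
    rw [h.eq, h'.eq] at h1
    have h3 : (b 0).1 = (b' q).1 := (Prod.mk.inj h1).1
    exact hne 0 q (Prod.ext h3 (w.rot_injective h2))
  · rw [key, key0] at h2
    obtain ⟨g, hg⟩ := isConj_iff.1 ((w.isConj (b 0).2).trans
      (h2 ▸ isConj_iff.2 ⟨1, by simp⟩ : IsConj _ ((w.rot (b' q).2)⁻¹)))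
    obtain ⟨g', hg'⟩ := isConj_iff.1 (w.isConj (b' q).2)
    rw [← hg'] at hg
    have he : (g'⁻¹ * g) * v ^ (1 : ℤ) * (g'⁻¹ * g)⁻¹ = v ^ (-1 : ℤ) := by
      rw [zpow_one, zpow_neg_one]
      calc _ = g'⁻¹ * (g * v * g⁻¹) * g' := by group
        _ = _ := by rw [hg]; group
    obtain ⟨t, ht⟩ := mem_zpowers_of_conj_zpow hv hvp one_ne_zero he
    simp only at ht
    rw [← ht, zpow_one, zpow_neg_one, ← zpow_add_one, ← zpow_neg, ← zpow_add, ← zpow_neg_one] at he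
    rw [add_neg_cancel_comm, zpow_one] at he
    refine hv (eq_one_of_zpow_eq_one (n := 2) two_ne_zero ?_)
    rw [zpow_two]
    nth_rewrite 1 [he]
    group

theorem IsReading.not_match_of_not_isConj {u : FreeGroup X} {w' : CycWord u} {C C' : Circle X Y}
    {b : ℤ → Y × ZMod w.n} {b' : ℤ → Y × ZMod w'.n} (hv : v ≠ 1)
    (hvp : ¬ IsProperPower v) (hu : u ≠ 1) (hup : ¬ IsProperPower u) (huv : ¬ IsConj u v)
    (huv' : ¬ IsConj u v⁻¹) (h : IsReading w C b) (h' : IsReading w' C' b') :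
    ¬ ∀ k, ∃ j, C.e k = C'.e j := by
  intro hm
  have key0 := h.hol_mul 0 w'.n
  have key := fun q => h'.hol_mul q w.n
  simp only [mul_comm w'.n] at key
  obtain ⟨g, hg⟩ := isConj_iff.1 (w.isConj (b 0).2)
  have hcon : ∀ (q : ℤ) (s : ℤ), w.rot (b 0).2 ^ (w'.n : ℤ) = w'.rot (b' q).2 ^ s → False := by
    intro q s hs
    obtain ⟨g', hg'⟩ := isConj_iff.1 (w'.isConj (b' q).2)
    rw [← hg, ← hg', conj_zpow, conj_zpow] at hs
    have he : (g'⁻¹ * g) * v ^ (w'.n : ℤ) * (g'⁻¹ * g)⁻¹ = u ^ s := by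
      calc _ = g'⁻¹ * (g * v ^ (w'.n : ℤ) * g⁻¹) * g' := by group
        _ = _ := by rw [hs]; group
    rcases conj_eq_of_conj_zpow hu hup hv hvp (by exact_mod_cast w'.n_ne_zero.1) he with h | h
    · exact huv h
    · exact huv' h
  rcases C.exists_hol_eq C' hm (w.n * w'.n) with ⟨q, -, h2⟩ | ⟨q, h2⟩
  · exact hcon q w.n (by rw [zpow_natCast, zpow_natCast, ← key, ← key0, h2])
  · exact hcon q (-w.n) (by rw [zpow_neg, zpow_natCast, zpow_natCast, ← key, ← key0, h2])

/-- If a point stabilizer of a transitive action of a free group is generated by two elements,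
then of two essentially different root elements at least one has at most one finite orbit. -/
theorem not_hasTwoFixed_and {u : FreeGroup X} (hv : v ≠ 1) (hvp : ¬ IsProperPower v) (hu : u ≠ 1)
    (hup : ¬ IsProperPower u) (huv : ¬ IsConj u v) (huv' : ¬ IsConj u v⁻¹) {y₀ : Y}
    (htr : ∀ y : Y, ∃ s : FreeGroup X, s • y₀ = y)
    {f : Fin 2 → FreeGroup X} (hf : Subgroup.closure (Set.range f) = MulAction.stabilizer _ y₀) :
    ¬ (HasTwoFixed Y v ∧ HasTwoFixed Y u) := by
  rintro ⟨h₁, h₂⟩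
  obtain ⟨w⟩ := nonempty_cycWord v hv hvp
  obtain ⟨w'⟩ := nonempty_cycWord u hu hup
  obtain ⟨C₁, C₂, b₁, b₂, hC₁, hC₂, hb⟩ := h₁.exists_isReading w htr hf
  obtain ⟨D₁, D₂, d₁, d₂, hD₁, hD₂, hd⟩ := h₂.exists_isReading w' htr hf
  have hCD := fun {C C' : Circle X Y} {b b'} (h : IsReading w C b) (h' : IsReading w' C' b') =>
    h.not_match_of_not_isConj hv hvp hu hup huv huv' h'
  have hex : ∀ C : Circle X Y, ∃ p : FreeGroup X × Y, p.1 • p.2 = p.2 ∧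
      (∀ k, chain p.1 p.2 (C.e k) = 1) ∧ ∀ a, chain p.1 p.2 a = 1 → ∃ k, a = C.e k :=
    fun C => by
      obtain ⟨m, y, h⟩ := C.exists_chain
      exact ⟨(m, y), h⟩
  choose p hp1 hp2 hp3 using hex
  have hmatch : ∀ C C' : Circle X Y, chain (p C).1 (p C).2 = chain (p C').1 (p C').2 →
      ∀ k, ∃ j, C.e k = C'.e j := fun C C' h k => hp3 _ _ (h ▸ hp2 C k)
  let c : Bool × Bool → Circle X Y
    | (false, false) => C₁
    | (false, true) => C₂
    | (true, false) => D₁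
    | (true, true) => D₂
  have hc : ∀ i j, i ≠ j →
      chain (p (c i)).1 (p (c i)).2 = chain (p (c j)).1 (p (c j)).2 → False := by
    intro i j hij h
    have h12 := hmatch _ _ h
    have h21 := hmatch _ _ h.symm
    obtain ⟨_ | _, _ | _⟩ := i <;> obtain ⟨_ | _, _ | _⟩ := j <;>
      first
      | exact hij rfl
      | exact hCD ‹_› ‹_› h12
      | exact hCD ‹_› ‹_› h21
      | exact hC₁.not_match hv hvp hC₂ hb h12
      | exact hC₁.not_match hv hvp hC₂ hb h21
      | exact hD₁.not_match hu hup hD₂ hd h12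
      | exact hD₁.not_match hu hup hD₂ hd h21
  obtain ⟨i, j, hij, h⟩ := exists_chain_eq htr hf (ι := Option (Bool × Bool)) (by decide)
    (fun i => i.elim 1 fun i => (p (c i)).1) (fun i => i.elim y₀ fun i => (p (c i)).2)
    (by rintro (_ | i) <;> simp [hp1])
  have hnone : ∀ C : Circle X Y, chain 1 y₀ ≠ chain (p C).1 (p C).2 := by
    intro C h
    have := hp2 C 0
    rw [← h, chain_one] at this
    exact zero_ne_one this
  rcases i with _ | i <;> rcases j with _ | j
  · exact hij rfl
  · exact hnone _ h
  · exact hnone _ h.symm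
  · exact hc i j (fun e => hij (congrArg some e)) h

end Parity

end FreeGroup

section Final

open FreeGroup (HasTwoFixed not_hasTwoFixed_and)
open HNNExtension

theorem not_hasTwoFixed_quotient {H : Type} [Group H] [IsFreeGroup H] {u v : H} (hu : u ≠ 1)
    (hv : v ≠ 1) (hup : ¬ IsProperPower u) (hvp : ¬ IsProperPower v) (huv : ¬ IsConj u v)
    (huv' : ¬ IsConj u v⁻¹) {M : Subgroup H} (hM : GenBy M 2) :
    ¬ (HasTwoFixed (H ⧸ M) v ∧ HasTwoFixed (H ⧸ M) u) := by
  let e := IsFreeGroup.toFreeGroup H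
  let _ : MulAction (FreeGroup (IsFreeGroup.Generators H)) (H ⧸ M) :=
    MulAction.compHom _ e.symm.toMonoidHom
  have hsmul : ∀ (g : FreeGroup (IsFreeGroup.Generators H)) (y : H ⧸ M), g • y = e.symm g • y :=
    fun _ _ => rfl
  have hpp : ∀ x : H, ¬ IsProperPower x → ¬ IsProperPower (e x) := by
    rintro x hx ⟨y, k, hk, h⟩
    exact hx ⟨e.symm y, k, hk, by rw [← map_pow, h, e.symm_apply_apply]⟩
  have hconj : ∀ x y : H, ¬ IsConj x y → ¬ IsConj (e x) (e y) := by
    intro x y h h'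
    have := e.symm.toMonoidHom.map_isConj h'
    simp only [MulEquiv.toMonoidHom_eq_coe, MonoidHom.coe_coe, e.symm_apply_apply] at this
    exact h this
  have htwo : ∀ x : H, HasTwoFixed (H ⧸ M) x → HasTwoFixed (H ⧸ M) (e x) := by
    rintro x ⟨y₁, y₂, c₁, c₂, h1, h2, h3, h4, h5⟩
    refine ⟨y₁, y₂, c₁, c₂, h1, h2, ?_, ?_, fun k => ?_⟩ <;>
      simp only [hsmul, map_zpow, e.symm_apply_apply]
    · exact h3
    · exact h4
    · exact h5 k
  obtain ⟨f, hf⟩ := hM.map e.toMonoidHom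
  rintro ⟨h1, h2⟩
  refine not_hasTwoFixed_and (y₀ := (QuotientGroup.mk 1 : H ⧸ M)) (f := f) (v := e v) (u := e u)
    (by simpa using hv) (hpp v hvp) (by simpa using hu) (hpp u hup) (hconj _ _ huv)
    (by rw [← map_inv]; exact hconj _ _ huv') ?_ ?_ ⟨htwo _ h1, htwo _ h2⟩
  · intro y
    obtain ⟨h, rfl⟩ := QuotientGroup.mk_surjective y
    refine ⟨e h, ?_⟩
    rw [hsmul, e.symm_apply_apply]
    change (QuotientGroup.mk (h * 1) : H ⧸ M) = _
    rw [mul_one]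
  · rw [hf]
    ext g
    rw [MulAction.mem_stabilizer_iff, hsmul]
    change _ ↔ (QuotientGroup.mk (e.symm g * 1) : H ⧸ M) = _
    rw [mul_one, eq_comm, QuotientGroup.eq, inv_one, one_mul, Subgroup.mem_map]
    constructor
    · rintro ⟨x, hx, rfl⟩
      simpa using hx
    · exact fun h => ⟨_, h, by simp⟩

namespace HNNTree

variable {H : Type} [Group H] {A B : Subgroup H} {φ : A ≃* B}

theorem adj_smul_base_out {g : HNNExtension H A B φ} {y : Vertex φ} (h : adj φ (g • base φ) y) :
    ∃ a : H, y = (g * of a * t ^ ((1 : ℤˣ) : ℤ) : HNNExtension H A B φ) • base φ := by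
  obtain ⟨k, hk, rfl⟩ := h
  obtain ⟨a, rfl⟩ := smul_base_eq_iff.1 hk
  exact ⟨a, by simp⟩

theorem adj_smul_base_in {g : HNNExtension H A B φ} {y : Vertex φ} (h : adj φ y (g • base φ)) :
    ∃ a : H, y = (g * of a * t ^ ((-1 : ℤˣ) : ℤ) : HNNExtension H A B φ) • base φ := by
  obtain ⟨k, rfl, hk⟩ := h
  obtain ⟨a, ha⟩ := smul_base_eq_iff.1 hk
  exact ⟨a, by rw [← ha]; simp⟩

/-- The conjugate embedding of the base group fixing a vertex. -/
def vertexHom (g : HNNExtension H A B φ) : H →* HNNExtension H A B φ :=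
  (MulAut.conj g).toMonoidHom.comp of

theorem vertexHom_apply (g : HNNExtension H A B φ) (h : H) : vertexHom g h = g * of h * g⁻¹ := rfl

theorem vertexHom_injective (g : HNNExtension H A B φ) : Function.Injective (vertexHom g) :=
  (MulAut.conj g).injective.comp (of_injective _)

theorem stabilizer_le_range_vertexHom (g : HNNExtension H A B φ) :
    MulAction.stabilizer _ (g • base φ) ≤ (vertexHom g).range := by
  intro m hm
  rw [MulAction.mem_stabilizer_iff, smul_smul] at hm
  obtain ⟨a, ha⟩ := smul_base_eq_iff.1 hm.symm
  exact ⟨a, by rw [vertexHom_apply, ← ha, mul_inv_cancel_right]⟩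

theorem vertexHom_smul_neighbor_iff {g : HNNExtension H A B φ} {a k : H} {ε : ℤˣ} :
    vertexHom g k • (g * of a * t ^ (ε : ℤ) : HNNExtension H A B φ) • base φ =
      (g * of a * t ^ (ε : ℤ) : HNNExtension H A B φ) • base φ ↔
    a⁻¹ * k * a ∈ toSubgroup A B (-ε) := by
  rw [← of_smul_neighbor_iff (φ := φ), vertexHom_apply, smul_smul,
    show g * of k * g⁻¹ * (g * of a * t ^ (ε : ℤ)) = g * (of k * (of a * t ^ (ε : ℤ))) by group,
    mul_assoc g, mul_smul g, mul_smul g, smul_left_cancel_iff, mul_smul (of k)]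

theorem hasTwoFixed_of_hasTwo {c : H} {ε : ℤˣ} (hc : toSubgroup A B (-ε) = Subgroup.zpowers c)
    {r : Vertex φ → Vertex φ → Prop} {g : HNNExtension H A B φ}
    (hr : ∀ y, r (g • base φ) y →
      ∃ a : H, y = (g * of a * t ^ (ε : ℤ) : HNNExtension H A B φ) • base φ)
    {M : Subgroup (HNNExtension H A B φ)} (hM : M ≤ (vertexHom g).range)
    (h : HasTwo r M (g • base φ)) : HasTwoFixed (H ⧸ M.comap (vertexHom g)) c := by
  obtain ⟨y₁, y₂, h₁, h₂, hm₁, hm₂, hne⟩ := h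
  obtain ⟨a₁, rfl⟩ := hr _ h₁
  obtain ⟨a₂, rfl⟩ := hr _ h₂
  have key : ∀ a : H, (∃ m ∈ M, m ≠ 1 ∧
      m • (g * of a * t ^ (ε : ℤ) : HNNExtension H A B φ) • base φ =
        (g * of a * t ^ (ε : ℤ) : HNNExtension H A B φ) • base φ) →
      ∃ n : ℤ, n ≠ 0 ∧ c ^ n • (QuotientGroup.mk a⁻¹ : H ⧸ M.comap (vertexHom g)) =
        QuotientGroup.mk a⁻¹ := by
    rintro a ⟨m, hm, hm1, h⟩
    obtain ⟨k, rfl⟩ := hM hm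
    rw [vertexHom_smul_neighbor_iff, hc] at h
    obtain ⟨n, hn⟩ := Subgroup.mem_zpowers_iff.1 h
    refine ⟨n, ?_, ?_⟩
    · rintro rfl
      apply hm1
      rw [zpow_zero, eq_comm, mul_assoc, inv_mul_eq_one, eq_comm, mul_eq_right] at hn
      rw [hn, map_one]
    · rw [hn]
      change (QuotientGroup.mk (a⁻¹ * k * a * a⁻¹) : H ⧸ M.comap (vertexHom g)) = _
      rw [mul_inv_cancel_right, eq_comm, QuotientGroup.eq, inv_inv, mul_inv_cancel_left]
      exact hm
  obtain ⟨n₁, hn₁, h₁⟩ := key a₁ hm₁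
  obtain ⟨n₂, hn₂, h₂⟩ := key a₂ hm₂
  refine ⟨_, _, n₁, n₂, hn₁, hn₂, h₁, h₂, fun k h => ?_⟩
  change (QuotientGroup.mk (c ^ k * a₁⁻¹) : H ⧸ M.comap (vertexHom g)) = _ at h
  rw [eq_comm, QuotientGroup.eq, inv_inv] at h
  refine hne _ h ?_
  have h3 : vertexHom g (a₂ * c ^ k * a₂⁻¹) •
      (g * of a₂ * t ^ (ε : ℤ) : HNNExtension H A B φ) • base φ =
      (g * of a₂ * t ^ (ε : ℤ) : HNNExtension H A B φ) • base φ := by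
    rw [vertexHom_smul_neighbor_iff, hc]
    exact ⟨k, by simp only; group⟩
  rw [← h3, smul_smul, smul_smul]
  congr 1
  simp only [vertexHom_apply, map_mul, map_inv]
  group

variable [IsFreeGroup H] {u v : H} {φ : Subgroup.zpowers u ≃* Subgroup.zpowers v}

theorem not_hasTwo_and (hu : u ≠ 1) (hv : v ≠ 1) (hup : ¬ IsProperPower u)
    (hvp : ¬ IsProperPower v) (huv : ¬ IsConj u v) (huv' : ¬ IsConj u v⁻¹) (x : Vertex φ)
    (M : Subgroup (HNNExtension H _ _ φ)) (hMx : M ≤ MulAction.stabilizer _ x) (hM : GenBy M 2) :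
    ¬ (HasTwo (adj φ) M x ∧ HasTwo (fun x y => adj φ y x) M x) := by
  obtain ⟨g, rfl⟩ := exists_smul_base x
  have hMr := hMx.trans (stabilizer_le_range_vertexHom g)
  rintro ⟨h1, h2⟩
  refine not_hasTwoFixed_quotient hu hv hup hvp huv huv' (M := M.comap (vertexHom g))
    (GenBy.of_map (vertexHom g) (vertexHom_injective g) ?_)
    ⟨hasTwoFixed_of_hasTwo (ε := 1) (by simp) (fun y => adj_smul_base_out) hMr h1,
      hasTwoFixed_of_hasTwo (ε := -1) (by simp) (fun y => adj_smul_base_in) hMr h2⟩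
  rwa [Subgroup.map_comap_eq, inf_eq_right.2 hMr]

end HNNTree

end Final

/-- **3-generated subgroups of conjugacy pinched one-relator groups.**
Let `H` be a free group, `u, v ∈ H` nontrivial, neither a proper power, and `u`
not conjugate to `v` or `v⁻¹`.  Let `G = ⟨H, t | tut⁻¹ = v⟩` be the HNN extension
of `H` along the isomorphism `⟨u⟩ ≃ ⟨v⟩` sending `u` to `v`.  Then every subgroup
of `G` generated by at most three elements is free of rank at most `3`, or is a
one-relator group on three generators `⟨x₁, x₂, x₃ | r⟩`. -/
theorem threeGeneratedSubgroups_of_HNN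
    (H : Type) [Group H] [IsFreeGroup H]
    (u v : H) (hu : u ≠ 1) (hv : v ≠ 1)
    (hup : ¬ IsProperPower u) (hvp : ¬ IsProperPower v)
    (huv : ¬ IsConj u v) (huv' : ¬ IsConj u v⁻¹)
    (φ : (Subgroup.zpowers u) ≃* (Subgroup.zpowers v))
    (hφ : φ ⟨u, Subgroup.mem_zpowers u⟩ = ⟨v, Subgroup.mem_zpowers v⟩)
    (x : Fin 3 → HNNExtension H (Subgroup.zpowers u) (Subgroup.zpowers v) φ) :
    (∃ k : ℕ, k ≤ 3 ∧
        Nonempty (↥(Subgroup.closure (Set.range x)) ≃* FreeGroup (Fin k))) ∨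
      (∃ r : FreeGroup (Fin 3),
        Nonempty (↥(Subgroup.closure (Set.range x)) ≃*
          PresentedGroup ({r} : Set (FreeGroup (Fin 3))))) :=
  classify (HNNTree.isTreeAction hu hv hup hvp huv huv' φ) ⟨1, (one_smul _ _).symm, rfl⟩
    (HNNTree.not_hasTwo_and hu hv hup hvp huv huv') 3 le_rfl _ ⟨x, rfl⟩
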